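/- arXiv:1602.08242 — 2 statements merged into one kernel-verified Lean document; each statement's English description precedes it below -/
import Mathlib

section
/- Let G be a countable discrete infinite amenable group acting continuously on a compact metric space (X,d), let μ be a G-invariant Borel probability measure on X with ergodic decomposition μ = ∫_Y μ_y dπ(y) over Y = X/I_μ with projection p : X → Y, and let h(y) = h_{μ_y}(p^{-1}(y),G). Let {F_n} be a tempered Følner sequence in G with lim_{n→∞} |F_n|/log n = ∞, and let X_∞ = p^{-1}(h^{-1}({∞})) be the union of the ergodic components of infinite entropy. Then for μ-almost every x ∈ X_∞, lim_{δ→0} liminf_{n→∞} −(1/|F_n|) log μ(B_{F_n}(x,δ)) = ∞. -/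
open MeasureTheory Filter Set
open scoped Pointwise ENNReal NNReal Topology

section Defs

variable {G : Type*} [Group G] [DecidableEq G] {X : Type*}

/-- A Følner sequence: a sequence of nonempty finite subsets of `G` that is asymptotically
invariant: `|Fₙ △ gFₙ|/|Fₙ| → 0` for every `g ∈ G`. -/
def IsFolnerSeq (F : ℕ → Finset G) : Prop :=
  (∀ n, (F n).Nonempty) ∧
    ∀ g : G, Tendsto (fun n => ((symmDiff (F n) ((F n).image (g * ·))).card : ℝ) / (F n).card)
      atTop (𝓝 0)

/-- A sequence of finite subsets is tempered if `|⋃_{k<n} Fₖ⁻¹ Fₙ| ≤ C |Fₙ|` for a constant `C`. -/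
def IsTemperedSeq (F : ℕ → Finset G) : Prop :=
  ∃ C : ℝ, ∀ n : ℕ, (((Finset.range n).biUnion fun k => (F k)⁻¹ * F n).card : ℝ) ≤ C * (F n).card

/-- The growth condition `|Fₙ|/log n → ∞`. -/
def GrowthCond (F : ℕ → Finset G) : Prop :=
  Tendsto (fun n => ((F n).card : ℝ) / Real.log n) atTop atTop

variable [MetricSpace X] [MulAction G X]

/-- The Bowen ball `B_F(x,ε) = {y : d(gx, gy) < ε for all g ∈ F}`. -/
def bowenBall (F : Finset G) (x : X) (ε : ℝ) : Set X :=
  {y | ∀ g ∈ F, dist (g • x) (g • y) < ε}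

/-- `M(Z,N,ε,s,{Fₙ})`: infimum of `Σᵢ exp(-s |F_{nᵢ}|)` over countable families of Bowen balls
`B_{F_{nᵢ}}(xᵢ,ε)` with `nᵢ ≥ N` covering `Z`. -/
noncomputable def bowenMpre (F : ℕ → Finset G) (Z : Set X) (N : ℕ) (ε s : ℝ) : ℝ≥0∞ :=
  ⨅ (C : Set (X × ℕ)) (_ : C.Countable ∧ (∀ p ∈ C, N ≤ p.2) ∧
      Z ⊆ ⋃ p ∈ C, bowenBall (F p.2) p.1 ε),
    ∑' p : C, ENNReal.ofReal (Real.exp (-s * ((F (p : X × ℕ).2).card : ℝ)))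

/-- `M(Z,s,{Fₙ}) = lim_{ε→0} lim_{N→∞} M(Z,N,ε,s,{Fₙ})`; since the quantity is monotone
(nondecreasing as `N` increases and as `ε` decreases), the limits are suprema. -/
noncomputable def bowenMeasure (F : ℕ → Finset G) (Z : Set X) (s : ℝ) : ℝ≥0∞ :=
  ⨆ (ε : ℝ) (_ : 0 < ε), ⨆ N : ℕ, bowenMpre F Z N ε s

/-- The Bowen topological entropy of `Z` along `{Fₙ}`: the critical value of `s` at which
`M(Z,s,{Fₙ})` jumps from `+∞` to `0`. -/
noncomputable def bowenEntropy (F : ℕ → Finset G) (Z : Set X) : ℝ≥0∞ :=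
  ⨆ (s : ℝ) (_ : bowenMeasure F Z s = ⊤), ENNReal.ofReal s

/-- The minimal cardinality of a subcover of `⋁_{g ∈ F} g⁻¹ U` for a cover `U`. -/
noncomputable def coverNumber (U : Finset (Set X)) (F : Finset G) : ℕ :=
  sInf {k : ℕ | ∃ f : Fin k → G → Set X, (∀ i, ∀ g ∈ F, f i g ∈ U) ∧
    (univ : Set X) ⊆ ⋃ i, ⋂ g ∈ F, (fun x => g • x) ⁻¹' f i g}

/-- The topological entropy of the `G`-action on `X` (computed along `{Fₙ}`; it is independent
of the Følner sequence). -/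
noncomputable def topEntropy (X : Type*) [MetricSpace X] {G : Type*} [Group G] [MulAction G X]
    (F : ℕ → Finset G) : ℝ≥0∞ :=
  ⨆ (U : Finset (Set X)) (_ : (∀ V ∈ U, IsOpen V) ∧ ⋃₀ (U : Set (Set X)) = univ),
    limsup (fun n => ENNReal.ofReal (Real.log (coverNumber U (F n)) / (F n).card)) atTop

end Defs

section MeasDefs

variable {G : Type*} [Group G] [DecidableEq G] {X : Type*} [MeasurableSpace X] [MulAction G X]

/-- The Shannon entropy `H_μ(⋁_{g∈F} g⁻¹ P)` of the join over `F` of the finite measurable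
partition `P` given by the fibers of `α`. -/
noncomputable def partitionEntropy (μ : Measure X) {ι : Type*} [Fintype ι] (α : X → ι)
    (F : Finset G) : ℝ :=
  ∑ f : ↥F → ι, Real.negMulLog ((μ {x | ∀ g : ↥F, α ((g : G) • x) = f g}).toReal)

/-- The entropy `h_μ(G,P) = lim_n H_μ(P^{Fₙ})/|Fₙ|` of the partition given by the fibers
of `α` (the limit existing, it is the `limsup`). -/
noncomputable def partitionDynEntropy (F : ℕ → Finset G) (μ : Measure X) {ι : Type*} [Fintype ι]
    (α : X → ι) : ℝ :=
  limsup (fun n => partitionEntropy μ α (F n) / (F n).card) atTop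

/-- The measure-theoretic entropy `h_μ(X,G)`: the supremum over finite measurable partitions
(encoded as measurable maps `X → Fin k`) of `lim_n H_μ(P^{Fₙ})/|Fₙ|`. -/
noncomputable def measEntropy (F : ℕ → Finset G) (μ : Measure X) : ℝ≥0∞ :=
  ⨆ (k : ℕ) (α : X → Fin k) (_ : Measurable α),
    limsup (fun n => ENNReal.ofReal (partitionEntropy μ α (F n) / (F n).card)) atTop

/-- `μ` is `G`-invariant. -/
def InvariantMeasure (G : Type*) [Group G] [MulAction G X] (μ : Measure X) : Prop :=
  ∀ g : G, Measure.map (fun x => g • x) μ = μ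

/-- `μ` is ergodic: every Borel set `A` with `μ(A △ g⁻¹A) = 0` for all `g` is trivial. -/
def ErgodicMeasure (G : Type*) [Group G] [MulAction G X] (μ : Measure X) : Prop :=
  ∀ A : Set X, MeasurableSet A →
    (∀ g : G, μ (symmDiff A ((fun x => g • x) ⁻¹' A)) = 0) → μ A = 0 ∨ μ A = 1

end MeasDefs

section LocalDefs

variable {G : Type*} [Group G] [DecidableEq G] {X : Type*} [MetricSpace X] [MulAction G X]
  [MeasurableSpace X]

/-- The set of generic points of `μ` with respect to `{Fₙ}`. -/
def genericPointSet (F : ℕ → Finset G) (μ : Measure X) : Set X :=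
  {x | ∀ f : C(X, ℝ),
    Tendsto (fun n => (∑ g ∈ F n, f (g • x)) / (F n).card) atTop (𝓝 (∫ y, f y ∂μ))}

/-- The lower local entropy of `μ` at `x` along `{Fₙ}`:
`lim_{δ→0} liminf_n -(1/|Fₙ|) log μ(B_{Fₙ}(x,δ))` (the limit in `δ` being a supremum
by monotonicity). -/
noncomputable def localLowerEntropy (F : ℕ → Finset G) (μ : Measure X) (x : X) : ℝ≥0∞ :=
  ⨆ (δ : ℝ) (_ : 0 < δ),
    liminf (fun n =>
      ENNReal.ofReal (-(Real.log ((μ (bowenBall (F n) x δ)).toReal)) / (F n).card)) atTop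

end LocalDefs

namespace LLE

section Cover
variable {G : Type*} [Group G] [DecidableEq G]

/-- The shadow set `⋃_{k<m} F_k⁻¹ F_m`. -/
def shadow (F : ℕ → Finset G) (m : ℕ) : Finset G :=
  (Finset.range m).biUnion fun k => (F k)⁻¹ * F m

/-- Accumulated weight of higher levels at `h`. -/
noncomputable def kap (F : ℕ → Finset G) (E : Finset G) (n : G → ℕ) (w : G → ℝ) (h : G) : ℝ :=
  ∑ h' ∈ E with (n h < n h' ∧ h * h'⁻¹ ∈ shadow F (n h')), w h'

open Classical in
lemma exists_weight (F : ℕ → Finset G) (n : G → ℕ) (E : Finset G) :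
    ∃ w : G → ℝ, ∀ h ∈ E, w h = if kap F E n w h < 1 then ((F (n h)).card : ℝ)⁻¹ else 0 := by
  induction E using Finset.induction_on_min_value n with
  | empty => exact ⟨0, by simp⟩
  | insert a s ha hmin ih =>
    obtain ⟨w, hw⟩ := ih
    refine ⟨Function.update w a (if kap F s n w a < 1 then ((F (n a)).card : ℝ)⁻¹ else 0), ?_⟩
    set w' := Function.update w a (if kap F s n w a < 1 then ((F (n a)).card : ℝ)⁻¹ else 0)
    have key : ∀ h ∈ insert a s, kap F (insert a s) n w' h = kap F s n w h := by
      intro h hh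
      have hle : n a ≤ n h := by
        rcases Finset.mem_insert.1 hh with rfl | hh
        · exact le_rfl
        · exact hmin h hh
      unfold kap
      rw [Finset.filter_insert, if_neg (by rintro ⟨h1, _⟩; omega)]
      refine Finset.sum_congr rfl fun x hx => ?_
      have : x ≠ a := by
        rintro rfl; exact ha (Finset.mem_filter.1 hx).1
      simp [w', Function.update_of_ne this]
    intro h hh
    rw [key h hh]
    rcases Finset.mem_insert.1 hh with rfl | hh'
    · simp [w']
    · have : h ≠ a := by rintro rfl; exact ha hh'
      simp only [w', Function.update_of_ne this]
      exact hw h hh'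

lemma cover (F : ℕ → Finset G) (hne : ∀ n, (F n).Nonempty) {C : ℝ}
    (hC : ∀ n : ℕ, (((Finset.range n).biUnion fun k => (F k)⁻¹ * F n).card : ℝ) ≤ C * (F n).card)
    (n : G → ℕ) (E : Finset G) :
    ∃ w : G → ℝ, (∀ h ∈ E, 0 ≤ w h) ∧
      (E.card : ℝ) ≤ (1 + C) * ∑ h ∈ E, w h * (F (n h)).card ∧
      ∀ g : G, ∑ h ∈ E with g * h⁻¹ ∈ F (n h), w h ≤ 2 := by
  classical
  obtain ⟨w, hw⟩ := exists_weight F n E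
  have hpos : ∀ m, (0 : ℝ) < (F m).card := fun m => by exact_mod_cast (hne m).card_pos
  have h0 : ∀ h ∈ E, 0 ≤ w h := by
    intro h hh
    rw [hw h hh]; split_ifs
    · exact inv_nonneg.2 (hpos _).le
    · exact le_rfl
  have hle : ∀ h ∈ E, w h ≤ ((F (n h)).card : ℝ)⁻¹ := by
    intro h hh
    rw [hw h hh]; split_ifs
    · exact le_rfl
    · exact inv_nonneg.2 (hpos _).le
  refine ⟨w, h0, ?_, ?_⟩
  · have h1 : ∀ h ∈ E, (1 : ℝ) ≤ w h * (F (n h)).card + kap F E n w h := by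
      intro h hh
      have hk : 0 ≤ kap F E n w h :=
        Finset.sum_nonneg fun x hx => h0 x (Finset.mem_filter.1 hx).1
      by_cases hk1 : kap F E n w h < 1
      · rw [hw h hh, if_pos hk1, inv_mul_cancel₀ (hpos _).ne']; linarith
      · have := mul_nonneg (h0 h hh) (hpos (n h)).le
        linarith
    have h2 : ∑ h ∈ E, kap F E n w h ≤ ∑ h' ∈ E, C * (w h' * (F (n h')).card) := by
      unfold kap
      simp_rw [Finset.sum_filter]
      rw [Finset.sum_comm]
      refine Finset.sum_le_sum fun h' hh' => ?_
      rw [← Finset.sum_filter, Finset.sum_const, nsmul_eq_mul]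
      have : ((E.filter fun h => n h < n h' ∧ h * h'⁻¹ ∈ shadow F (n h')).card : ℝ)
          ≤ (shadow F (n h')).card := by
        norm_cast
        refine Finset.card_le_card_of_injOn (fun h => h * h'⁻¹) ?_ ?_
        · intro h hh
          exact (Finset.mem_filter.1 hh).2.2
        · intro x _ y _ hxy
          exact mul_right_cancel hxy
      calc _ ≤ ((shadow F (n h')).card : ℝ) * w h' :=
            mul_le_mul_of_nonneg_right this (h0 h' hh')
        _ ≤ (C * (F (n h')).card) * w h' := mul_le_mul_of_nonneg_right (hC _) (h0 h' hh')
        _ = _ := by ring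
    have h3 := Finset.sum_le_sum h1
    rw [Finset.sum_add_distrib, Finset.sum_const, nsmul_eq_mul, mul_one] at h3
    rw [← Finset.mul_sum] at h2
    linarith
  · intro g
    set S := E.filter fun h => g * h⁻¹ ∈ F (n h) ∧ w h ≠ 0 with hS
    have hsum : ∑ h ∈ E with g * h⁻¹ ∈ F (n h), w h = ∑ h ∈ S, w h := by
      symm
      refine Finset.sum_subset ?_ ?_
      · intro h hh
        simp only [hS, Finset.mem_filter] at hh ⊢
        tauto
      · intro h hh hh'
        simp only [hS, Finset.mem_filter] at hh hh'
        tauto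
    rw [hsum]
    rcases S.eq_empty_or_nonempty with hE | hE
    · rw [hE]; simp
    obtain ⟨h₀, hh₀, hmin⟩ := Finset.exists_min_image S n hE
    have hh₀' := hh₀
    simp only [hS, Finset.mem_filter] at hh₀
    have hk : kap F E n w h₀ < 1 := by
      by_contra hcon
      exact hh₀.2.2 (by rw [hw h₀ hh₀.1, if_neg hcon])
    rw [← Finset.sum_filter_add_sum_filter_not S (fun h => n h = n h₀)]
    have e1 : ∑ h ∈ S with n h = n h₀, w h ≤ 1 := by
      calc _ ≤ ∑ h ∈ S with n h = n h₀, ((F (n h₀)).card : ℝ)⁻¹ := by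
            refine Finset.sum_le_sum fun h hh => ?_
            simp only [hS, Finset.mem_filter] at hh
            rw [← hh.2]; exact hle h hh.1.1
        _ = ((S.filter fun h => n h = n h₀).card : ℝ) * ((F (n h₀)).card : ℝ)⁻¹ := by
            rw [Finset.sum_const, nsmul_eq_mul]
        _ ≤ (F (n h₀)).card * ((F (n h₀)).card : ℝ)⁻¹ := by
            refine mul_le_mul_of_nonneg_right ?_ (inv_nonneg.2 (hpos _).le)
            norm_cast
            refine Finset.card_le_card_of_injOn (fun h => g * h⁻¹) ?_ ?_
            · intro h hh
              simp only [hS, Finset.coe_filter, Finset.mem_filter, Set.mem_ofPred_eq] at hh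
              have := hh.1.2.1
              rw [hh.2] at this
              exact this
            · intro x _ y _ hxy
              exact inv_injective (mul_left_cancel hxy)
        _ = 1 := mul_inv_cancel₀ (hpos _).ne'
    have e2 : ∑ h ∈ S with ¬ n h = n h₀, w h ≤ kap F E n w h₀ := by
      unfold kap
      refine Finset.sum_le_sum_of_subset_of_nonneg ?_ ?_
      · intro h hh
        have hhS := (Finset.mem_filter.1 hh).1
        have hm := hmin h hhS
        simp only [hS, Finset.mem_filter] at hh ⊢
        have hlt : n h₀ < n h := lt_of_le_of_ne hm (fun e => hh.2 e.symm)
        refine ⟨hh.1.1, hlt, ?_⟩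
        unfold shadow
        refine Finset.mem_biUnion.2 ⟨n h₀, Finset.mem_range.2 hlt, ?_⟩
        refine Finset.mem_mul.2 ⟨(g * h₀⁻¹)⁻¹, Finset.inv_mem_inv hh₀.2.1, g * h⁻¹, hh.1.2.1, ?_⟩
        group
      · intro h hh _
        exact h0 h (Finset.mem_filter.1 hh).1
    linarith

end Cover
end LLE

namespace LLE

section Maximal
variable {G : Type*} [Group G] [DecidableEq G] {X : Type*} [MulAction G X]

lemma maximal_pointwise (F : ℕ → Finset G) (hne : ∀ n, (F n).Nonempty) {C : ℝ} (hC0 : 0 ≤ C)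
    (hC : ∀ n : ℕ, (((Finset.range n).biUnion fun k => (F k)⁻¹ * F n).card : ℝ) ≤ C * (F n).card)
    (f : X → ℝ) (hf : ∀ x, 0 ≤ f x) (N : ℕ) {l : ℝ} (hl : 0 < l) (T : Finset G) (x : X)
    (D : Set X) (hD : D = {x | ∃ n < N, l * (F n).card < ∑ g ∈ F n, f (g • x)}) :
    l * ∑ h ∈ T, D.indicator 1 (h • x) ≤
      2 * (1 + C) * ∑ g ∈ ((Finset.range N).biUnion F) * T, f (g • x) := by
  classical
  set E := T.filter fun h => h • x ∈ D with hE
  have hsum : ∑ h ∈ T, D.indicator (1 : X → ℝ) (h • x) = E.card := by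
    rw [hE, Finset.card_filter]
    push_cast
    refine Finset.sum_congr rfl fun h _ => ?_
    simp [Set.indicator_apply]
  rw [hsum]
  have hex : ∀ h : G, ∃ n : ℕ, h ∈ E → n < N ∧ l * (F n).card < ∑ g ∈ F n, f (g • h • x) := by
    intro h
    by_cases hh : h ∈ E
    · have := (Finset.mem_filter.1 hh).2
      rw [hD] at this
      obtain ⟨n, hn, hn'⟩ := this
      exact ⟨n, fun _ => ⟨hn, hn'⟩⟩
    · exact ⟨0, fun h => absurd h hh⟩
  choose n hn using hex
  obtain ⟨w, hw0, hw1, hw2⟩ := cover F hne hC n E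
  set V := ((Finset.range N).biUnion F) * T with hV
  have hin : ∀ h ∈ E, ∑ g ∈ F (n h), f (g • h • x) =
      ∑ g ∈ V, if g * h⁻¹ ∈ F (n h) then f (g • x) else 0 := by
    intro h hh
    rw [← Finset.sum_filter]
    refine Finset.sum_bij (fun g _ => g * h) ?_ ?_ ?_ ?_
    · intro g hg
      refine Finset.mem_filter.2 ⟨Finset.mul_mem_mul ?_ (Finset.mem_filter.1 hh).1, by simpa using hg⟩
      exact Finset.mem_biUnion.2 ⟨n h, Finset.mem_range.2 (hn h hh).1, hg⟩
    · intro a _ b _ hab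
      exact mul_right_cancel hab
    · intro b hb
      exact ⟨b * h⁻¹, (Finset.mem_filter.1 hb).2, by group⟩
    · intro g _
      rw [mul_smul]
  have hmain : l * ∑ h ∈ E, w h * (F (n h)).card ≤ 2 * ∑ g ∈ V, f (g • x) := by
    calc l * ∑ h ∈ E, w h * (F (n h)).card = ∑ h ∈ E, w h * (l * (F (n h)).card) := by
          rw [Finset.mul_sum]; refine Finset.sum_congr rfl fun h _ => by ring
      _ ≤ ∑ h ∈ E, w h * ∑ g ∈ V, (if g * h⁻¹ ∈ F (n h) then f (g • x) else 0) := by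
          refine Finset.sum_le_sum fun h hh => mul_le_mul_of_nonneg_left ?_ (hw0 h hh)
          rw [← hin h hh]; exact (hn h hh).2.le
      _ = ∑ g ∈ V, f (g • x) * ∑ h ∈ E with g * h⁻¹ ∈ F (n h), w h := by
          simp_rw [Finset.mul_sum, Finset.sum_filter]
          rw [Finset.sum_comm]
          refine Finset.sum_congr rfl fun g _ => Finset.sum_congr rfl fun h _ => ?_
          split_ifs <;> ring
      _ ≤ ∑ g ∈ V, f (g • x) * 2 :=
          Finset.sum_le_sum fun g _ => mul_le_mul_of_nonneg_left (hw2 g) (hf _)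
      _ = _ := by rw [← Finset.sum_mul]; ring
  calc l * (E.card : ℝ) ≤ l * ((1 + C) * ∑ h ∈ E, w h * (F (n h)).card) :=
        mul_le_mul_of_nonneg_left hw1 hl.le
    _ = (1 + C) * (l * ∑ h ∈ E, w h * (F (n h)).card) := by ring
    _ ≤ (1 + C) * (2 * ∑ g ∈ V, f (g • x)) := mul_le_mul_of_nonneg_left hmain (by linarith)
    _ = _ := by ring

lemma card_mul_le (U F : Finset G) :
    ((U * F).card : ℝ) ≤ F.card + ∑ u ∈ U, ((symmDiff F (F.image (u * ·))).card : ℝ) := by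
  classical
  have : U * F ⊆ F ∪ U.biUnion fun u => symmDiff F (F.image (u * ·)) := by
    intro g hg
    obtain ⟨u, hu, a, ha, rfl⟩ := Finset.mem_mul.1 hg
    by_cases h : u * a ∈ F
    · exact Finset.mem_union_left _ h
    · refine Finset.mem_union_right _ (Finset.mem_biUnion.2 ⟨u, hu, ?_⟩)
      exact Finset.mem_symmDiff.2 (Or.inr ⟨Finset.mem_image_of_mem _ ha, h⟩)
  have h1 := (Finset.card_le_card this).trans (Finset.card_union_le _ _)
  have h2 := h1.trans (Nat.add_le_add_left Finset.card_biUnion_le _)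
  exact_mod_cast h2

lemma tendsto_card_mul (F : ℕ → Finset G) (hF : IsFolnerSeq F) (U : Finset G) :
    Tendsto (fun m => 1 + ∑ u ∈ U, ((symmDiff (F m) ((F m).image (u * ·))).card : ℝ) / (F m).card)
      atTop (𝓝 1) := by
  have := tendsto_finsetSum U (fun u _ => hF.2 u)
  simpa using this.const_add 1

variable [MeasurableSpace X]

lemma integral_mp {ν : Measure X} {T : X → X} (hT : MeasurePreserving T ν ν) {f : X → ℝ}
    (hf : Measurable f) : ∫ x, f (T x) ∂ν = ∫ x, f x ∂ν := by
  have := integral_map (μ := ν) (φ := T) hT.measurable.aemeasurable (f := f)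
    hf.aestronglyMeasurable
  rw [hT.map_eq] at this
  exact this.symm

lemma arith_aux {l r A c S : ℝ} (hc : 0 < c) (h : l * (c * r) ≤ A * (c + S)) :
    l * r ≤ A * (1 + S / c) := by
  have h1 : A * (1 + S / c) = A * (c + S) / c := by field_simp
  rw [h1, le_div_iff₀ hc]
  linarith

lemma maximal (F : ℕ → Finset G) (hF : IsFolnerSeq F) {C : ℝ} (hC0 : 0 ≤ C)
    (hC : ∀ n : ℕ, (((Finset.range n).biUnion fun k => (F k)⁻¹ * F n).card : ℝ) ≤ C * (F n).card)
    (ν : Measure X) [IsProbabilityMeasure ν]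
    (hmp : ∀ g : G, MeasurePreserving (fun x : X => g • x) ν ν)
    (f : X → ℝ) (hfm : Measurable f) (hf : ∀ x, 0 ≤ f x) (hfi : Integrable f ν)
    (N : ℕ) {l : ℝ} (hl : 0 < l) :
    l * ν.real {x | ∃ n < N, l * (F n).card < ∑ g ∈ F n, f (g • x)} ≤
      2 * (1 + C) * ∫ x, f x ∂ν := by
  set D := {x | ∃ n < N, l * (F n).card < ∑ g ∈ F n, f (g • x)} with hD
  have hDm : MeasurableSet D := by
    have : D = ⋃ n ∈ Finset.range N, {x | l * (F n).card < ∑ g ∈ F n, f (g • x)} := by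
      ext x; simp [hD]
    rw [this]
    refine Finset.measurableSet_biUnion _ fun n _ => measurableSet_lt measurable_const ?_
    exact Finset.measurable_fun_sum _ fun g _ => hfm.comp (hmp g).measurable
  set U := (Finset.range N).biUnion F
  have hpos : ∀ m, (0 : ℝ) < (F m).card := fun m => by exact_mod_cast (hF.1 m).card_pos
  have h_int : ∀ g : G, ∫ x, f (g • x) ∂ν = ∫ x, f x ∂ν := fun g => integral_mp (hmp g) hfm
  have hinti : ∀ g : G, Integrable (fun x => f (g • x)) ν := fun g =>
    (hmp g).integrable_comp_of_integrable hfi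
  have hindi : ∀ g : G, Integrable (fun x => D.indicator (1 : X → ℝ) (g • x)) ν := fun g =>
    (hmp g).integrable_comp_of_integrable ((integrable_const 1).indicator hDm)
  have hind : ∀ g : G, ∫ x, D.indicator (1 : X → ℝ) (g • x) ∂ν = ν.real D := fun g => by
    rw [integral_mp (hmp g) (measurable_one.indicator hDm), integral_indicator_one hDm]
  have key : ∀ m, l * ν.real D ≤ 2 * (1 + C) * (∫ x, f x ∂ν) *
      (1 + ∑ u ∈ U, ((symmDiff (F m) ((F m).image (u * ·))).card : ℝ) / (F m).card) := by
    intro m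
    have h1 := integral_mono (μ := ν)
      ((integrable_finsetSum (F m) fun g _ => hindi g).const_mul l)
      ((integrable_finsetSum (U * F m) fun g _ => hinti g).const_mul (2 * (1 + C)))
      (fun x => maximal_pointwise F hF.1 hC0 hC f hf N hl (F m) x D hD)
    simp only [integral_const_mul] at h1
    rw [integral_finsetSum _ fun g _ => hindi g, integral_finsetSum _ fun g _ => hinti g] at h1
    simp only [hind, h_int, Finset.sum_const, nsmul_eq_mul] at h1
    have h2 := card_mul_le U (F m)
    have h3 : 0 ≤ 2 * (1 + C) * ∫ x, f x ∂ν :=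
      mul_nonneg (by linarith) (integral_nonneg hf)
    rw [← Finset.sum_div]
    have h4 : l * ((F m).card * ν.real D) ≤ (2 * (1 + C) * ∫ x, f x ∂ν) *
        ((F m).card + ∑ u ∈ U, ((symmDiff (F m) ((F m).image (u * ·))).card : ℝ)) := by
      refine h1.trans ?_
      calc _ = (2 * (1 + C) * ∫ x, f x ∂ν) * ((U * F m).card : ℝ) := by ring
        _ ≤ _ := mul_le_mul_of_nonneg_left h2 h3
    exact arith_aux (hpos m) h4
  have hlim := (tendsto_card_mul F hF U).const_mul (2 * (1 + C) * (∫ x, f x ∂ν))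
  rw [mul_one] at hlim
  exact ge_of_tendsto' hlim key

end Maximal
end LLE

namespace LLE

section Ergodic
variable {G : Type*} [Group G] {X : Type*} [MulAction G X] [MeasurableSpace X]

lemma integral_norm_le_Lp2 {ν : Measure X} [IsProbabilityMeasure ν] (u : Lp ℝ 2 ν) :
    ∫ x, |u x| ∂ν ≤ ‖u‖ := by
  have h1 : ∫ x, |u x| ∂ν = (eLpNorm u 1 ν).toReal := by
    rw [eLpNorm_one_eq_lintegral_enorm,
      ← integral_norm_eq_lintegral_enorm (Lp.aestronglyMeasurable u)]
    rfl
  rw [h1, Lp.norm_def]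
  refine ENNReal.toReal_mono (Lp.eLpNorm_ne_top u) ?_
  exact eLpNorm_le_eLpNorm_of_exponent_le (by norm_num) (Lp.aestronglyMeasurable u)

lemma ae_const_of_invariant {ν : Measure X} [IsProbabilityMeasure ν] (herg : ErgodicMeasure G ν)
    (hmp : ∀ g : G, MeasurePreserving (fun x : X => g • x) ν ν)
    (w : X → ℝ) (hw : Measurable w) (hinv : ∀ g : G, (fun x => w (g • x)) =ᵐ[ν] w) :
    ∃ a : ℝ, w =ᵐ[ν] fun _ => a := by
  refine exists_eventuallyEq_const_of_forall_separating MeasurableSet fun U hU => ?_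
  have hA : MeasurableSet (w ⁻¹' U) := hw hU
  have hnull : ∀ g : G, ν (symmDiff (w ⁻¹' U) ((fun x => g • x) ⁻¹' (w ⁻¹' U))) = 0 := by
    intro g
    refine measure_mono_null ?_ (hinv g)
    intro x hx
    simp only [Set.mem_symmDiff, Set.mem_preimage] at hx
    simp only [Set.mem_compl_iff, Set.mem_ofPred_eq]
    intro h
    rw [h] at hx
    tauto
  rcases herg (w ⁻¹' U) hA hnull with h | h
  · right
    exact measure_eq_zero_iff_ae_notMem.1 h
  · left
    exact (prob_compl_eq_zero_iff hA).2 h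

lemma conv_approx {ν : Measure X} [IsProbabilityMeasure ν] (herg : ErgodicMeasure G ν)
    (hmp : ∀ g : G, MeasurePreserving (fun x : X => g • x) ν ν)
    (Φ : X → ℝ) (hΦ : Measurable Φ) (T : ℝ) (hT : ∀ x, |Φ x| ≤ T) {η : ℝ} (hη : 0 < η) :
    ∃ (ι : Type) (t : Finset ι) (c : ι → ℝ) (γ : ι → G), (∀ i ∈ t, 0 ≤ c i) ∧ ∑ i ∈ t, c i = 1 ∧
      ∫ x, |∑ i ∈ t, c i * Φ (γ i • x) - ∫ y, Φ y ∂ν| ∂ν ≤ η := by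
  have hmem : MemLp Φ 2 ν := MemLp.of_bound hΦ.aestronglyMeasurable T
    (Eventually.of_forall fun x => by simpa using hT x)
  let U : G → (Lp ℝ 2 ν →ₗᵢ[ℝ] Lp ℝ 2 ν) := fun g =>
    Lp.compMeasurePreservingₗᵢ ℝ (fun x : X => g • x) (hmp g)
  have hU : ∀ g (v : Lp ℝ 2 ν), (U g v : X → ℝ) =ᵐ[ν] fun x => v (g • x) := fun g v =>
    Lp.coeFn_compMeasurePreserving v (hmp g)
  let φ : Lp ℝ 2 ν := hmem.toLp Φ
  have hUφ : ∀ g, (U g φ : X → ℝ) =ᵐ[ν] fun x => Φ (g • x) := fun g =>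
    (hU g φ).trans ((hmp g).quasiMeasurePreserving.ae_eq_comp hmem.coeFn_toLp)
  have hUU : ∀ g h, U g (U h φ) = U (h * g) φ := by
    intro g h
    refine Lp.ext ?_
    refine (hU g _).trans (((hmp g).quasiMeasurePreserving.ae_eq_comp (hUφ h)).trans ?_)
    refine EventuallyEq.trans ?_ (hUφ (h * g)).symm
    refine Eventually.of_forall fun x => ?_
    simp [mul_smul]
  let K : Set (Lp ℝ 2 ν) := closure (convexHull ℝ (range fun g => U g φ))
  have hKc : Convex ℝ K := (convex_convexHull ℝ _).closure
  have hKclosed : IsClosed K := isClosed_closure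
  have hKne : K.Nonempty := ⟨U 1 φ, subset_closure (subset_convexHull ℝ _ ⟨1, rfl⟩)⟩
  have hmaps : ∀ g, ∀ v ∈ K, U g v ∈ K := by
    intro g
    have h1 : convexHull ℝ (range fun g => U g φ) ⊆ (U g) ⁻¹' K := by
      refine convexHull_min ?_ (hKc.linear_preimage (U g).toLinearMap)
      rintro _ ⟨h, rfl⟩
      simp only [mem_preimage]
      rw [hUU]
      exact subset_closure (subset_convexHull ℝ _ ⟨h * g, rfl⟩)
    exact closure_minimal h1 (hKclosed.preimage (U g).continuous)
  obtain ⟨w, hwK, hwmin⟩ := exists_norm_eq_iInf_of_complete_convex hKne hKclosed.isComplete hKc 0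
  have hinner := (norm_eq_iInf_iff_real_inner_le_zero hKc hwK).1 hwmin
  have hUw : ∀ g, U g w = w := by
    intro g
    have h1 := hinner _ (hmaps g w hwK)
    rw [zero_sub, inner_neg_left, inner_sub_right, real_inner_self_eq_norm_sq] at h1
    have h2 : ‖U g w - w‖ ^ 2 = 2 * (‖w‖ ^ 2 - inner ℝ w (U g w)) := by
      rw [norm_sub_sq_real, (U g).norm_map, real_inner_comm]; ring
    have h3 : ‖U g w - w‖ ^ 2 ≤ 0 := by rw [h2]; linarith
    have h4 : ‖U g w - w‖ = 0 := by
      have := sq_nonneg ‖U g w - w‖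
      exact pow_eq_zero_iff (two_ne_zero) |>.1 (le_antisymm h3 this)
    exact sub_eq_zero.1 (norm_eq_zero.1 h4)
  obtain ⟨a, ha⟩ := ae_const_of_invariant herg hmp (w : X → ℝ) (Lp.stronglyMeasurable w).measurable
    (fun g => (hU g w).symm.trans (by rw [hUw g]))
  obtain ⟨v, hv, hvw⟩ := Metric.mem_closure_iff.1 hwK (η / 2) (by linarith)
  rw [convexHull_eq] at hv
  obtain ⟨ι, t, c, z, hc0, hc1, hz, hcm⟩ := hv
  have hz' : ∀ i : ι, ∃ g : G, i ∈ t → U g φ = z i := by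
    intro i
    by_cases hi : i ∈ t
    · obtain ⟨g, hg⟩ := hz i hi
      exact ⟨g, fun _ => hg⟩
    · exact ⟨1, fun h => absurd h hi⟩
  choose γ hγ using hz'
  refine ⟨ι, t, c, γ, hc0, hc1, ?_⟩
  rw [Finset.centerMass_eq_of_sum_1 _ _ hc1] at hcm
  have hveq : (v : X → ℝ) =ᵐ[ν] fun x => ∑ i ∈ t, c i * Φ (γ i • x) := by
    rw [← hcm]
    refine (Lp.coeFn_finsetSum _ _).trans ?_
    have : ∀ᵐ x ∂ν, ∀ i ∈ t, (c i • z i : Lp ℝ 2 ν) x = c i * Φ (γ i • x) := by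
      rw [Finset.eventually_all]
      intro i hi
      filter_upwards [Lp.coeFn_smul (c i) (z i), hUφ (γ i)] with x h1 h2
      rw [h1, ← hγ i hi]
      simp [h2]
    filter_upwards [this] with x hx
    rw [Finset.sum_apply]
    exact Finset.sum_congr rfl hx
  have hΦi : ∀ g : G, Integrable (fun x => Φ (g • x)) ν := fun g =>
    (hmp g).integrable_comp_of_integrable (hmem.integrable (by norm_num))
  have hsi : Integrable (fun x => ∑ i ∈ t, c i * Φ (γ i • x)) ν :=
    integrable_finsetSum _ fun i _ => (hΦi _).const_mul _
  have hbd : ∫ x, |∑ i ∈ t, c i * Φ (γ i • x) - a| ∂ν ≤ η / 2 := by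
    have h1 := integral_norm_le_Lp2 (v - w)
    have h2 : ‖v - w‖ ≤ η / 2 := by
      rw [← dist_eq_norm, dist_comm]; exact hvw.le
    refine le_trans (le_of_eq (integral_congr_ae ?_)) (h1.trans h2)
    filter_upwards [hveq, ha, Lp.coeFn_sub v w] with x h3 h4 h5
    rw [h5, Pi.sub_apply, h3, h4]
  have hmean : ∫ x, ∑ i ∈ t, c i * Φ (γ i • x) ∂ν = ∫ x, Φ x ∂ν := by
    rw [integral_finsetSum _ fun i _ => (hΦi _).const_mul _]
    simp_rw [integral_const_mul, integral_mp (hmp _) hΦ]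
    rw [← Finset.sum_mul, hc1, one_mul]
  have hia : Integrable (fun x => ∑ i ∈ t, c i * Φ (γ i • x) - a) ν := hsi.sub (integrable_const a)
  have hdiff : |∫ x, Φ x ∂ν - a| ≤ η / 2 := by
    have h1 : ∫ x, Φ x ∂ν - a = ∫ x, (∑ i ∈ t, c i * Φ (γ i • x) - a) ∂ν := by
      rw [integral_sub hsi (integrable_const a), hmean]; simp
    rw [h1]
    exact (abs_integral_le_integral_abs).trans hbd
  calc ∫ x, |∑ i ∈ t, c i * Φ (γ i • x) - ∫ y, Φ y ∂ν| ∂ν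
      ≤ ∫ x, (|∑ i ∈ t, c i * Φ (γ i • x) - a| + |∫ x, Φ x ∂ν - a|) ∂ν := by
        refine integral_mono (hsi.sub (integrable_const _)).abs
          (hia.abs.add (integrable_const _)) fun x => ?_
        simp only
        rw [abs_sub_comm (∫ x, Φ x ∂ν) a]
        refine le_trans (le_of_eq ?_) (abs_add_le _ _)
        congr 1; ring
    _ = ∫ x, |∑ i ∈ t, c i * Φ (γ i • x) - a| ∂ν + |∫ x, Φ x ∂ν - a| := by
        rw [integral_add hia.abs (integrable_const _)]; simp
    _ ≤ η := by linarith

variable [DecidableEq G]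

lemma sum_shift_bound (F : Finset G) (Φ : X → ℝ) (T : ℝ) (hT : ∀ x, |Φ x| ≤ T) (g : G) (x : X) :
    |∑ h ∈ F, Φ (g • h • x) - ∑ h ∈ F, Φ (h • x)| ≤
      T * (symmDiff F (F.image (g * ·))).card := by
  have h1 : ∑ h ∈ F, Φ (g • h • x) = ∑ h ∈ F.image (g * ·), Φ (h • x) := by
    rw [Finset.sum_image (fun a _ b _ hab => mul_left_cancel hab)]
    exact Finset.sum_congr rfl fun h _ => by rw [mul_smul]
  rw [h1]
  set F' := F.image (g * ·)
  rw [← Finset.sum_sdiff_sub_sum_sdiff]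
  have hb : ∀ A : Finset G, |∑ h ∈ A, Φ (h • x)| ≤ T * A.card := fun A => by
    calc _ ≤ ∑ h ∈ A, |Φ (h • x)| := Finset.abs_sum_le_sum_abs _ _
      _ ≤ ∑ h ∈ A, T := Finset.sum_le_sum fun h _ => hT _
      _ = _ := by rw [Finset.sum_const, nsmul_eq_mul, mul_comm]
  have hcard : ((symmDiff F F').card : ℝ) = (F \ F').card + (F' \ F).card := by
    have : symmDiff F F' = (F \ F') ∪ (F' \ F) := rfl
    rw [this, Finset.card_union_of_disjoint disjoint_sdiff_sdiff]; push_cast; rfl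
  rw [hcard]
  have h2 := hb (F' \ F)
  have h3 := hb (F \ F')
  refine (abs_sub _ _).trans ?_
  linarith

lemma ergodic_lower (F : ℕ → Finset G) (hF : IsFolnerSeq F) (hTemp : IsTemperedSeq F)
    {ν : Measure X} [IsProbabilityMeasure ν] (herg : ErgodicMeasure G ν)
    (hmp : ∀ g : G, MeasurePreserving (fun x : X => g • x) ν ν)
    (Φ : X → ℝ) (hΦ : Measurable Φ) (T : ℝ) (hT : ∀ x, |Φ x| ≤ T) {ε : ℝ} (hε : 0 < ε) :
    ∀ᵐ x ∂ν, ∀ᶠ n in atTop, (∫ y, Φ y ∂ν - ε) * (F n).card ≤ ∑ g ∈ F n, Φ (g • x) := by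
  obtain ⟨C, hC⟩ := hTemp
  have hpos : ∀ m, (0 : ℝ) < (F m).card := fun m => by exact_mod_cast (hF.1 m).card_pos
  have hC0 : 0 ≤ C := by
    have := hC 0
    simp only [Finset.range_zero, Finset.biUnion_empty, Finset.card_empty, Nat.cast_zero] at this
    exact nonneg_of_mul_nonneg_left this (hpos 0)
  set a := ∫ y, Φ y ∂ν with ha
  set B := {x | ¬ ∀ᶠ n in atTop, (a - ε) * (F n).card ≤ ∑ g ∈ F n, Φ (g • x)} with hB
  have hl : (0 : ℝ) < ε / 2 := by linarith
  have key : ∀ η : ℝ, 0 < η → ν B ≤ ENNReal.ofReal (2 * (1 + C) * η / (ε / 2)) := by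
    intro η hη
    obtain ⟨ι, t, c, γ, hc0, hc1, h_int⟩ := conv_approx herg hmp Φ hΦ T hT hη
    set f : X → ℝ := fun x => |∑ i ∈ t, c i * Φ (γ i • x) - a| with hf
    have hfm : Measurable f := by
      refine Measurable.abs (Measurable.sub ?_ measurable_const)
      exact Finset.measurable_fun_sum _ fun i _ => (hΦ.comp (hmp (γ i)).measurable).const_mul _
    have hf0 : ∀ x, 0 ≤ f x := fun x => abs_nonneg _
    have hΦi : ∀ g : G, Integrable (fun x => Φ (g • x)) ν := fun g =>
      Integrable.of_bound (hΦ.comp (hmp g).measurable).aestronglyMeasurable T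
        (Eventually.of_forall fun x => by simpa using hT _)
    have hfi : Integrable f ν :=
      ((integrable_finsetSum _ fun i _ => (hΦi _).const_mul _).sub (integrable_const a)).abs
    let D : ℕ → Set X := fun N => {x | ∃ n < N, (ε / 2) * (F n).card < ∑ g ∈ F n, f (g • x)}
    have hDN : ∀ N, ν (D N) ≤ ENNReal.ofReal (2 * (1 + C) * η / (ε / 2)) := by
      intro N
      have h1 := maximal F hF hC0 hC ν hmp f hfm hf0 hfi N hl
      rw [← ofReal_measureReal]
      refine ENNReal.ofReal_le_ofReal ?_
      rw [le_div_iff₀ hl, mul_comm]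
      exact h1.trans (mul_le_mul_of_nonneg_left h_int (by linarith))
    have hDmono : Monotone D := fun N M h x ⟨n, hn, hx⟩ => ⟨n, hn.trans_le h, hx⟩
    have hsub : B ⊆ ⋃ N, D N := by
      intro x hx
      by_contra hcon
      apply hx
      simp only [mem_iUnion, not_exists] at hcon
      have hgood : ∀ n, ∑ g ∈ F n, f (g • x) ≤ (ε / 2) * (F n).card := by
        intro n
        by_contra h
        exact hcon (n + 1) ⟨n, Nat.lt_succ_self n, not_le.1 h⟩
      have hlim : Tendsto (fun n => ∑ i ∈ t, c i * (T *
          (((symmDiff (F n) ((F n).image (γ i * ·))).card : ℝ) / (F n).card))) atTop (𝓝 0) := by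
        have := tendsto_finsetSum t (fun i _ => ((hF.2 (γ i)).const_mul T).const_mul (c i))
        simpa using this
      filter_upwards [hlim.eventually (gt_mem_nhds hl)] with n hn
      have h1 : ∑ i ∈ t, c i * (T * ((symmDiff (F n) ((F n).image (γ i * ·))).card : ℝ))
          ≤ (ε / 2) * (F n).card := by
        have h2 : ∑ i ∈ t, c i * (T * (((symmDiff (F n) ((F n).image (γ i * ·))).card : ℝ)
            / (F n).card)) = (∑ i ∈ t, c i * (T *
            ((symmDiff (F n) ((F n).image (γ i * ·))).card : ℝ))) / (F n).card := by
          rw [Finset.sum_div]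
          exact Finset.sum_congr rfl fun i _ => by ring
        rw [h2, div_lt_iff₀ (hpos n)] at hn
        exact hn.le
      have h3 : ∑ g ∈ F n, (a - f (g • x)) ≤ ∑ g ∈ F n, ∑ i ∈ t, c i * Φ (γ i • g • x) := by
        refine Finset.sum_le_sum fun g _ => ?_
        have := neg_abs_le (∑ i ∈ t, c i * Φ (γ i • g • x) - a)
        simp only [hf]
        linarith
      rw [Finset.sum_sub_distrib, Finset.sum_const, nsmul_eq_mul, Finset.sum_comm] at h3
      have h4 : ∑ i ∈ t, ∑ g ∈ F n, c i * Φ (γ i • g • x) ≤ ∑ i ∈ t, (c i *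
          ∑ g ∈ F n, Φ (g • x) +
          c i * (T * ((symmDiff (F n) ((F n).image (γ i * ·))).card : ℝ))) := by
        refine Finset.sum_le_sum fun i hi => ?_
        rw [← Finset.mul_sum, ← mul_add]
        refine mul_le_mul_of_nonneg_left ?_ (hc0 i hi)
        have := le_of_abs_le (sum_shift_bound (F n) Φ T hT (γ i) x)
        linarith
      rw [Finset.sum_add_distrib, ← Finset.sum_mul, hc1, one_mul] at h4
      have h5 := hgood n
      have h6 : (a - ε) * (F n).card = (F n).card * a - ε / 2 * (F n).card - ε / 2 * (F n).card := by
        ring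
      rw [h6]
      linarith
    refine (measure_mono hsub).trans ?_
    rw [hDmono.measure_iUnion]
    exact iSup_le hDN
  have hB0 : ν B = 0 := by
    have hlim : Tendsto (fun η : ℝ => ENNReal.ofReal (2 * (1 + C) * η / (ε / 2))) (𝓝[>] 0)
        (𝓝 0) := by
      have h1 : Tendsto (fun η : ℝ => 2 * (1 + C) * η / (ε / 2)) (𝓝 0) (𝓝 0) := by
        have : Continuous fun η : ℝ => 2 * (1 + C) * η / (ε / 2) := by fun_prop
        simpa using this.tendsto 0
      have h2 := ENNReal.tendsto_ofReal h1
      rw [ENNReal.ofReal_zero] at h2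
      exact h2.mono_left nhdsWithin_le_nhds
    refine le_antisymm (ge_of_tendsto hlim ?_) bot_le
    filter_upwards [self_mem_nhdsWithin] with η hη
    exact key η hη
  exact hB0

end Ergodic
end LLE

namespace LLE

section Fin
variable {X : Type*} [MeasurableSpace X] {ν : Measure X} [IsProbabilityMeasure ν]

lemma integrable_fin {κ : Type*} [Fintype κ] (η : X → κ) (hη : ∀ a, MeasurableSet (η ⁻¹' {a}))
    (f : κ → ℝ) : Integrable (fun x => f (η x)) ν ∧ Measurable (fun x => f (η x)) := by
  letI : MeasurableSpace κ := ⊤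
  haveI : DiscreteMeasurableSpace κ := ⟨fun _ => trivial⟩
  have hm : Measurable η := measurable_to_countable' hη
  have hf : Measurable f := measurable_of_finite f
  refine ⟨?_, hf.comp hm⟩
  obtain ⟨C, hC⟩ := (Set.finite_range (fun a => |f a|)).bddAbove
  exact Integrable.of_bound (hf.comp hm).aestronglyMeasurable C
    (Eventually.of_forall fun x => hC ⟨η x, rfl⟩)

lemma integral_fin {κ : Type*} [Fintype κ] (η : X → κ) (hη : ∀ a, MeasurableSet (η ⁻¹' {a}))
    (f : κ → ℝ) : ∫ x, f (η x) ∂ν = ∑ a, ν.real {y | η y = a} * f a := by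
  letI : MeasurableSpace κ := ⊤
  haveI : DiscreteMeasurableSpace κ := ⟨fun _ => trivial⟩
  have hm : Measurable η := measurable_to_countable' hη
  haveI : IsProbabilityMeasure (ν.map η) := Measure.isProbabilityMeasure_map hm.aemeasurable
  have hf : Measurable f := measurable_of_finite f
  rw [← integral_map hm.aemeasurable hf.aestronglyMeasurable, integral_fintype Integrable.of_finite]
  refine Finset.sum_congr rfl fun a _ => ?_
  rw [smul_eq_mul, map_measureReal_apply hm (measurableSet_singleton a)]
  rfl

lemma sum_real_fiber {ι : Type*} [Fintype ι] (ξ : X → ι) (hξ : ∀ a, MeasurableSet (ξ ⁻¹' {a}))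
    (S : Set X) (hS : MeasurableSet S) :
    ∑ b, ν.real {y | y ∈ S ∧ ξ y = b} = ν.real S := by
  have : S = ⋃ b ∈ (Finset.univ : Finset ι), {y | y ∈ S ∧ ξ y = b} := by
    ext y; simp
  conv_rhs => rw [this]
  rw [measureReal_biUnion_finset]
  · intro a _ b _ hab
    refine Set.disjoint_left.2 ?_
    rintro y ⟨_, h1⟩ ⟨_, h2⟩
    exact hab (h1.symm.trans h2)
  · intro b _
    exact hS.inter (hξ b)

lemma term_le {n na R q : ℝ} (hn : 0 ≤ n) (hna : 0 ≤ na) (hR : 0 ≤ R) (hq : 0 ≤ q) :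
    n * (R * q / (n / na)) ≤ na * (R * q) := by
  rcases hn.eq_or_lt with h | h
  · rw [← h]; simp; positivity
  rcases hna.eq_or_lt with h' | h'
  · rw [← h']; simp
  · apply le_of_eq; field_simp

/-- Master inequality: a conditional probability given a coarser partition divided by the one given
a finer partition is a supermartingale density. -/
lemma master {κ κ' ι : Type*} [Fintype κ] [Fintype κ'] [Fintype ι]
    (η : X → κ) (hη : ∀ a, MeasurableSet (η ⁻¹' {a}))
    (ξ : X → ι) (hξ : ∀ a, MeasurableSet (ξ ⁻¹' {a})) (π : κ → κ')
    (R : κ → ℝ) (hR : ∀ a, 0 ≤ R a) :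
    ∫ x, R (η x) * (ν.real {y | π (η y) = π (η x) ∧ ξ y = ξ x} / ν.real {y | π (η y) = π (η x)}) /
      (ν.real {y | η y = η x ∧ ξ y = ξ x} / ν.real {y | η y = η x}) ∂ν ≤ ∫ x, R (η x) ∂ν := by
  classical
  have hθ : ∀ p : κ × ι, MeasurableSet ((fun x => (η x, ξ x)) ⁻¹' {p}) := by
    rintro ⟨a, b⟩
    have : (fun x => (η x, ξ x)) ⁻¹' {(a, b)} = η ⁻¹' {a} ∩ ξ ⁻¹' {b} := by
      ext x; simp
    rw [this]; exact (hη a).inter (hξ b)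
  have hπ : ∀ c, MeasurableSet {y | π (η y) = c} := by
    intro c
    have : {y | π (η y) = c} = ⋃ a ∈ (Finset.univ.filter fun a => π a = c), η ⁻¹' {a} := by
      ext y; simp
    rw [this]
    exact Finset.measurableSet_biUnion _ fun a _ => hη a
  let f : κ × ι → ℝ := fun p =>
    R p.1 * (ν.real {y | π (η y) = π p.1 ∧ ξ y = p.2} / ν.real {y | π (η y) = π p.1}) /
      (ν.real {y | η y = p.1 ∧ ξ y = p.2} / ν.real {y | η y = p.1})
  have h1 := integral_fin (ν := ν) (fun x => (η x, ξ x)) hθ f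
  refine (le_of_eq h1).trans ?_
  rw [integral_fin η hη R, Fintype.sum_prod_type]
  refine Finset.sum_le_sum fun a _ => ?_
  calc ∑ b, ν.real {y | (η y, ξ y) = (a, b)} * f (a, b)
      ≤ ∑ b, ν.real {y | η y = a} *
          (R a * (ν.real {y | π (η y) = π a ∧ ξ y = b} / ν.real {y | π (η y) = π a})) := by
        refine Finset.sum_le_sum fun b _ => ?_
        have e : {y | (η y, ξ y) = (a, b)} = {y | η y = a ∧ ξ y = b} := by
          ext y; simp
        rw [e]
        exact term_le measureReal_nonneg measureReal_nonneg (hR a)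
          (div_nonneg measureReal_nonneg measureReal_nonneg)
    _ = ν.real {y | η y = a} * (R a * ((∑ b, ν.real {y | π (η y) = π a ∧ ξ y = b})
          / ν.real {y | π (η y) = π a})) := by
        rw [← Finset.mul_sum, ← Finset.mul_sum, Finset.sum_div]
    _ ≤ ν.real {y | η y = a} * (R a * 1) := by
        have := sum_real_fiber (ν := ν) ξ hξ {y | π (η y) = π a} (hπ _)
        simp only [Set.mem_ofPred_eq] at this
        rw [this]
        refine mul_le_mul_of_nonneg_left ?_ measureReal_nonneg
        exact mul_le_mul_of_nonneg_left (div_self_le_one _) (hR a)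
    _ = _ := by rw [mul_one]

lemma master_inv {κ ι : Type*} [Fintype κ] [Fintype ι]
    (η : X → κ) (hη : ∀ a, MeasurableSet (η ⁻¹' {a}))
    (ξ : X → ι) (hξ : ∀ a, MeasurableSet (ξ ⁻¹' {a})) :
    ∫ x, 1 / (ν.real {y | η y = η x ∧ ξ y = ξ x} / ν.real {y | η y = η x}) ∂ν
      ≤ Fintype.card ι := by
  have hθ : ∀ p : κ × ι, MeasurableSet ((fun x => (η x, ξ x)) ⁻¹' {p}) := by
    rintro ⟨a, b⟩
    have : (fun x => (η x, ξ x)) ⁻¹' {(a, b)} = η ⁻¹' {a} ∩ ξ ⁻¹' {b} := by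
      ext x; simp
    rw [this]; exact (hη a).inter (hξ b)
  let f : κ × ι → ℝ := fun p =>
    1 / (ν.real {y | η y = p.1 ∧ ξ y = p.2} / ν.real {y | η y = p.1})
  have h1 := integral_fin (ν := ν) (fun x => (η x, ξ x)) hθ f
  refine (le_of_eq h1).trans ?_
  rw [Fintype.sum_prod_type]
  calc ∑ a, ∑ b, ν.real {y | (η y, ξ y) = (a, b)} * f (a, b)
      ≤ ∑ a, ∑ b : ι, ν.real {y | η y = a} := by
        refine Finset.sum_le_sum fun a _ => Finset.sum_le_sum fun b _ => ?_
        have e : {y | (η y, ξ y) = (a, b)} = {y | η y = a ∧ ξ y = b} := by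
          ext y; simp
        rw [e]
        have := term_le (n := ν.real {y | η y = a ∧ ξ y = b}) (na := ν.real {y | η y = a})
          (R := 1) (q := 1) measureReal_nonneg measureReal_nonneg zero_le_one zero_le_one
        simpa [f] using this
    _ = Fintype.card ι * ∑ a, ν.real {y | η y = a} := by
        simp [Finset.mul_sum]
    _ = Fintype.card ι := by
        have := sum_real_fiber (ν := ν) η hη univ MeasurableSet.univ
        simp only [Set.mem_univ, true_and] at this
        rw [this]; simp

end Fin

section Info
variable {G : Type*} [Group G] [DecidableEq G] {X : Type*} [MulAction G X] [MeasurableSpace X]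
  {ι : Type*} [Fintype ι]

/-- The `A`-name of `x`. -/
def nm (β : X → ι) (A : Finset G) (x : X) : A → ι := fun g => β ((g : G) • x)

/-- The measure of the atom of `⋁_{h∈A} h⁻¹β` containing `x`. -/
noncomputable def Nn (ν : Measure X) (β : X → ι) (A : Finset G) (x : X) : ℝ :=
  ν.real {y | ∀ h ∈ A, β (h • y) = β (h • x)}

/-- The conditional probability at `x` of the atom of `g⁻¹β` given `⋁_{h∈A} h⁻¹β`. -/
noncomputable def cp (ν : Measure X) (β : X → ι) (g : G) (A : Finset G) (x : X) : ℝ :=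
  Nn ν β (insert g A) x / Nn ν β A x

def Dep {Z : Type*} (β : X → ι) (B : Finset G) (f : X → Z) : Prop :=
  ∀ x y, (∀ h ∈ B, β (h • x) = β (h • y)) → f x = f y

lemma nm_eq_iff (β : X → ι) (A : Finset G) (x y : X) :
    nm β A y = nm β A x ↔ ∀ h ∈ A, β (h • y) = β (h • x) := by
  constructor
  · intro h g hg; exact congrFun h ⟨g, hg⟩
  · intro h; funext g; exact h g g.2

lemma Dep.exists_factor {β : X → ι} {B : Finset G} {f : X → ℝ} (hf : Dep β B f) :
    ∃ r : (B → ι) → ℝ, (∀ x, f x = r (nm β B x)) ∧ ((∀ x, 0 ≤ f x) → ∀ a, 0 ≤ r a) := by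
  classical
  refine ⟨fun a => if h : ∃ x, nm β B x = a then f h.choose else 0, ?_, ?_⟩
  · intro x
    have h : ∃ x', nm β B x' = nm β B x := ⟨x, rfl⟩
    simp only [dif_pos h]
    exact hf _ _ fun g hg => ((nm_eq_iff β B x _).1 h.choose_spec g hg).symm
  · intro h0 a
    simp only
    split_ifs with h
    · exact h0 _
    · exact le_rfl

lemma Dep.mono {Z : Type*} {β : X → ι} {A B : Finset G} {f : X → Z} (hf : Dep β A f) (h : A ⊆ B) :
    Dep β B f := fun x y hxy => hf x y fun g hg => hxy g (h hg)

lemma Nn_dep (ν : Measure X) (β : X → ι) (A : Finset G) : Dep β A (Nn ν β A) := by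
  intro x y h
  unfold Nn
  congr 1
  ext z
  exact forall₂_congr fun g hg => by rw [h g hg]

lemma cp_dep (ν : Measure X) (β : X → ι) (g : G) (A : Finset G) :
    Dep β (insert g A) (cp ν β g A) := by
  intro x y h
  unfold cp
  rw [Nn_dep ν β _ x y h, (Nn_dep ν β A).mono (Finset.subset_insert g A) x y h]

lemma Nn_nonneg (ν : Measure X) (β : X → ι) (A : Finset G) (x : X) : 0 ≤ Nn ν β A x :=
  measureReal_nonneg

lemma cp_nonneg (ν : Measure X) (β : X → ι) (g : G) (A : Finset G) (x : X) : 0 ≤ cp ν β g A x :=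
  div_nonneg (Nn_nonneg ..) (Nn_nonneg ..)

variable {ν : Measure X} [IsProbabilityMeasure ν]

lemma Nn_anti (β : X → ι) {A B : Finset G} (h : A ⊆ B) (x : X) :
    Nn ν β B x ≤ Nn ν β A x :=
  measureReal_mono fun _ hy g hg => hy g (h hg)

lemma Nn_le_one (β : X → ι) (A : Finset G) (x : X) : Nn ν β A x ≤ 1 := measureReal_le_one

lemma Nn_empty (β : X → ι) (x : X) : Nn ν β (∅ : Finset G) x = 1 := by
  simp [Nn]

lemma cp_le_one (β : X → ι) (g : G) (A : Finset G) (x : X) : cp ν β g A x ≤ 1 :=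
  div_le_one_of_le₀ (Nn_anti β (Finset.subset_insert g A) x) (Nn_nonneg ..)

lemma Nn_insert (β : X → ι) (g : G) (A : Finset G) (x : X) :
    Nn ν β (insert g A) x = Nn ν β A x * cp ν β g A x := by
  unfold cp
  rcases (Nn_nonneg ν β A x).eq_or_lt with h | h
  · have h1 := Nn_anti (ν := ν) β (Finset.subset_insert g A) x
    have h2 := Nn_nonneg ν β (insert g A) x
    rw [← h] at h1 ⊢
    rw [le_antisymm h1 h2]; simp
  · rw [mul_div_cancel₀ _ h.ne']


lemma nm_meas (hm : ∀ g : G, Measurable (fun x : X => g • x)) {β : X → ι}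
    (hβ : ∀ b, MeasurableSet (β ⁻¹' {b}))
    (A : Finset G) (a : A → ι) : MeasurableSet (nm β A ⁻¹' {a}) := by
  have : nm β A ⁻¹' {a} = ⋂ g : A, (fun x => (g : G) • x) ⁻¹' (β ⁻¹' {a g}) := by
    ext x
    simp only [Set.mem_preimage, Set.mem_singleton_iff, Set.mem_iInter]
    exact funext_iff
  rw [this]
  exact MeasurableSet.iInter fun g => hm g (hβ _)

lemma Dep.meas (hm : ∀ g : G, Measurable (fun x : X => g • x)) {β : X → ι}
    (hβ : ∀ b, MeasurableSet (β ⁻¹' {b}))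
    {B : Finset G} {f : X → ℝ} (hf : Dep β B f) : Integrable f ν ∧ Measurable f := by
  obtain ⟨r, hr, _⟩ := hf.exists_factor
  have : f = fun x => r (nm β B x) := funext hr
  rw [this]
  exact integrable_fin _ (nm_meas hm hβ B) r

lemma master' (hm : ∀ g : G, Measurable (fun x : X => g • x)) {β : X → ι}
    (hβ : ∀ b, MeasurableSet (β ⁻¹' {b}))
    {A B : Finset G} (hAB : A ⊆ B) (g : G) (R : X → ℝ) (hR : Dep β B R)
    (hR0 : ∀ x, 0 ≤ R x) :
    ∫ x, R x * cp ν β g A x / cp ν β g B x ∂ν ≤ ∫ x, R x ∂ν := by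
  obtain ⟨r, hr, hr0⟩ := hR.exists_factor
  have h := master (ν := ν) (nm β B) (nm_meas hm hβ B) (fun x => β (g • x))
    (fun b => hm g (hβ b)) (fun (a : B → ι) (h : A) => a ⟨h, hAB h.2⟩) r (hr0 hR0)
  have e1 : ∀ x, {y | (fun (h : A) => nm β B y ⟨h, hAB h.2⟩) = (fun (h : A) => nm β B x ⟨h, hAB h.2⟩)}
      = {y | ∀ h ∈ A, β (h • y) = β (h • x)} := by
    intro x; ext y; exact nm_eq_iff β A x y
  have e2 : ∀ x, {y | (fun (h : A) => nm β B y ⟨h, hAB h.2⟩) = (fun (h : A) => nm β B x ⟨h, hAB h.2⟩)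
      ∧ β (g • y) = β (g • x)} = {y | ∀ h ∈ insert g A, β (h • y) = β (h • x)} := by
    intro x; ext y
    rw [Set.mem_ofPred_eq, Set.mem_ofPred_eq, Finset.forall_mem_insert, and_comm]
    exact and_congr_right fun _ => nm_eq_iff β A x y
  have e3 : ∀ x, {y | nm β B y = nm β B x} = {y | ∀ h ∈ B, β (h • y) = β (h • x)} := by
    intro x; ext y; exact nm_eq_iff β B x y
  have e4 : ∀ x, {y | nm β B y = nm β B x ∧ β (g • y) = β (g • x)}
      = {y | ∀ h ∈ insert g B, β (h • y) = β (h • x)} := by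
    intro x; ext y
    rw [Set.mem_ofPred_eq, Set.mem_ofPred_eq, Finset.forall_mem_insert, and_comm]
    exact and_congr_right fun _ => nm_eq_iff β B x y
  simp only [e1, e2, e3, e4, ← hr] at h
  exact h

lemma master_inv' (hm : ∀ g : G, Measurable (fun x : X => g • x)) {β : X → ι}
    (hβ : ∀ b, MeasurableSet (β ⁻¹' {b}))
    (B : Finset G) (g : G) :
    ∫ x, 1 / cp ν β g B x ∂ν ≤ Fintype.card ι := by
  have h := master_inv (ν := ν) (nm β B) (nm_meas hm hβ B) (fun x => β (g • x))
    (fun b => hm g (hβ b))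
  have e3 : ∀ x, {y | nm β B y = nm β B x} = {y | ∀ h ∈ B, β (h • y) = β (h • x)} := by
    intro x; ext y; exact nm_eq_iff β B x y
  have e4 : ∀ x, {y | nm β B y = nm β B x ∧ β (g • y) = β (g • x)}
      = {y | ∀ h ∈ insert g B, β (h • y) = β (h • x)} := by
    intro x; ext y
    rw [Set.mem_ofPred_eq, Set.mem_ofPred_eq, Finset.forall_mem_insert, and_comm]
    exact and_congr_right fun _ => nm_eq_iff β B x y
  simp only [e3, e4] at h
  exact h

lemma Nn_pos_ae (hm : ∀ g : G, Measurable (fun x : X => g • x)) {β : X → ι}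
    (hβ : ∀ b, MeasurableSet (β ⁻¹' {b}))
    (A : Finset G) : ∀ᵐ x ∂ν, 0 < Nn ν β A x := by
  have h : {x | ¬ 0 < Nn ν β A x} ⊆ ⋃ a : {a : A → ι // ν (nm β A ⁻¹' {a}) = 0}, nm β A ⁻¹' {a.1} := by
    intro x hx
    have h0 : Nn ν β A x = 0 := le_antisymm (not_lt.1 hx) (Nn_nonneg ..)
    have e : {y | ∀ h ∈ A, β (h • y) = β (h • x)} = nm β A ⁻¹' {nm β A x} := by
      ext y; exact (nm_eq_iff β A x y).symm
    unfold Nn at h0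
    rw [e, measureReal_eq_zero_iff] at h0
    exact Set.mem_iUnion.2 ⟨⟨_, h0⟩, rfl⟩
  exact measure_mono_null h (measure_iUnion_null fun a => a.2)

lemma cp_pos_ae (hm : ∀ g : G, Measurable (fun x : X => g • x)) {β : X → ι}
    (hβ : ∀ b, MeasurableSet (β ⁻¹' {b}))
    (g : G) (A : Finset G) : ∀ᵐ x ∂ν, 0 < cp ν β g A x := by
  filter_upwards [Nn_pos_ae hm hβ A, Nn_pos_ae hm hβ (insert g A)] with x h1 h2
  exact div_pos h2 h1

/-- Conditional entropy decreases in the conditioning. -/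
lemma condEnt_anti (hm : ∀ g : G, Measurable (fun x : X => g • x)) {β : X → ι}
    (hβ : ∀ b, MeasurableSet (β ⁻¹' {b}))
    {A B : Finset G} (hAB : A ⊆ B) (g : G) :
    ∫ x, -Real.log (cp ν β g B x) ∂ν ≤ ∫ x, -Real.log (cp ν β g A x) ∂ν := by
  have hd : ∀ C : Finset G, Dep β (insert g C) (fun x => -Real.log (cp ν β g C x)) := fun C x y h => by
    simp only [cp_dep ν β g C x y h]
  have hAB' : insert g A ⊆ insert g B := Finset.insert_subset_insert g hAB
  have hiA := (Dep.meas (ν := ν) hm hβ (hd A)).1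
  have hiB := (Dep.meas (ν := ν) hm hβ (hd B)).1
  have hq : Dep β (insert g B) (fun x => (1 : ℝ) * cp ν β g A x / cp ν β g B x) := fun x y h => by
    simp only [cp_dep ν β g B x y h, (cp_dep ν β g A).mono hAB' x y h]
  have hiq := (Dep.meas (ν := ν) hm hβ hq).1
  have h1 := master' (ν := ν) hm hβ hAB g (fun _ => 1) (fun _ _ _ => rfl) (fun _ => zero_le_one)
  have h2 : ∫ x, (-Real.log (cp ν β g B x) - -Real.log (cp ν β g A x)) ∂ν
      ≤ ∫ x, (1 * cp ν β g A x / cp ν β g B x - 1) ∂ν := by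
    refine integral_mono_ae (hiB.sub hiA) (hiq.sub (integrable_const 1)) ?_
    filter_upwards [cp_pos_ae (ν := ν) hm hβ g A, cp_pos_ae (ν := ν) hm hβ g B] with x hA hB
    have := Real.log_le_sub_one_of_pos (div_pos hA hB)
    rw [Real.log_div hA.ne' hB.ne'] at this
    rw [one_mul]
    linarith
  rw [integral_sub hiB hiA, integral_sub hiq (integrable_const 1)] at h2
  simp only [integral_const, probReal_univ, smul_eq_mul, mul_one] at h1 h2
  linarith

end Info
end LLE

namespace LLE

section Chain
variable {G : Type*} [Group G] [DecidableEq G] {X : Type*} [MulAction G X] [MeasurableSpace X]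
  {ι : Type*} [Fintype ι]

/-- Elements of `A` before `g` in the order given by `ω`. -/
noncomputable def past (ω : G → ℝ) (A : Finset G) (g : G) : Finset G := A.filter fun h => ω h < ω g

lemma past_insert_max {ω : G → ℝ} (hω : Function.Injective ω) {a : G} {s : Finset G} (ha : a ∉ s)
    (hmax : ∀ x ∈ s, ω x ≤ ω a) : past ω (insert a s) a = s := by
  ext h
  simp only [past, Finset.mem_filter, Finset.mem_insert]
  constructor
  · rintro ⟨rfl | h1, h2⟩
    · exact absurd h2 (lt_irrefl _)
    · exact h1
  · intro h1
    refine ⟨Or.inr h1, lt_of_le_of_ne (hmax h h1) fun e => ha (hω e ▸ h1)⟩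

lemma past_insert_of_le {ω : G → ℝ} {a g : G} {s : Finset G} (h : ω g ≤ ω a) :
    past ω (insert a s) g = past ω s g := by
  unfold past
  rw [Finset.filter_insert, if_neg (not_lt.2 h)]

lemma past_subset (ω : G → ℝ) (A : Finset G) (g : G) : past ω A g ⊆ A := Finset.filter_subset _ _

variable {ν : Measure X} [IsProbabilityMeasure ν]

lemma Nn_chain {ω : G → ℝ} (hω : Function.Injective ω) (β : X → ι) (F : Finset G) (x : X) :
    Nn ν β F x = ∏ g ∈ F, cp ν β g (past ω F g) x := by
  induction F using Finset.induction_on_max_value ω with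
  | empty => simp [Nn_empty]
  | insert a s ha hmax ih =>
    rw [Nn_insert, Finset.prod_insert ha, past_insert_max hω ha hmax, ih, mul_comm]
    congr 1
    refine Finset.prod_congr rfl fun g hg => ?_
    rw [past_insert_of_le (hmax g hg)]

/-- The density used in the supermartingale. -/
noncomputable def Us (ν : Measure X) (β : X → ι) (ω : G → ℝ) (S L : Finset G) (x : X) : ℝ :=
  ∏ g ∈ L, (if g ∈ S then cp ν β g (past ω (L.filter (· ∈ S)) g) x / cp ν β g (past ω L g) x else 1)

lemma prod_dep {κ : Type*} (s : Finset κ) (β : X → ι) (B : Finset G) (f : κ → X → ℝ)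
    (h : ∀ k ∈ s, Dep β B (f k)) : Dep β B (fun x => ∏ k ∈ s, f k x) := fun x y hxy =>
  Finset.prod_congr rfl fun k hk => h k hk x y hxy

lemma Us_dep (ν : Measure X) (β : X → ι) (ω : G → ℝ) (S L : Finset G) :
    Dep β L (Us ν β ω S L) := by
  refine prod_dep L β L _ fun g hg => ?_
  intro x y hxy
  simp only
  split_ifs with hS
  · have h1 : insert g (past ω L g) ⊆ L := Finset.insert_subset hg (past_subset ..)
    have h2 : insert g (past ω (L.filter (· ∈ S)) g) ⊆ L :=
      Finset.insert_subset hg ((past_subset ..).trans (Finset.filter_subset _ _))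
    rw [(cp_dep ν β g _).mono h1 x y hxy, (cp_dep ν β g _).mono h2 x y hxy]
  · rfl

lemma Us_nonneg (ν : Measure X) (β : X → ι) (ω : G → ℝ) (S L : Finset G) (x : X) :
    0 ≤ Us ν β ω S L x := by
  refine Finset.prod_nonneg fun g _ => ?_
  split_ifs
  · exact div_nonneg (cp_nonneg ..) (cp_nonneg ..)
  · exact zero_le_one

lemma Us_le (hm : ∀ g : G, Measurable (fun x : X => g • x)) {β : X → ι}
    (hβ : ∀ b, MeasurableSet (β ⁻¹' {b})) {ω : G → ℝ} (hω : Function.Injective ω)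
    (S L : Finset G) : ∫ x, Us ν β ω S L x ∂ν ≤ 1 := by
  induction L using Finset.induction_on_max_value ω with
  | empty => simp [Us]
  | insert a s ha hmax ih =>
    have key : ∀ x, ∏ g ∈ s, (if g ∈ S then cp ν β g (past ω ((insert a s).filter (· ∈ S)) g) x /
        cp ν β g (past ω (insert a s) g) x else 1) = Us ν β ω S s x := by
      intro x
      refine Finset.prod_congr rfl fun g hg => ?_
      rw [past_insert_of_le (hmax g hg)]
      congr 3
      rw [Finset.filter_insert]
      split_ifs
      · rw [past_insert_of_le (hmax g hg)]
      · rfl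
    by_cases haS : a ∈ S
    · have e : ∀ x, Us ν β ω S (insert a s) x
          = Us ν β ω S s x * cp ν β a (s.filter (· ∈ S)) x / cp ν β a s x := by
        intro x
        rw [Us, Finset.prod_insert ha, key, if_pos haS, past_insert_max hω ha hmax,
          Finset.filter_insert, if_pos haS, past_insert_max hω]
        · ring
        · simp [ha]
        · intro y hy; exact hmax y (Finset.mem_filter.1 hy).1
      simp only [e]
      exact (master' hm hβ (Finset.filter_subset _ _) a _ (Us_dep ν β ω S s)
        (Us_nonneg ν β ω S s)).trans ih
    · have e : ∀ x, Us ν β ω S (insert a s) x = Us ν β ω S s x := by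
        intro x
        rw [Us, Finset.prod_insert ha, key, if_neg haS, one_mul]
      simp only [e]; exact ih

lemma super (hm : ∀ g : G, Measurable (fun x : X => g • x)) {β : X → ι}
    (hβ : ∀ b, MeasurableSet (β ⁻¹' {b})) {ω : G → ℝ} (hω : Function.Injective ω)
    {F L : Finset G} (hFL : F ⊆ L) :
    Integrable (fun x => Nn ν β F x * ∏ g ∈ F, 1 / cp ν β g (past ω L g) x) ν ∧
    ∫ x, Nn ν β F x * ∏ g ∈ F, 1 / cp ν β g (past ω L g) x ∂ν ≤ 1 := by
  have e : (fun x => Nn ν β F x * ∏ g ∈ F, 1 / cp ν β g (past ω L g) x) = Us ν β ω F L := by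
    funext x
    rw [Nn_chain hω β F x, ← Finset.prod_mul_distrib, Us, ← Finset.prod_filter]
    have hf : L.filter (· ∈ F) = F := by
      ext g; simp only [Finset.mem_filter]; exact ⟨fun h => h.2, fun h => ⟨hFL h, h⟩⟩
    rw [hf]
    refine Finset.prod_congr rfl fun g _ => ?_
    ring
  rw [e]
  exact ⟨(Dep.meas hm hβ (Us_dep ν β ω F L)).1, Us_le hm hβ hω F L⟩

lemma partitionEntropy_eq (hm : ∀ g : G, Measurable (fun x : X => g • x)) {β : X → ι}
    (hβ : ∀ b, MeasurableSet (β ⁻¹' {b})) (F : Finset G) :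
    partitionEntropy ν β F = ∫ x, -Real.log (Nn ν β F x) ∂ν := by
  have e3 : ∀ x, {y | nm β F y = nm β F x} = {y | ∀ h ∈ F, β (h • y) = β (h • x)} := by
    intro x; ext y; exact nm_eq_iff β F x y
  have h := integral_fin (ν := ν) (nm β F) (nm_meas hm hβ F)
    (fun a => -Real.log (ν.real {y | nm β F y = a}))
  simp only [e3] at h
  unfold Nn
  rw [h]
  refine Finset.sum_congr rfl fun a _ => ?_
  have : {x | ∀ g : F, β ((g : G) • x) = a g} = {y | nm β F y = a} := by
    ext y; simp only [Set.mem_ofPred_eq]; exact funext_iff.symm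
  rw [this, Real.negMulLog]
  change -(ν.real _) * Real.log (ν.real _) = _
  ring

lemma logcp_integrable (hm : ∀ g : G, Measurable (fun x : X => g • x)) {β : X → ι}
    (hβ : ∀ b, MeasurableSet (β ⁻¹' {b})) (g : G) (A : Finset G) :
    Integrable (fun x => -Real.log (cp ν β g A x)) ν :=
  (Dep.meas (ν := ν) hm hβ (B := insert g A) fun x y h => by
    rw [cp_dep ν β g A x y h]).1

lemma entropy_chain (hm : ∀ g : G, Measurable (fun x : X => g • x)) {β : X → ι}
    (hβ : ∀ b, MeasurableSet (β ⁻¹' {b})) {ω : G → ℝ} (hω : Function.Injective ω) (F : Finset G) :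
    partitionEntropy ν β F = ∑ g ∈ F, ∫ x, -Real.log (cp ν β g (past ω F g) x) ∂ν := by
  rw [partitionEntropy_eq hm hβ, ← integral_finsetSum _ fun g _ => logcp_integrable hm hβ _ _]
  refine integral_congr_ae ?_
  have : ∀ᵐ x ∂ν, ∀ g ∈ F, 0 < cp ν β g (past ω F g) x :=
    (Finset.eventually_all F).2 fun g _ => cp_pos_ae hm hβ g _
  filter_upwards [this] with x hx
  rw [Nn_chain hω, Real.log_prod (fun g hg => (hx g hg).ne'), Finset.sum_neg_distrib]

lemma Nn_image (hmp : ∀ g : G, MeasurePreserving (fun x : X => g • x) ν ν) {β : X → ι}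
    (hβ : ∀ b, MeasurableSet (β ⁻¹' {b})) (A : Finset G) (g : G) (x : X) :
    Nn ν β (A.image (· * g)) x = Nn ν β A (g • x) := by
  unfold Nn
  have e : {y | ∀ h ∈ A.image (· * g), β (h • y) = β (h • x)}
      = (fun y => g • y) ⁻¹' {y | ∀ h ∈ A, β (h • y) = β (h • g • x)} := by
    ext y
    simp only [Finset.mem_image, Set.mem_preimage, Set.mem_ofPred_eq]
    constructor
    · intro H h hh
      simpa [mul_smul] using H (h * g) ⟨h, hh, rfl⟩
    · rintro H _ ⟨h, hh, rfl⟩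
      simpa [mul_smul] using H h hh
  have hms : MeasurableSet {y | ∀ h ∈ A, β (h • y) = β (h • g • x)} := by
    have := nm_meas (fun g => (hmp g).measurable) hβ A (nm β A (g • x))
    convert this using 1
    ext y; exact (nm_eq_iff β A (g • x) y).symm
  rw [e, Measure.real, (hmp g).measure_preimage hms.nullMeasurableSet]; rfl

lemma cp_image (hmp : ∀ g : G, MeasurePreserving (fun x : X => g • x) ν ν) {β : X → ι}
    (hβ : ∀ b, MeasurableSet (β ⁻¹' {b})) (A : Finset G) (g : G) (x : X) :
    cp ν β g (A.image (· * g)) x = cp ν β 1 A (g • x) := by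
  unfold cp
  rw [Nn_image hmp hβ]
  have : insert g (A.image (· * g)) = (insert 1 A).image (· * g) := by
    rw [Finset.image_insert, one_mul]
  rw [this, Nn_image hmp hβ]

/-- Shifted order. -/
def sh (g : G) (ω : G → ℝ) : G → ℝ := fun h => ω (h * g)

lemma past_shift (ω : G → ℝ) (L : Finset G) (g : G) :
    past ω L g = (past (sh g ω) (L.image (· * g⁻¹)) 1).image (· * g) := by
  ext h
  simp only [past, sh, Finset.mem_filter, Finset.mem_image, one_mul]
  constructor
  · rintro ⟨h1, h2⟩
    exact ⟨h * g⁻¹, ⟨⟨h, h1, rfl⟩, by simpa using h2⟩, by simp⟩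
  · rintro ⟨_, ⟨⟨k, hk, rfl⟩, h2⟩, rfl⟩
    simpa using ⟨hk, by simpa using h2⟩

lemma cp_shift (hmp : ∀ g : G, MeasurePreserving (fun x : X => g • x) ν ν) {β : X → ι}
    (hβ : ∀ b, MeasurableSet (β ⁻¹' {b})) (ω : G → ℝ) (L : Finset G) (g : G) (x : X) :
    cp ν β g (past ω L g) x = cp ν β 1 (past (sh g ω) (L.image (· * g⁻¹)) 1) (g • x) := by
  rw [past_shift, cp_image hmp hβ]

end Chain
end LLE

namespace LLE

section Levy
variable {G : Type*} [Group G] [DecidableEq G] {X : Type*} [MulAction G X] [mX : MeasurableSpace X]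
  {ι : Type*} [Fintype ι]

/-- The finite algebra generated by `⋁_{h∈A} h⁻¹β`. -/
def sg (β : X → ι) (A : Finset G) : MeasurableSpace X := MeasurableSpace.comap (nm β A) ⊤

lemma sg_mono (β : X → ι) {A B : Finset G} (h : A ⊆ B) : sg β A ≤ sg β B := by
  rintro _ ⟨T, _, rfl⟩
  refine ⟨{b | (fun a : A => b ⟨a, h a.2⟩) ∈ T}, trivial, rfl⟩

lemma sg_le (hm : ∀ g : G, Measurable (fun x : X => g • x)) {β : X → ι}
    (hβ : ∀ b, MeasurableSet (β ⁻¹' {b})) (A : Finset G) : sg β A ≤ mX := by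
  letI : MeasurableSpace (A → ι) := ⊤
  haveI : DiscreteMeasurableSpace (A → ι) := ⟨fun _ => trivial⟩
  exact (measurable_to_countable' (nm_meas hm hβ A)).comap_le

variable {ν : Measure X} [IsProbabilityMeasure ν]

/-- conditional probability of `β = b`. -/
noncomputable def cb (ν : Measure X) (β : X → ι) (b : ι) (A : Finset G) (x : X) : ℝ :=
  ν.real {y | nm β A y = nm β A x ∧ β y = b} / ν.real {y | nm β A y = nm β A x}

lemma cb_eq (β : X → ι) (A : Finset G) (x : X) : cp ν β 1 A x = cb ν β (β x) A x := by
  unfold cp cb Nn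
  congr 2
  · ext y
    simp only [Finset.forall_mem_insert, one_smul, Set.mem_ofPred_eq, nm_eq_iff]
    exact and_comm
  · ext y
    simp only [Set.mem_ofPred_eq, nm_eq_iff]

lemma cb_condExp (hm : ∀ g : G, Measurable (fun x : X => g • x)) {β : X → ι}
    (hβ : ∀ b, MeasurableSet (β ⁻¹' {b})) (b : ι) (A : Finset G) :
    cb ν β b A =ᵐ[ν] ν[(β ⁻¹' {b}).indicator (fun _ => (1 : ℝ)) | sg β A] := by
  classical
  have hN := nm_meas hm hβ A
  let f : (A → ι) → ℝ := fun a => ν.real {y | nm β A y = a ∧ β y = b} / ν.real {y | nm β A y = a}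
  have hf : cb ν β b A = fun x => f (nm β A x) := rfl
  refine ae_eq_condExp_of_forall_setIntegral_eq (sg_le hm hβ A) ?_ ?_ ?_ ?_
  · exact (integrable_const 1).indicator (hβ b)
  · intro s _ _
    rw [hf]
    exact (integrable_fin _ hN f).1.integrableOn
  · rintro s ⟨T, hT, rfl⟩ -
    have hs : MeasurableSet (nm β A ⁻¹' T) := sg_le hm hβ A _ ⟨T, hT, rfl⟩
    rw [← integral_indicator hs, ← integral_indicator hs]
    have e1 : (nm β A ⁻¹' T).indicator (cb ν β b A)
        = fun x => (fun a => if a ∈ T then f a else 0) (nm β A x) := by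
      funext x
      simp [Set.indicator_apply, hf]
    rw [e1, integral_fin _ hN, Set.indicator_indicator]
    change _ = ∫ x, (nm β A ⁻¹' T ∩ β ⁻¹' {b}).indicator (1 : X → ℝ) x ∂ν
    rw [integral_indicator_one (hs.inter (hβ b))]
    rw [← sum_real_fiber (nm β A) hN _ (hs.inter (hβ b))]
    refine Finset.sum_congr rfl fun a _ => ?_
    by_cases ha : a ∈ T
    · have e2 : {y | y ∈ nm β A ⁻¹' T ∩ β ⁻¹' {b} ∧ nm β A y = a} = {y | nm β A y = a ∧ β y = b} := by
        ext y
        simp only [Set.mem_inter_iff, Set.mem_preimage, Set.mem_singleton_iff, Set.mem_ofPred_eq]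
        constructor
        · rintro ⟨⟨_, h1⟩, h2⟩; exact ⟨h2, h1⟩
        · rintro ⟨h1, h2⟩; exact ⟨⟨h1 ▸ ha, h2⟩, h1⟩
      rw [e2, if_pos ha]
      rcases eq_or_ne (ν.real {y | nm β A y = a}) 0 with h0 | h0
      · have : ν.real {y | nm β A y = a ∧ β y = b} ≤ ν.real {y | nm β A y = a} :=
          measureReal_mono fun y hy => hy.1
        rw [h0] at this
        rw [h0, le_antisymm this measureReal_nonneg]; simp
      · simp only [f]; rw [mul_div_cancel₀ _ h0]
    · have e2 : {y | y ∈ nm β A ⁻¹' T ∩ β ⁻¹' {b} ∧ nm β A y = a} = ∅ := by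
        ext y
        simp only [Set.mem_inter_iff, Set.mem_preimage, Set.mem_ofPred_eq, Set.mem_empty_iff_false,
          iff_false]
        rintro ⟨⟨h1, _⟩, h2⟩; exact ha (h2 ▸ h1)
      rw [e2, if_neg ha]; simp
  · refine StronglyMeasurable.aestronglyMeasurable ?_
    rw [hf]
    letI : MeasurableSpace (A → ι) := ⊤
    have h1 : Measurable[sg β A] (nm β A) := comap_measurable _
    exact ((measurable_of_finite f).comp h1).stronglyMeasurable

lemma sg_iSup_le (β : X → ι) {K K' : ℕ → Finset G} (h : ∀ n, ∃ m, K n ⊆ K' m) :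
    (⨆ n, sg β (K n)) ≤ ⨆ n, sg β (K' n) := by
  refine iSup_le fun n => ?_
  obtain ⟨m, hm⟩ := h n
  exact (sg_mono β hm).trans (le_iSup (fun n => sg β (K' n)) m)

lemma cb_tendsto (hm : ∀ g : G, Measurable (fun x : X => g • x)) {β : X → ι}
    (hβ : ∀ b, MeasurableSet (β ⁻¹' {b})) (b : ι) {K : ℕ → Finset G} (hK : Monotone K) :
    ∀ᵐ x ∂ν, Tendsto (fun n => cb ν β b (K n) x) atTop
      (𝓝 ((ν[(β ⁻¹' {b}).indicator (fun _ => (1 : ℝ)) | ⨆ n, sg β (K n)]) x)) := by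
  let ℱ : Filtration ℕ mX := ⟨fun n => sg β (K n), fun i j hij => sg_mono β (hK hij),
    fun n => sg_le hm hβ _⟩
  have h1 := tendsto_ae_condExp (μ := ν) (ℱ := ℱ) ((β ⁻¹' {b}).indicator (fun _ => (1 : ℝ)))
  have h2 : ∀ᵐ x ∂ν, ∀ n, cb ν β b (K n) x =
      (ν[(β ⁻¹' {b}).indicator (fun _ => (1 : ℝ)) | sg β (K n)]) x :=
    ae_all_iff.2 fun n => cb_condExp hm hβ b (K n)
  filter_upwards [h1, h2] with x h1 h2
  exact h1.congr fun n => (h2 n).symm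

lemma cp_tendsto (hm : ∀ g : G, Measurable (fun x : X => g • x)) {β : X → ι}
    (hβ : ∀ b, MeasurableSet (β ⁻¹' {b})) {K K' : ℕ → Finset G} (hK : Monotone K)
    (hK' : Monotone K') (h : ∀ n, ∃ m, K n ⊆ K' m) (h' : ∀ n, ∃ m, K' n ⊆ K m) :
    ∀ᵐ x ∂ν, ∃ q, Tendsto (fun n => cp ν β 1 (K n) x) atTop (𝓝 q) ∧
      Tendsto (fun n => cp ν β 1 (K' n) x) atTop (𝓝 q) := by
  have e : (⨆ n, sg β (K n)) = ⨆ n, sg β (K' n) :=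
    le_antisymm (sg_iSup_le β h) (sg_iSup_le β h')
  have h1 : ∀ᵐ x ∂ν, ∀ b, _ := ae_all_iff.2 fun b => cb_tendsto (ν := ν) hm hβ b hK
  have h2 : ∀ᵐ x ∂ν, ∀ b, _ := ae_all_iff.2 fun b => cb_tendsto (ν := ν) hm hβ b hK'
  filter_upwards [h1, h2] with x h1 h2
  rw [← e] at h2
  simp only [cb_eq]
  exact ⟨_, h1 (β x), h2 (β x)⟩

end Levy
end LLE

namespace LLE

section Order
variable {G : Type*} [Group G] [Countable G] [DecidableEq G]

lemma exists_order : ∃ P : Measure (G → ℝ), IsProbabilityMeasure P ∧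
    (∀ᵐ ω ∂P, Function.Injective ω) ∧ ∀ g : G, MeasurePreserving (sh g) P P := by
  let γ : Measure ℝ := ProbabilityTheory.gaussianReal 0 1
  haveI : NullSingletonClass γ := ProbabilityTheory.nullSingletonClass_gaussianReal (by simp)
  refine ⟨Measure.infinitePi fun _ : G => γ, inferInstance, ?_, ?_⟩
  · have h : ∀ g h : G, ∀ᵐ ω ∂(Measure.infinitePi fun _ : G => γ), ω g = ω h → g = h := by
      intro g h
      by_cases hgh : g = h
      · exact Eventually.of_forall fun _ _ => hgh
      · have hmeas : Measurable (fun ω : G → ℝ => (ω g, ω h)) := by fun_prop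
        have hd : MeasurableSet {p : ℝ × ℝ | p.1 = p.2} :=
          measurableSet_eq_fun measurable_fst measurable_snd
        have h1 := Measure.infinitePi_map_eval_prod (P := fun _ : G => γ) hgh
        have h2 : (γ.prod γ) {p : ℝ × ℝ | p.1 = p.2} = 0 := by
          rw [Measure.measure_prod_null hd]
          refine Eventually.of_forall fun a => ?_
          have : Prod.mk a ⁻¹' {p : ℝ × ℝ | p.1 = p.2} = {a} := by
            ext b; simp [eq_comm]
          change γ (Prod.mk a ⁻¹' {p : ℝ × ℝ | p.1 = p.2}) = 0
          rw [this]; simp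
        rw [← h1, Measure.map_apply hmeas hd] at h2
        rw [ae_iff]
        convert h2 using 2
        ext ω; simp [hgh]
    have := ae_all_iff.2 fun g => ae_all_iff.2 (h g)
    filter_upwards [this] with ω hω g h e using hω g h e
  · intro g
    refine ⟨?_, ?_⟩
    · unfold sh; fun_prop
    · exact Measure.map_infinitePi_infinitePi_of_inj (P := fun _ : G => γ) (mul_left_injective g)

lemma exists_exhaust : ∃ L : ℕ → Finset G, Monotone L ∧ ∀ g, ∃ n, g ∈ L n := by
  obtain ⟨f, hf⟩ := exists_surjective_nat G
  refine ⟨fun n => (Finset.range n).image f, ?_, ?_⟩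
  · intro m n h
    exact Finset.image_subset_image (Finset.range_mono h)
  · intro g
    obtain ⟨k, rfl⟩ := hf g
    exact ⟨k + 1, Finset.mem_image_of_mem f (Finset.mem_range.2 (Nat.lt_succ_self k))⟩

lemma exhaust_subset {L : ℕ → Finset G} (hL : Monotone L) (hL' : ∀ g, ∃ n, g ∈ L n)
    (A : Finset G) : ∃ n, A ⊆ L n := by
  induction A using Finset.induction_on with
  | empty => exact ⟨0, by simp⟩
  | insert a s _ ih =>
    obtain ⟨n, hn⟩ := ih
    obtain ⟨m, hm⟩ := hL' a
    exact ⟨max n m, Finset.insert_subset (hL (le_max_right _ _) hm) (hn.trans (hL (le_max_left _ _)))⟩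

end Order

/-- Truncated information. -/
noncomputable def psi (T p : ℝ) : ℝ := -Real.log (max p (Real.exp (-T)))

lemma psi_pos_aux (T p : ℝ) : 0 < max p (Real.exp (-T)) := lt_max_of_lt_right (Real.exp_pos _)

lemma psi_cont (T : ℝ) : Continuous (psi T) := by
  unfold psi
  exact ((continuous_id.max continuous_const).log fun p => (psi_pos_aux T p).ne').neg

lemma psi_le (T p : ℝ) : psi T p ≤ T := by
  unfold psi
  have := Real.log_le_log (Real.exp_pos (-T)) (le_max_right p (Real.exp (-T)))
  rw [Real.log_exp] at this; linarith

lemma psi_nonneg {T p : ℝ} (hT : 0 ≤ T) (hp : p ≤ 1) : 0 ≤ psi T p := by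
  unfold psi
  have : max p (Real.exp (-T)) ≤ 1 := max_le hp (Real.exp_le_one_iff.2 (by linarith))
  have := Real.log_nonpos (psi_pos_aux T p).le this
  linarith

lemma psi_abs {T p : ℝ} (hT : 0 ≤ T) (hp : p ≤ 1) : |psi T p| ≤ T :=
  abs_le.2 ⟨by linarith [psi_nonneg hT hp], psi_le T p⟩

lemma exp_psi_le {T p : ℝ} (hp : 0 < p) : Real.exp (psi T p) ≤ 1 / p := by
  unfold psi
  rw [Real.exp_neg, Real.exp_log (psi_pos_aux T p), ← one_div]
  exact one_div_le_one_div_of_le hp (le_max_left _ _)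

lemma neg_log_le_psi {T p : ℝ} (hp : 0 < p) :
    -Real.log p ≤ psi T p + Real.exp (-T) * (1 / p) := by
  unfold psi
  rcases le_total (Real.exp (-T)) p with h | h
  · rw [max_eq_left h]
    have : 0 ≤ Real.exp (-T) * (1 / p) := by positivity
    linarith
  · rw [max_eq_right h, Real.log_exp]
    have h1 : 0 < Real.exp (-T) * (1 / p) := by positivity
    have := Real.log_le_sub_one_of_pos h1
    rw [Real.log_mul (Real.exp_pos _).ne' (by positivity), Real.log_exp, one_div, Real.log_inv] at this
    rw [one_div]
    linarith

section Phi
variable {G : Type*} [Group G] [Countable G] [DecidableEq G] {X : Type*} [MulAction G X]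
  [MeasurableSpace X] {ι : Type*} [Fintype ι]

lemma cp_past_meas {ν : Measure X} [IsProbabilityMeasure ν]
    (hm : ∀ g : G, Measurable (fun x : X => g • x)) {β : X → ι}
    (hβ : ∀ b, MeasurableSet (β ⁻¹' {b})) (L : Finset G) :
    Measurable (fun p : (G → ℝ) × X => cp ν β 1 (past p.1 L 1) p.2) := by
  classical
  have e : (fun p : (G → ℝ) × X => cp ν β 1 (past p.1 L 1) p.2)
      = fun p => ∑ A ∈ L.powerset, if past p.1 L 1 = A then cp ν β 1 A p.2 else 0 := by
    funext p
    rw [Finset.sum_ite_eq, if_pos (Finset.mem_powerset.2 (past_subset ..))]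
  rw [e]
  refine Finset.measurable_sum _ fun A hA => ?_
  have hA' := Finset.mem_powerset.1 hA
  refine Measurable.ite ?_ ((Dep.meas (ν := ν) hm hβ (cp_dep ν β 1 A)).2.comp measurable_snd)
    measurable_const
  have e2 : {p : (G → ℝ) × X | past p.1 L 1 = A}
      = ⋂ h ∈ L, {p | (p.1 h < p.1 1) ↔ h ∈ A} := by
    ext p
    simp only [Set.mem_ofPred_eq, Set.mem_iInter, past, Finset.ext_iff, Finset.mem_filter]
    constructor
    · intro H h hh
      rw [← H h]; exact ⟨fun h' => ⟨hh, h'⟩, fun h' => h'.2⟩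
    · intro H h
      constructor
      · rintro ⟨h1, h2⟩; exact (H h h1).1 h2
      · intro h1; exact ⟨hA' h1, (H h (hA' h1)).2 h1⟩
  rw [e2]
  refine Finset.measurableSet_biInter _ fun h _ => ?_
  have hlt : MeasurableSet {p : (G → ℝ) × X | p.1 h < p.1 1} :=
    measurableSet_lt (by fun_prop) (by fun_prop)
  by_cases hh : h ∈ A
  · simpa [hh] using hlt
  · have e3 : {p : (G → ℝ) × X | (p.1 h < p.1 1) ↔ h ∈ A} = {p | p.1 h < p.1 1}ᶜ := by
      ext p; simp [hh]
    rw [e3]; exact hlt.compl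

/-- The conditional probability given the infinite past. -/
noncomputable def pinf (ν : Measure X) (β : X → ι) (L : ℕ → Finset G) (ω : G → ℝ) (x : X) : ℝ :=
  limsup (fun n => cp ν β 1 (past ω (L n) 1) x) atTop

variable {ν : Measure X} [IsProbabilityMeasure ν]

lemma pinf_meas (hm : ∀ g : G, Measurable (fun x : X => g • x)) {β : X → ι}
    (hβ : ∀ b, MeasurableSet (β ⁻¹' {b})) (L : ℕ → Finset G) :
    Measurable (fun p : (G → ℝ) × X => pinf ν β L p.1 p.2) :=
  Measurable.limsup fun n => cp_past_meas hm hβ (L n)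

lemma pinf_le_one (β : X → ι) (L : ℕ → Finset G) (ω : G → ℝ) (x : X) : pinf ν β L ω x ≤ 1 := by
  refine limsup_le_of_le ?_ (Eventually.of_forall fun n => cp_le_one ..)
  have : IsBoundedUnder (· ≥ ·) atTop (fun n => cp ν β 1 (past ω (L n) 1) x) :=
    isBoundedUnder_of ⟨0, fun n => cp_nonneg ..⟩
  exact this.isCoboundedUnder_le

lemma pinf_tendsto (hm : ∀ g : G, Measurable (fun x : X => g • x)) {β : X → ι}
    (hβ : ∀ b, MeasurableSet (β ⁻¹' {b})) {L L' : ℕ → Finset G} (hL : Monotone L)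
    (hLe : ∀ g, ∃ n, g ∈ L n) (hL' : Monotone L') (hLe' : ∀ g, ∃ n, g ∈ L' n) (ω : G → ℝ) :
    ∀ᵐ x ∂ν, Tendsto (fun n => cp ν β 1 (past ω (L' n) 1) x) atTop (𝓝 (pinf ν β L ω x)) := by
  have hp : ∀ {A B : Finset G}, A ⊆ B → past ω A 1 ⊆ past ω B 1 := fun h =>
    Finset.filter_subset_filter _ h
  have := cp_tendsto (ν := ν) hm hβ (K := fun n => past ω (L n) 1) (K' := fun n => past ω (L' n) 1)
    (fun _ _ h => hp (hL h)) (fun _ _ h => hp (hL' h))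
    (fun n => (exhaust_subset hL' hLe' (L n)).imp fun _ => hp)
    (fun n => (exhaust_subset hL hLe (L' n)).imp fun _ => hp)
  filter_upwards [this] with x ⟨q, h1, h2⟩
  have : pinf ν β L ω x = q := h1.limsup_eq
  rw [this]; exact h2

lemma image_exhaust {L : ℕ → Finset G} (hL : Monotone L)
    (hLe : ∀ g, ∃ n, g ∈ L n) (g : G) : Monotone (fun n => (L n).image (· * g⁻¹)) ∧
      ∀ h, ∃ n, h ∈ (L n).image (· * g⁻¹) := by
  refine ⟨fun _ _ h => Finset.image_subset_image (hL h), fun h => ?_⟩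
  obtain ⟨n, hn⟩ := hLe (h * g)
  exact ⟨n, Finset.mem_image.2 ⟨h * g, hn, by simp⟩⟩

lemma super_inf (hmp : ∀ g : G, MeasurePreserving (fun x : X => g • x) ν ν) {β : X → ι}
    (hβ : ∀ b, MeasurableSet (β ⁻¹' {b})) {L : ℕ → Finset G} (hL : Monotone L)
    (hLe : ∀ g, ∃ n, g ∈ L n) {T : ℝ} (hT : 0 ≤ T) {ω : G → ℝ} (hω : Function.Injective ω)
    (F : Finset G) :
    ∫ x, Nn ν β F x * Real.exp (∑ g ∈ F, psi T (pinf ν β L (sh g ω) (g • x))) ∂ν ≤ 1 := by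
  have hm : ∀ g : G, Measurable (fun x : X => g • x) := fun g => (hmp g).measurable
  have hconv : ∀ᵐ x ∂ν, ∀ g ∈ F, Tendsto (fun n => cp ν β g (past ω (L n) g) x) atTop
      (𝓝 (pinf ν β L (sh g ω) (g • x))) := by
    refine (Finset.eventually_all F).2 fun g _ => ?_
    obtain ⟨h1, h2⟩ := image_exhaust hL hLe g
    have := (hmp g).quasiMeasurePreserving.ae (pinf_tendsto (ν := ν) hm hβ hL hLe h1 h2 (sh g ω))
    filter_upwards [this] with x hx
    refine hx.congr fun n => ?_
    rw [cp_shift hmp hβ ω (L n) g x]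
  have hcd : ∀ n, ∃ B : Finset G, Dep β B (fun x => Nn ν β F x *
      Real.exp (∑ g ∈ F, psi T (cp ν β g (past ω (L n) g) x))) := by
    intro n
    refine ⟨F ∪ L n, fun x y h => ?_⟩
    simp only
    rw [(Nn_dep ν β F).mono Finset.subset_union_left x y h]
    congr 2
    refine Finset.sum_congr rfl fun g hg => ?_
    have : insert g (past ω (L n) g) ⊆ F ∪ L n :=
      Finset.insert_subset (Finset.mem_union_left _ hg)
        ((past_subset ..).trans Finset.subset_union_right)
    rw [(cp_dep ν β g _).mono this x y h]
  have hlim : Tendsto (fun n => ∫ x, Nn ν β F x *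
      Real.exp (∑ g ∈ F, psi T (cp ν β g (past ω (L n) g) x)) ∂ν) atTop
      (𝓝 (∫ x, Nn ν β F x * Real.exp (∑ g ∈ F, psi T (pinf ν β L (sh g ω) (g • x))) ∂ν)) := by
    refine tendsto_integral_of_dominated_convergence (fun _ => Real.exp (F.card * T)) ?_
      (integrable_const _) ?_ ?_
    · intro n
      obtain ⟨B, hB⟩ := hcd n
      exact (Dep.meas (ν := ν) hm hβ hB).1.aestronglyMeasurable
    · intro n
      refine Eventually.of_forall fun x => ?_
      rw [Real.norm_of_nonneg (mul_nonneg (Nn_nonneg ..) (Real.exp_pos _).le)]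
      calc _ ≤ 1 * Real.exp (F.card * T) := by
            refine mul_le_mul (Nn_le_one ..) (Real.exp_le_exp.2 ?_) (Real.exp_pos _).le zero_le_one
            calc _ ≤ ∑ g ∈ F, T := Finset.sum_le_sum fun g _ => psi_le ..
              _ = _ := by simp
        _ = _ := one_mul _
    · filter_upwards [hconv] with x hx
      refine Tendsto.const_mul _ ((Real.continuous_exp.tendsto _).comp ?_)
      exact tendsto_finsetSum _ fun g hg => ((psi_cont T).tendsto _).comp (hx g hg)
  obtain ⟨n0, hn0⟩ := exhaust_subset hL hLe F
  refine le_of_tendsto hlim (eventually_atTop.2 ⟨n0, fun n hn => ?_⟩)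
  obtain ⟨hi, hle⟩ := super (ν := ν) hm hβ hω (hn0.trans (hL hn))
  refine le_trans (integral_mono_ae ?_ hi ?_) hle
  · obtain ⟨B, hB⟩ := hcd n
    exact (Dep.meas (ν := ν) hm hβ hB).1
  · have : ∀ᵐ x ∂ν, ∀ g ∈ F, 0 < cp ν β g (past ω (L n) g) x :=
      (Finset.eventually_all F).2 fun g _ => cp_pos_ae hm hβ g _
    filter_upwards [this] with x hx
    refine mul_le_mul_of_nonneg_left ?_ (Nn_nonneg ..)
    rw [Real.exp_sum]
    exact Finset.prod_le_prod (fun g _ => (Real.exp_pos _).le) fun g hg => exp_psi_le (hx g hg)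

end Phi
attribute [irreducible] pinf psi

end LLE

namespace LLE


section Phi
variable {G : Type*} [Group G] [Countable G] [DecidableEq G] {X : Type*} [MulAction G X]
  [MeasurableSpace X] {ι : Type*} [Fintype ι] {ν : Measure X} [IsProbabilityMeasure ν]

/-- Truncated information function averaged over random orders. -/
noncomputable def Phi (ν : Measure X) (β : X → ι) (L : ℕ → Finset G) (P : Measure (G → ℝ)) (T : ℝ)
    (x : X) : ℝ := ∫ ω, psi T (pinf ν β L ω x) ∂P

variable {P : Measure (G → ℝ)} [IsProbabilityMeasure P]

lemma psipinf_meas (hm : ∀ g : G, Measurable (fun x : X => g • x)) {β : X → ι}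
    (hβ : ∀ b, MeasurableSet (β ⁻¹' {b})) (L : ℕ → Finset G) (T : ℝ) :
    Measurable (fun p : (G → ℝ) × X => psi T (pinf ν β L p.1 p.2)) :=
  (psi_cont T).measurable.comp (pinf_meas hm hβ L)

lemma Phi_meas (hm : ∀ g : G, Measurable (fun x : X => g • x)) {β : X → ι}
    (hβ : ∀ b, MeasurableSet (β ⁻¹' {b})) (L : ℕ → Finset G) (T : ℝ) :
    Measurable (Phi ν β L P T) :=
  ((psipinf_meas hm hβ L T).stronglyMeasurable.integral_prod_left).measurable

lemma Phi_bound {β : X → ι} (L : ℕ → Finset G) {T : ℝ} (hT : 0 ≤ T) (x : X) :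
    |Phi ν β L P T x| ≤ T := by
  have := norm_integral_le_of_norm_le_const (μ := P) (f := fun ω => psi T (pinf ν β L ω x))
    (Eventually.of_forall fun ω => psi_abs hT (pinf_le_one β L ω x))
  simpa [Phi] using this

lemma Phi_super (hmp : ∀ g : G, MeasurePreserving (fun x : X => g • x) ν ν) {β : X → ι}
    (hβ : ∀ b, MeasurableSet (β ⁻¹' {b})) {L : ℕ → Finset G} (hL : Monotone L)
    (hLe : ∀ g, ∃ n, g ∈ L n) {T : ℝ} (hT : 0 ≤ T) (hinj : ∀ᵐ ω ∂P, Function.Injective ω)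
    (hP : ∀ g : G, MeasurePreserving (sh g) P P) (F : Finset G) :
    Integrable (fun x => Nn ν β F x * Real.exp (∑ g ∈ F, Phi ν β L P T (g • x))) ν ∧
    ∫ x, Nn ν β F x * Real.exp (∑ g ∈ F, Phi ν β L P T (g • x)) ∂ν ≤ 1 := by
  have hm : ∀ g : G, Measurable (fun x : X => g • x) := fun g => (hmp g).measurable
  have hNm : Measurable (Nn ν β F) := (Dep.meas (ν := ν) hm hβ (Nn_dep ν β F)).2
  have hmg : ∀ g, Measurable (fun p : (G → ℝ) × X => psi T (pinf ν β L (sh g p.1) (g • p.2))) := by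
    intro g
    have hq1 : Measurable (fun p : (G → ℝ) × X => sh g p.1) := (hP g).measurable.comp measurable_fst
    have hq2 : Measurable (fun p : (G → ℝ) × X => g • p.2) := (hm g).comp measurable_snd
    have hq3 := psipinf_meas (ν := ν) hm hβ L T
    have hq4 := hq1.prodMk hq2
    have hq5 := hq3.comp hq4
    simp only [Function.comp_def] at hq5
    exact hq5
  have hS : Measurable (fun p : (G → ℝ) × X => ∑ g ∈ F, psi T (pinf ν β L (sh g p.1) (g • p.2))) :=
    Finset.measurable_sum _ fun g _ => hmg g
  have hSb : ∀ ω x, ∑ g ∈ F, psi T (pinf ν β L (sh g ω) (g • x)) ≤ F.card * T := fun ω x => by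
    calc _ ≤ ∑ g ∈ F, T := Finset.sum_le_sum fun g _ => psi_le ..
      _ = _ := by simp
  have hSn : ∀ ω x, 0 ≤ ∑ g ∈ F, psi T (pinf ν β L (sh g ω) (g • x)) := fun ω x =>
    Finset.sum_nonneg fun g _ => psi_nonneg hT (pinf_le_one ..)
  -- the big joint function
  have hJ : Measurable (fun p : (G → ℝ) × X => Nn ν β F p.2 *
      Real.exp (∑ g ∈ F, psi T (pinf ν β L (sh g p.1) (g • p.2)))) :=
    (hNm.comp measurable_snd).mul (Real.measurable_exp.comp hS)
  have hJi : Integrable (fun p : (G → ℝ) × X => Nn ν β F p.2 *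
      Real.exp (∑ g ∈ F, psi T (pinf ν β L (sh g p.1) (g • p.2)))) (P.prod ν) := by
    refine Integrable.of_bound hJ.aestronglyMeasurable (Real.exp (F.card * T))
      (Eventually.of_forall fun p => ?_)
    rw [Real.norm_of_nonneg (mul_nonneg (Nn_nonneg ..) (Real.exp_pos _).le)]
    calc _ ≤ 1 * Real.exp (F.card * T) :=
          mul_le_mul (Nn_le_one ..) (Real.exp_le_exp.2 (hSb _ _)) (Real.exp_pos _).le zero_le_one
      _ = _ := one_mul _
  have hPhi : ∀ x g, Phi ν β L P T (g • x) = ∫ ω, psi T (pinf ν β L (sh g ω) (g • x)) ∂P := by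
    intro x g
    refine (integral_mp (hP g) (f := fun ω => psi T (pinf ν β L ω (g • x))) ?_).symm
    have hq : Measurable (fun ω : G → ℝ => (ω, g • x)) := measurable_prodMk_right
    exact (psipinf_meas (ν := ν) hm hβ L T).comp hq
  have hgi : ∀ x g, Integrable (fun ω => psi T (pinf ν β L (sh g ω) (g • x))) P := by
    intro x g
    have hq : Measurable (fun ω : G → ℝ => (ω, x)) := measurable_prodMk_right
    have hq' := (hmg g).comp hq
    refine Integrable.of_bound (Measurable.aestronglyMeasurable hq') T
      (Eventually.of_forall fun ω => psi_abs hT (pinf_le_one ..))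
  have hei : ∀ x, Integrable (fun ω => Real.exp (∑ g ∈ F, psi T (pinf ν β L (sh g ω) (g • x)))) P := by
    intro x
    have hq : Measurable (fun ω : G → ℝ => (ω, x)) := measurable_prodMk_right
    have hq' := (Real.measurable_exp.comp hS).comp hq
    refine Integrable.of_bound (Measurable.aestronglyMeasurable hq') (Real.exp (F.card * T))
      (Eventually.of_forall fun ω => ?_)
    rw [Real.norm_of_nonneg (Real.exp_pos _).le]
    exact Real.exp_le_exp.2 (hSb _ _)
  have hjen : ∀ x, Real.exp (∑ g ∈ F, Phi ν β L P T (g • x)) ≤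
      ∫ ω, Real.exp (∑ g ∈ F, psi T (pinf ν β L (sh g ω) (g • x))) ∂P := by
    intro x
    simp only [hPhi]
    rw [← integral_finsetSum _ fun g _ => hgi x g]
    exact convexOn_exp.map_integral_le Real.continuous_exp.continuousOn isClosed_univ
      (Eventually.of_forall fun _ => trivial) (integrable_finsetSum _ fun g _ => hgi x g) (hei x)
  have hIm : Measurable (fun x => Nn ν β F x * Real.exp (∑ g ∈ F, Phi ν β L P T (g • x))) :=
    hNm.mul (Real.measurable_exp.comp (Finset.measurable_sum _ fun g _ =>
      (Phi_meas hm hβ L T).comp (hm g)))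
  have hle : ∀ x, Nn ν β F x * Real.exp (∑ g ∈ F, Phi ν β L P T (g • x)) ≤
      ∫ ω, Nn ν β F x * Real.exp (∑ g ∈ F, psi T (pinf ν β L (sh g ω) (g • x))) ∂P := by
    intro x
    rw [integral_const_mul]
    exact mul_le_mul_of_nonneg_left (hjen x) (Nn_nonneg ..)
  have hI : Integrable (fun x => Nn ν β F x * Real.exp (∑ g ∈ F, Phi ν β L P T (g • x))) ν := by
    refine hJi.integral_prod_right.mono' hIm.aestronglyMeasurable (Eventually.of_forall fun x => ?_)
    rw [Real.norm_of_nonneg (mul_nonneg (Nn_nonneg ..) (Real.exp_pos _).le)]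
    exact hle x
  refine ⟨hI, (integral_mono hI hJi.integral_prod_right hle).trans ?_⟩
  rw [← integral_prod_symm _ hJi, integral_prod _ hJi]
  have h1 : ∫ ω, ∫ x, Nn ν β F x * Real.exp (∑ g ∈ F, psi T (pinf ν β L (sh g ω) (g • x))) ∂ν ∂P
      ≤ ∫ _ω, (1 : ℝ) ∂P := by
    refine integral_mono_ae hJi.integral_prod_left (integrable_const 1) ?_
    filter_upwards [hinj] with ω hω
    exact super_inf hmp hβ hL hLe hT hω F
  simpa using h1

end Phi
end LLE

namespace LLE

section PhiLower
variable {G : Type*} [Group G] [Countable G] [DecidableEq G] {X : Type*} [MulAction G X]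
  [MeasurableSpace X] {ι : Type*} [Fintype ι] {ν : Measure X} [IsProbabilityMeasure ν]

/-- conditional entropy given the part of the past in `K`. -/
noncomputable def cK (ν : Measure X) (β : X → ι) (K : Finset G) (ω : G → ℝ) : ℝ :=
  ∫ x, -Real.log (cp ν β 1 (past ω K 1) x) ∂ν

lemma cond_shift (hmp : ∀ g : G, MeasurePreserving (fun x : X => g • x) ν ν) {β : X → ι}
    (hβ : ∀ b, MeasurableSet (β ⁻¹' {b})) (ω : G → ℝ) (K : Finset G) (g : G) :
    ∫ x, -Real.log (cp ν β g (past ω (K.image (· * g)) g) x) ∂ν = cK ν β K (sh g ω) := by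
  have hm : ∀ g : G, Measurable (fun x : X => g • x) := fun g => (hmp g).measurable
  have e : (K.image (· * g)).image (· * g⁻¹) = K := by
    ext h; simp
  simp only [cp_shift hmp hβ ω _ g, e]
  refine integral_mp (hmp g) (f := fun x => -Real.log (cp ν β 1 (past (sh g ω) K 1) x)) ?_
  exact (Real.measurable_log.comp (Dep.meas (ν := ν) hm hβ (cp_dep ν β 1 _)).2).neg

lemma cK_nonneg (β : X → ι) (K : Finset G) (ω : G → ℝ) : 0 ≤ cK ν β K ω :=
  integral_nonneg fun x => by
    have := Real.log_nonpos (cp_nonneg ν β 1 (past ω K 1) x) (cp_le_one ..)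
    simp only [Pi.zero_apply]; linarith

lemma cK_le (hm : ∀ g : G, Measurable (fun x : X => g • x)) {β : X → ι}
    (hβ : ∀ b, MeasurableSet (β ⁻¹' {b})) (K : Finset G) (ω : G → ℝ) :
    cK ν β K ω ≤ cK ν β ∅ ω :=
  condEnt_anti hm hβ (Finset.filter_subset_filter _ (Finset.empty_subset K)) 1

lemma cK_empty (β : X → ι) (ω ω' : G → ℝ) : cK ν β ∅ ω = cK ν β ∅ ω' := by
  simp [cK, past]

lemma cK_meas (hm : ∀ g : G, Measurable (fun x : X => g • x)) {β : X → ι}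
    (hβ : ∀ b, MeasurableSet (β ⁻¹' {b})) (K : Finset G) : Measurable (cK ν β K) :=
  (Real.measurable_log.comp (cp_past_meas (ν := ν) hm hβ K)).neg.stronglyMeasurable.integral_prod_right.measurable

lemma entropy_le (hmp : ∀ g : G, MeasurePreserving (fun x : X => g • x) ν ν) {β : X → ι}
    (hβ : ∀ b, MeasurableSet (β ⁻¹' {b})) {ω : G → ℝ} (hω : Function.Injective ω)
    (K F : Finset G) :
    partitionEntropy ν β F ≤ ∑ g ∈ F, cK ν β K (sh g ω) +
      (F.filter fun g => ¬ K.image (· * g) ⊆ F).card * cK ν β ∅ (fun _ : G => (0 : ℝ)) := by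
  have hm : ∀ g : G, Measurable (fun x : X => g • x) := fun g => (hmp g).measurable
  rw [entropy_chain hm hβ hω]
  have : ((F.filter fun g => ¬ K.image (· * g) ⊆ F).card : ℝ) * cK ν β ∅ (fun _ : G => (0 : ℝ))
      = ∑ g ∈ F, if ¬ K.image (· * g) ⊆ F then cK ν β ∅ (fun _ : G => (0 : ℝ)) else 0 := by
    rw [← Finset.sum_filter, Finset.sum_const, nsmul_eq_mul]
  rw [this, ← Finset.sum_add_distrib]
  refine Finset.sum_le_sum fun g _ => ?_
  have mono : ∀ A B : Finset G, A ⊆ B → ∫ x, -Real.log (cp ν β g (past ω B g) x) ∂ν ≤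
      ∫ x, -Real.log (cp ν β g (past ω A g) x) ∂ν := fun A B h =>
    condEnt_anti hm hβ (Finset.filter_subset_filter _ h) g
  split_ifs with h
  · rw [add_zero, ← cond_shift hmp hβ]
    exact mono _ _ h
  · have h1 := mono ∅ F (Finset.empty_subset F)
    have h2 := cond_shift (ν := ν) hmp hβ ω ∅ g
    rw [Finset.image_empty] at h2
    rw [h2, cK_empty β (sh g ω) (fun _ => 0)] at h1
    have := cK_nonneg (ν := ν) β K (sh g ω)
    linarith

lemma bad_le (K F : Finset G) : ((F.filter fun g => ¬ K.image (· * g) ⊆ F).card : ℝ) ≤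
    ∑ k ∈ K, ((symmDiff F (F.image (k * ·))).card : ℝ) := by
  have hc : ∀ k ∈ K, ((F.filter fun g => k * g ∉ F).card : ℝ)
      ≤ ((symmDiff F (F.image (k * ·))).card : ℝ) := by
    intro k _
    rw [← Finset.card_image_of_injective _ (mul_right_injective k)]
    norm_cast
    refine Finset.card_le_card ?_
    intro x hx
    obtain ⟨g, hg, rfl⟩ := Finset.mem_image.1 hx
    obtain ⟨h1, h2⟩ := Finset.mem_filter.1 hg
    rw [Finset.mem_symmDiff]
    exact Or.inr ⟨Finset.mem_image_of_mem _ h1, h2⟩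
  have : (F.filter fun g => ¬ K.image (· * g) ⊆ F) ⊆ K.biUnion fun k => F.filter fun g => k * g ∉ F := by
    intro g hg
    obtain ⟨h1, h2⟩ := Finset.mem_filter.1 hg
    obtain ⟨y, hy, hy'⟩ := Finset.not_subset.1 h2
    obtain ⟨k, hk, rfl⟩ := Finset.mem_image.1 hy
    exact Finset.mem_biUnion.2 ⟨k, hk, Finset.mem_filter.2 ⟨h1, hy'⟩⟩
  calc _ ≤ ((K.biUnion fun k => F.filter fun g => k * g ∉ F).card : ℝ) := by
        exact_mod_cast Finset.card_le_card this
    _ ≤ ∑ k ∈ K, ((F.filter fun g => k * g ∉ F).card : ℝ) := by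
        exact_mod_cast Finset.card_biUnion_le
    _ ≤ _ := Finset.sum_le_sum hc

variable {P : Measure (G → ℝ)} [IsProbabilityMeasure P]

lemma cK_integrable (hm : ∀ g : G, Measurable (fun x : X => g • x)) {β : X → ι}
    (hβ : ∀ b, MeasurableSet (β ⁻¹' {b})) (K : Finset G) : Integrable (cK ν β K) P := by
  refine Integrable.of_bound (cK_meas hm hβ K).aestronglyMeasurable (cK ν β ∅ (fun _ : G => (0 : ℝ)))
    (Eventually.of_forall fun ω => ?_)
  rw [Real.norm_of_nonneg (cK_nonneg ..), cK_empty β (fun _ => 0) ω]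
  exact cK_le hm hβ K ω

lemma E_lower (hmp : ∀ g : G, MeasurePreserving (fun x : X => g • x) ν ν) {β : X → ι}
    (hβ : ∀ b, MeasurableSet (β ⁻¹' {b})) (hinj : ∀ᵐ ω ∂P, Function.Injective ω)
    (hP : ∀ g : G, MeasurePreserving (sh g) P P) {F : ℕ → Finset G} (hF : IsFolnerSeq F)
    {M : ℝ} (hM : ∃ᶠ n in atTop, M * (F n).card ≤ partitionEntropy ν β (F n)) (K : Finset G) :
    M ≤ ∫ ω, cK ν β K ω ∂P := by
  have hm : ∀ g : G, Measurable (fun x : X => g • x) := fun g => (hmp g).measurable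
  set H0 := cK ν β ∅ (fun _ : G => (0 : ℝ)) with hH0
  have hH0n : 0 ≤ H0 := cK_nonneg ..
  have hfin : ∀ F : Finset G, partitionEntropy ν β F ≤ F.card * ∫ ω, cK ν β K ω ∂P +
      (∑ k ∈ K, ((symmDiff F (F.image (k * ·))).card : ℝ)) * H0 := by
    intro F
    have hsi : ∀ g, Integrable (fun ω => cK ν β K (sh g ω)) P := fun g =>
      (hP g).integrable_comp_of_integrable (cK_integrable hm hβ K)
    have h1 : ∫ _ω, partitionEntropy ν β F ∂P ≤ ∫ ω, (∑ g ∈ F, cK ν β K (sh g ω) +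
        (F.filter fun g => ¬ K.image (· * g) ⊆ F).card * H0) ∂P := by
      refine integral_mono_ae (integrable_const _)
        ((integrable_finsetSum _ fun g _ => hsi g).add (integrable_const _)) ?_
      filter_upwards [hinj] with ω hω
      exact entropy_le hmp hβ hω K F
    rw [integral_add (integrable_finsetSum _ fun g _ => hsi g) (integrable_const _),
      integral_finsetSum _ fun g _ => hsi g] at h1
    simp only [integral_const, probReal_univ, one_smul] at h1
    have h2 : ∀ g, ∫ ω, cK ν β K (sh g ω) ∂P = ∫ ω, cK ν β K ω ∂P := fun g =>
      integral_mp (hP g) (cK_meas hm hβ K)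
    simp only [h2, Finset.sum_const, nsmul_eq_mul] at h1
    have := mul_le_mul_of_nonneg_right (bad_le K F) hH0n
    linarith
  refine le_of_forall_pos_le_add fun ε hε => ?_
  have hlim : Tendsto (fun m => (∑ u ∈ K, ((symmDiff (F m) ((F m).image (u * ·))).card : ℝ) / (F m).card) * H0)
      atTop (𝓝 0) := by
    have := (tendsto_finsetSum K (fun u _ => hF.2 u)).mul_const H0
    simpa using this
  obtain ⟨n, h1, h2⟩ := (hM.and_eventually (hlim.eventually (gt_mem_nhds hε))).exists
  have hc : (0 : ℝ) < (F n).card := by exact_mod_cast (hF.1 n).card_pos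
  have h3 := hfin (F n)
  rw [← Finset.sum_div, div_mul_eq_mul_div, div_lt_iff₀ hc] at h2
  have : M * (F n).card ≤ (∫ ω, cK ν β K ω ∂P + ε) * (F n).card := by nlinarith
  exact le_of_mul_le_mul_right this hc

lemma psicp_meas (hm : ∀ g : G, Measurable (fun x : X => g • x)) {β : X → ι}
    (hβ : ∀ b, MeasurableSet (β ⁻¹' {b})) (K : Finset G) (T : ℝ) :
    Measurable (fun p : (G → ℝ) × X => psi T (cp ν β 1 (past p.1 K 1) p.2)) :=
  (psi_cont T).measurable.comp (cp_past_meas hm hβ K)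

lemma Phi_lower (hmp : ∀ g : G, MeasurePreserving (fun x : X => g • x) ν ν) {β : X → ι}
    (hβ : ∀ b, MeasurableSet (β ⁻¹' {b})) {L : ℕ → Finset G} (hL : Monotone L)
    (hLe : ∀ g, ∃ n, g ∈ L n) {T : ℝ} (hT : 0 ≤ T) (hinj : ∀ᵐ ω ∂P, Function.Injective ω)
    (hP : ∀ g : G, MeasurePreserving (sh g) P P) {F : ℕ → Finset G} (hF : IsFolnerSeq F)
    {M : ℝ} (hM : ∃ᶠ n in atTop, M * (F n).card ≤ partitionEntropy ν β (F n)) :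
    M - Real.exp (-T) * Fintype.card ι ≤ ∫ x, Phi ν β L P T x ∂ν := by
  have hm : ∀ g : G, Measurable (fun x : X => g • x) := fun g => (hmp g).measurable
  have hps : ∀ K : Finset G, Integrable (fun ω => ∫ x, psi T (cp ν β 1 (past ω K 1) x) ∂ν) P := by
    intro K
    refine Integrable.of_bound
      (psicp_meas hm hβ K T).stronglyMeasurable.integral_prod_right.aestronglyMeasurable T
      (Eventually.of_forall fun ω => ?_)
    have := norm_integral_le_of_norm_le_const (μ := ν)
      (f := fun x => psi T (cp ν β 1 (past ω K 1) x))
      (Eventually.of_forall fun x => psi_abs hT (cp_le_one β 1 (past ω K 1) x))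
    simpa using this
  have hpx : ∀ (K : Finset G) ω, Integrable (fun x => psi T (cp ν β 1 (past ω K 1) x)) ν := by
    intro K ω
    exact (Dep.meas (ν := ν) hm hβ (B := insert 1 (past ω K 1)) fun x y h => by
      simp only [cp_dep ν β 1 (past ω K 1) x y h]).1
  have hstep : ∀ K : Finset G, M - Real.exp (-T) * Fintype.card ι ≤
      ∫ ω, ∫ x, psi T (cp ν β 1 (past ω K 1) x) ∂ν ∂P := by
    intro K
    have h1 := E_lower hmp hβ hinj hP hF hM K
    have h2 : ∀ ω, cK ν β K ω ≤ ∫ x, psi T (cp ν β 1 (past ω K 1) x) ∂ν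
        + Real.exp (-T) * Fintype.card ι := by
      intro ω
      have hi : Integrable (fun x => 1 / cp ν β 1 (past ω K 1) x) ν :=
        (Dep.meas (ν := ν) hm hβ (B := insert 1 (past ω K 1)) fun x y h => by
          simp only [cp_dep ν β 1 (past ω K 1) x y h]).1
      calc cK ν β K ω ≤ ∫ x, (psi T (cp ν β 1 (past ω K 1) x)
            + Real.exp (-T) * (1 / cp ν β 1 (past ω K 1) x)) ∂ν := by
            refine integral_mono_ae (logcp_integrable hm hβ _ _) ((hpx K ω).add (hi.const_mul _)) ?_
            filter_upwards [cp_pos_ae (ν := ν) hm hβ 1 (past ω K 1)] with x hx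
            exact neg_log_le_psi hx
        _ = ∫ x, psi T (cp ν β 1 (past ω K 1) x) ∂ν
            + Real.exp (-T) * ∫ x, 1 / cp ν β 1 (past ω K 1) x ∂ν := by
            rw [integral_add (hpx K ω) (hi.const_mul _), integral_const_mul]
        _ ≤ _ := by
            have := master_inv' (ν := ν) hm hβ (past ω K 1) 1
            have := mul_le_mul_of_nonneg_left this (Real.exp_pos (-T)).le
            linarith
    have h3 := integral_mono (cK_integrable hm hβ K) ((hps K).add (integrable_const _)) h2
    have h4 : ∫ ω, ((∫ x, psi T (cp ν β 1 (past ω K 1) x) ∂ν)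
        + Real.exp (-T) * Fintype.card ι) ∂P =
        ∫ ω, ∫ x, psi T (cp ν β 1 (past ω K 1) x) ∂ν ∂P + Real.exp (-T) * Fintype.card ι := by
      rw [integral_add (hps K) (integrable_const _)]; simp
    have h5 : ∫ ω, cK ν β K ω ∂P ≤ _ := h3.trans (le_of_eq h4)
    linarith
  have hin : ∀ ω, Tendsto (fun n => ∫ x, psi T (cp ν β 1 (past ω (L n) 1) x) ∂ν) atTop
      (𝓝 (∫ x, psi T (pinf ν β L ω x) ∂ν)) := by
    intro ω
    refine tendsto_integral_of_dominated_convergence (fun _ => T) (fun n =>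
      (hpx (L n) ω).aestronglyMeasurable) (integrable_const _) (fun n =>
        Eventually.of_forall fun x => psi_abs hT (cp_le_one ..)) ?_
    filter_upwards [pinf_tendsto (ν := ν) hm hβ hL hLe hL hLe ω] with x hx
    exact ((psi_cont T).tendsto _).comp hx
  have hout : Tendsto (fun n => ∫ ω, ∫ x, psi T (cp ν β 1 (past ω (L n) 1) x) ∂ν ∂P) atTop
      (𝓝 (∫ ω, ∫ x, psi T (pinf ν β L ω x) ∂ν ∂P)) := by
    refine tendsto_integral_of_dominated_convergence (fun _ => T) (fun n =>
      (hps (L n)).aestronglyMeasurable) (integrable_const _) (fun n =>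
        Eventually.of_forall fun ω => ?_) (Eventually.of_forall hin)
    have := norm_integral_le_of_norm_le_const (μ := ν)
      (f := fun x => psi T (cp ν β 1 (past ω (L n) 1) x))
      (Eventually.of_forall fun x => psi_abs hT (cp_le_one β 1 (past ω (L n) 1) x))
    simpa using this
  have hfub : ∫ ω, ∫ x, psi T (pinf ν β L ω x) ∂ν ∂P = ∫ x, Phi ν β L P T x ∂ν := by
    have hi : Integrable (Function.uncurry fun ω x => psi T (pinf ν β L ω x)) (P.prod ν) := by
      refine Integrable.of_bound (psipinf_meas hm hβ L T).aestronglyMeasurable T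
        (Eventually.of_forall fun p => psi_abs hT (pinf_le_one ..))
    exact integral_integral_swap hi
  rw [← hfub]
  exact ge_of_tendsto' hout fun n => hstep (L n)

/-- Existence of a bounded function controlling the information along all finite sets. -/
lemma exists_Phi (hmp : ∀ g : G, MeasurePreserving (fun x : X => g • x) ν ν) {β : X → ι}
    (hβ : ∀ b, MeasurableSet (β ⁻¹' {b})) {F : ℕ → Finset G} (hF : IsFolnerSeq F)
    {M : ℝ} (hM : ∃ᶠ n in atTop, M * (F n).card ≤ partitionEntropy ν β (F n)) {ε : ℝ} (hε : 0 < ε) :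
    ∃ (Φ : X → ℝ) (T : ℝ), Measurable Φ ∧ (∀ x, |Φ x| ≤ T) ∧ M - ε ≤ ∫ x, Φ x ∂ν ∧
      ∀ A : Finset G, Integrable (fun x => Nn ν β A x * Real.exp (∑ g ∈ A, Φ (g • x))) ν ∧
        ∫ x, Nn ν β A x * Real.exp (∑ g ∈ A, Φ (g • x)) ∂ν ≤ 1 := by
  obtain ⟨P, hPp, hinj, hP⟩ := exists_order (G := G)
  obtain ⟨L, hL, hLe⟩ := exists_exhaust (G := G)
  have hlim : Tendsto (fun T : ℝ => Real.exp (-T) * Fintype.card ι) atTop (𝓝 0) := by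
    simpa using (Real.tendsto_exp_neg_atTop_nhds_zero).mul_const (Fintype.card ι : ℝ)
  obtain ⟨T, h1, hT⟩ := ((hlim.eventually (gt_mem_nhds hε)).and (eventually_ge_atTop 0)).exists
  have hm : ∀ g : G, Measurable (fun x : X => g • x) := fun g => (hmp g).measurable
  refine ⟨Phi ν β L P T, T, Phi_meas hm hβ L T, Phi_bound L hT, ?_,
    Phi_super hmp hβ hL hLe hT hinj hP⟩
  have := Phi_lower (ν := ν) hmp hβ hL hLe hT hinj hP hF hM
  linarith

end PhiLower
end LLE

namespace LLE

section SMB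
variable {G : Type*} [Group G] [Countable G] [DecidableEq G]

lemma growth_summable {F : ℕ → Finset G} (hG : GrowthCond F) :
    Summable (fun n => Real.exp (-((F n).card : ℝ))) := by
  have hs : Summable (fun n : ℕ => 1 / (n : ℝ) ^ 2) := Real.summable_one_div_nat_pow.2 (by norm_num)
  refine Summable.of_norm_bounded_eventually_nat hs ?_
  filter_upwards [hG.eventually_ge_atTop 2, eventually_ge_atTop 2] with n h1 h2
  have hn : (0 : ℝ) < n := by positivity
  have hlog : 0 < Real.log n := Real.log_pos (by exact_mod_cast h2)
  rw [le_div_iff₀ hlog] at h1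
  rw [Real.norm_of_nonneg (Real.exp_pos _).le, Real.exp_neg, one_div]
  refine inv_anti₀ (by positivity) ?_
  calc (n : ℝ) ^ 2 = Real.exp (2 * Real.log n) := by
        rw [two_mul, Real.exp_add, Real.exp_log hn, sq]
    _ ≤ _ := Real.exp_le_exp.2 h1

lemma borel_cantelli {X : Type*} [MeasurableSpace X] (ν : Measure X) {F : ℕ → Finset G}
    (hG : GrowthCond F) (s : ℕ → Set X)
    (h : ∀ n, ν (s n) ≤ ENNReal.ofReal (Real.exp (-((F n).card : ℝ)))) :
    ∀ᵐ x ∂ν, ∀ᶠ n in atTop, x ∉ s n := by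
  refine ae_eventually_notMem (ne_top_of_le_ne_top ?_ (ENNReal.tsum_le_tsum h))
  exact (growth_summable hG).tsum_ofReal_ne_top

variable {X : Type*} [MulAction G X]
  [MeasurableSpace X] {ι : Type*} [Fintype ι] {ν : Measure X} [IsProbabilityMeasure ν]

lemma smb_lower {F : ℕ → Finset G} (hF : IsFolnerSeq F) (hTemp : IsTemperedSeq F)
    (hG : GrowthCond F) (herg : ErgodicMeasure G ν)
    (hmp : ∀ g : G, MeasurePreserving (fun x : X => g • x) ν ν) {β : X → ι}
    (hβ : ∀ b, MeasurableSet (β ⁻¹' {b}))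
    {M : ℝ} (hM : ∃ᶠ n in atTop, M * (F n).card ≤ partitionEntropy ν β (F n)) :
    ∀ᵐ x ∂ν, ∀ᶠ n in atTop, Nn ν β (F n) x ≤ Real.exp (-(M - 3) * (F n).card) := by
  obtain ⟨Φ, T, hΦ, hT, hI, hS⟩ := exists_Phi hmp hβ hF hM one_pos
  have h1 := ergodic_lower F hF hTemp herg hmp Φ hΦ T hT one_pos
  have h2 := borel_cantelli ν hG (fun n => {x | Real.exp ((F n).card : ℝ) ≤
    Nn ν β (F n) x * Real.exp (∑ g ∈ F n, Φ (g • x))}) ?_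
  · filter_upwards [h1, h2] with x h1 h2
    filter_upwards [h1, h2] with n h1 h2
    simp only [Set.mem_ofPred_eq, not_le] at h2
    have h3 : (M - 2) * (F n).card ≤ ∑ g ∈ F n, Φ (g • x) := by
      refine le_trans (mul_le_mul_of_nonneg_right ?_ (Nat.cast_nonneg _)) h1
      linarith
    have h4 : Nn ν β (F n) x * Real.exp ((M - 2) * (F n).card) ≤ Real.exp ((F n).card : ℝ) :=
      (mul_le_mul_of_nonneg_left (Real.exp_le_exp.2 h3) (Nn_nonneg ..)).trans h2.le
    rw [← le_div_iff₀ (Real.exp_pos _), ← Real.exp_sub] at h4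
    refine h4.trans (le_of_eq ?_)
    congr 1; ring
  · intro n
    obtain ⟨hi, hle⟩ := hS (F n)
    have := mul_meas_ge_le_integral_of_nonneg (μ := ν) (Eventually.of_forall fun x =>
      mul_nonneg (Nn_nonneg ν β (F n) x) (Real.exp_pos (∑ g ∈ F n, Φ (g • x))).le) hi
      (Real.exp ((F n).card : ℝ))
    have h3 := this.trans hle
    rw [mul_comm, ← le_div_iff₀ (Real.exp_pos _), one_div, ← Real.exp_neg] at h3
    rw [← ENNReal.ofReal_toReal (measure_ne_top ν _)]
    exact ENNReal.ofReal_le_ofReal h3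

end SMB

section Balls
variable {G : Type*} [Group G] [Countable G] [DecidableEq G]
  {X : Type*} [MetricSpace X] [CompactSpace X] [MulAction G X] [ContinuousConstSMul G X]
  [MeasurableSpace X] [BorelSpace X]

lemma bowenBall_isOpen (A : Finset G) (x : X) (δ : ℝ) : IsOpen (bowenBall A x δ) := by
  have : bowenBall A x δ = ⋂ g ∈ A, {y | dist (g • x) (g • y) < δ} := by
    ext y; simp [bowenBall]
  rw [this]
  refine isOpen_biInter_finset fun g _ => isOpen_lt ?_ continuous_const
  exact continuous_const.dist (continuous_const_smul g)

lemma cover_ball (μ : Measure X) [IsProbabilityMeasure μ] (A : Finset G) (c : ℝ) {δ : ℝ}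
    (hδ : 0 < δ) :
    ∃ I : Finset X, (I.card : ℝ) ≤ Real.exp c ∧
      {x | Real.exp (-c) < μ.real (bowenBall A x δ)} ⊆ ⋃ i ∈ I, bowenBall A i (2 * δ) := by
  classical
  let B := {x | Real.exp (-c) < μ.real (bowenBall A x δ)}
  let Q : ℕ → Prop := fun m => ∃ I : Finset X, I.card = m ∧ (∀ i ∈ I, i ∈ B) ∧
    (I : Set X).PairwiseDisjoint (fun i => bowenBall A i δ)
  have hb : ∀ m, Q m → (m : ℝ) ≤ Real.exp c := by
    rintro m ⟨I, rfl, hI, hd⟩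
    have h1 : μ.real (⋃ i ∈ I, bowenBall A i δ) = ∑ i ∈ I, μ.real (bowenBall A i δ) :=
      measureReal_biUnion_finset hd fun i _ => (bowenBall_isOpen A i δ).measurableSet
    have h2 : (I.card : ℝ) * Real.exp (-c) ≤ 1 := by
      calc (I.card : ℝ) * Real.exp (-c) = ∑ i ∈ I, Real.exp (-c) := by simp
        _ ≤ ∑ i ∈ I, μ.real (bowenBall A i δ) := Finset.sum_le_sum fun i hi => (hI i hi).le
        _ ≤ 1 := by rw [← h1]; exact measureReal_le_one
    rw [Real.exp_neg, ← div_eq_mul_inv, div_le_one (Real.exp_pos _)] at h2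
    exact h2
  have hQ0 : Q 0 := ⟨∅, by simp⟩
  set N := ⌊Real.exp c⌋₊
  have hspec : Q (Nat.findGreatest Q N) := Nat.findGreatest_spec (Nat.zero_le N) hQ0
  obtain ⟨I, hIc, hIB, hId⟩ := hspec
  refine ⟨I, hb _ ⟨I, rfl, hIB, hId⟩, ?_⟩
  intro y hy
  by_contra hcon
  have hdis : ∀ i ∈ I, Disjoint (bowenBall A y δ) (bowenBall A i δ) := by
    intro i hi
    rw [Set.disjoint_left]
    intro z hz1 hz2
    refine hcon (Set.mem_iUnion₂.2 ⟨i, hi, fun g hg => ?_⟩)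
    have e1 := hz1 g hg
    have e2 := hz2 g hg
    have := dist_triangle_right (g • i) (g • y) (g • z)
    linarith
  have hyI : y ∉ I := by
    intro h
    have hy0 : y ∈ bowenBall A y δ := fun g _ => by simpa using hδ
    exact Set.disjoint_left.1 (hdis y h) hy0 hy0
  have hQ : Q (Nat.findGreatest Q N + 1) := by
    refine ⟨insert y I, by rw [Finset.card_insert_of_notMem hyI, hIc], ?_, ?_⟩
    · intro i hi
      rcases Finset.mem_insert.1 hi with rfl | h
      · exact hy
      · exact hIB i h
    · rw [Finset.coe_insert]
      exact hId.insert fun i hi _ => hdis i hi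
  have h1 : Nat.findGreatest Q N + 1 ≤ N := Nat.le_floor (hb _ hQ)
  have := Nat.le_findGreatest h1 hQ
  omega

variable {κ : Type*} [Fintype κ] {ν : Measure X} [IsProbabilityMeasure ν]

lemma names_ball {β : X → Option κ} {δ : ℝ}
    (hsep : ∀ x y i j, β x = some i → β y = some j → dist x y < 4 * δ → i = j)
    (A : Finset G) (x0 : X) (t : ℝ) :
    ν (bowenBall A x0 (2 * δ) ∩ {x | Nn ν β A x ≤ t}) ≤ 2 ^ A.card * ENNReal.ofReal t := by
  classical
  set E := bowenBall A x0 (2 * δ) ∩ {x | Nn ν β A x ≤ t} with hE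
  let S : A → Finset (Option κ) := fun g => Finset.univ.filter fun b => ∃ x ∈ E, β ((g : G) • x) = b
  have hS : ∀ g, (S g).card ≤ 2 := by
    intro g
    by_cases h : ∃ i, some i ∈ S g
    · obtain ⟨i, hi⟩ := h
      obtain ⟨x, hx, hxi⟩ := (Finset.mem_filter.1 hi).2
      have : S g ⊆ {none, some i} := by
        intro b hb
        obtain ⟨y, hy, hyb⟩ := (Finset.mem_filter.1 hb).2
        cases b with
        | none => simp
        | some j =>
          have d1 := hx.1 g g.2
          have d2 := hy.1 g g.2
          have := hsep _ _ j i hyb hxi (by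
            have := dist_triangle_left ((g : G) • y) ((g : G) • x) ((g : G) • x0)
            linarith)
          simp [this]
      exact (Finset.card_le_card this).trans Finset.card_le_two
    · have : S g ⊆ {none} := by
        intro b hb
        cases b with
        | none => simp
        | some j => exact absurd ⟨j, hb⟩ h
      exact (Finset.card_le_card this).trans (by simp)
  let N : Finset (A → Option κ) := Finset.univ.filter fun a => ∃ x ∈ E, nm β A x = a
  have hN : N ⊆ Fintype.piFinset S := by
    intro a ha
    obtain ⟨x, hx, rfl⟩ := (Finset.mem_filter.1 ha).2
    rw [Fintype.mem_piFinset]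
    intro g
    exact Finset.mem_filter.2 ⟨Finset.mem_univ _, x, hx, rfl⟩
  have hNc : N.card ≤ 2 ^ A.card := by
    refine (Finset.card_le_card hN).trans ?_
    rw [Fintype.card_piFinset]
    calc ∏ g, (S g).card ≤ ∏ _g : A, 2 := Finset.prod_le_prod' fun g _ => hS g
      _ = 2 ^ A.card := by simp
  have hsub : E ⊆ ⋃ a ∈ N, nm β A ⁻¹' {a} := by
    intro x hx
    exact Set.mem_iUnion₂.2 ⟨nm β A x, Finset.mem_filter.2 ⟨Finset.mem_univ _, x, hx, rfl⟩, rfl⟩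
  calc ν E ≤ ν (⋃ a ∈ N, nm β A ⁻¹' {a}) := measure_mono hsub
    _ ≤ ∑ a ∈ N, ν (nm β A ⁻¹' {a}) := measure_biUnion_finset_le _ _
    _ ≤ ∑ a ∈ N, ENNReal.ofReal t := by
        refine Finset.sum_le_sum fun a ha => ?_
        obtain ⟨x, hx, rfl⟩ := (Finset.mem_filter.1 ha).2
        have h1 : ν.real (nm β A ⁻¹' {nm β A x}) ≤ t := by
          have e : nm β A ⁻¹' {nm β A x} = {y | ∀ h ∈ A, β (h • y) = β (h • x)} := by
            ext y; exact nm_eq_iff β A x y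
          rw [e]; exact hx.2
        rw [← ENNReal.ofReal_toReal (measure_ne_top ν _)]
        exact ENNReal.ofReal_le_ofReal h1
    _ = N.card * ENNReal.ofReal t := by simp
    _ ≤ _ := by gcongr; exact_mod_cast hNc

lemma ball_ae (μ : Measure X) [IsProbabilityMeasure μ]
    {F : ℕ → Finset G} (hF : IsFolnerSeq F) (hTemp : IsTemperedSeq F)
    (hG : GrowthCond F) (herg : ErgodicMeasure G ν)
    (hmp : ∀ g : G, MeasurePreserving (fun x : X => g • x) ν ν) {β : X → Option κ}
    (hβ : ∀ b, MeasurableSet (β ⁻¹' {b})) {δ : ℝ} (hδ : 0 < δ)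
    (hsep : ∀ x y i j, β x = some i → β y = some j → dist x y < 4 * δ → i = j)
    {M : ℝ} (hM : ∃ᶠ n in atTop, (M + 5) * (F n).card ≤ partitionEntropy ν β (F n)) :
    ∀ᵐ x ∂ν, ∀ᶠ n in atTop, μ.real (bowenBall (F n) x δ) ≤ Real.exp (-(M * (F n).card)) := by
  have h1 := smb_lower hF hTemp hG herg hmp hβ hM
  have h2 := borel_cantelli ν hG (fun n => {x | Real.exp (-(M * (F n).card)) <
    μ.real (bowenBall (F n) x δ)} ∩ {x | Nn ν β (F n) x ≤ Real.exp (-((M + 5) - 3) * (F n).card)}) ?_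
  · filter_upwards [h1, h2] with x h1 h2
    filter_upwards [h1, h2] with n h1 h2
    by_contra hcon
    exact h2 ⟨not_le.1 hcon, h1⟩
  · intro n
    obtain ⟨I, hI, hsub⟩ := cover_ball μ (F n) (M * (F n).card) hδ
    set t := Real.exp (-((M + 5) - 3) * (F n).card)
    have ht : 0 < t := Real.exp_pos _
    calc _ ≤ ν (⋃ i ∈ I, (bowenBall (F n) i (2 * δ) ∩ {x | Nn ν β (F n) x ≤ t})) := by
          refine measure_mono ?_
          rintro x ⟨hx1, hx2⟩
          obtain ⟨i, hi, hxi⟩ := Set.mem_iUnion₂.1 (hsub hx1)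
          exact Set.mem_iUnion₂.2 ⟨i, hi, hxi, hx2⟩
      _ ≤ ∑ i ∈ I, ν (bowenBall (F n) i (2 * δ) ∩ {x | Nn ν β (F n) x ≤ t}) :=
          measure_biUnion_finset_le _ _
      _ ≤ ∑ i ∈ I, 2 ^ (F n).card * ENNReal.ofReal t :=
          Finset.sum_le_sum fun i _ => names_ball hsep _ _ _
      _ = ENNReal.ofReal (I.card * (2 ^ (F n).card * t)) := by
          rw [Finset.sum_const, nsmul_eq_mul, ENNReal.ofReal_mul (by positivity),
            ENNReal.ofReal_mul (by positivity), ENNReal.ofReal_pow (by norm_num)]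
          simp
      _ ≤ _ := by
          refine ENNReal.ofReal_le_ofReal ?_
          have h2e : (2 : ℝ) ^ (F n).card ≤ Real.exp ((F n).card : ℝ) := by
            have : (2 : ℝ) ≤ Real.exp 1 := by
              have := Real.add_one_le_exp (1 : ℝ); linarith
            calc (2 : ℝ) ^ (F n).card ≤ Real.exp 1 ^ (F n).card := by gcongr
              _ = _ := by rw [← Real.exp_nat_mul, mul_one]
          calc (I.card : ℝ) * (2 ^ (F n).card * t)
              ≤ Real.exp (M * (F n).card) * (Real.exp ((F n).card : ℝ) * t) := by gcongr
            _ = Real.exp (-((F n).card : ℝ)) := by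
                rw [← Real.exp_add, ← Real.exp_add]; congr 1; ring

end Balls
end LLE

namespace LLE
section Approx
variable {G : Type*} [Group G] [DecidableEq G] {X : Type*} [MulAction G X] [MeasurableSpace X]
  {ν : Measure X} [IsProbabilityMeasure ν] {κ : Type*} [Fintype κ] [DecidableEq κ]

/-- Conditional weights of the partition `α` given `β`. -/
noncomputable def rw_ (i : κ) : Option κ → ℝ
  | none => 1 / Fintype.card κ
  | some j => if i = j then 1 else 0

lemma rw_nonneg (i : κ) (o : Option κ) : 0 ≤ rw_ i o := by
  cases o with
  | none => simp [rw_]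
  | some j => simp only [rw_]; split_ifs <;> norm_num

lemma rw_sum [Nonempty κ] (o : Option κ) : ∑ i, rw_ i o = 1 := by
  cases o with
  | none => simp [rw_]
  | some j => simp [rw_]

lemma rw_log (α : X → κ) (β : X → Option κ) (hab : ∀ x j, β x = some j → α x = j) (x : X)
    [Nonempty κ] :
    0 < rw_ (α x) (β x) ∧ -Real.log (rw_ (α x) (β x)) =
      (β ⁻¹' {none}).indicator (fun _ => Real.log (Fintype.card κ)) x := by
  have hc : (0 : ℝ) < Fintype.card κ := by exact_mod_cast Fintype.card_pos
  cases h : β x with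
  | none =>
    refine ⟨by simpa [rw_] using hc, ?_⟩
    rw [Set.indicator_of_mem (by simpa using h)]
    simp [rw_]
  | some j =>
    have := hab x j h
    refine ⟨by simp [rw_, this], ?_⟩
    rw [Set.indicator_of_notMem (by simp [h])]
    simp [rw_, this]

lemma entropy_approx [Nonempty κ] (hmp : ∀ g : G, MeasurePreserving (fun x : X => g • x) ν ν)
    {α : X → κ} (hα : ∀ b, MeasurableSet (α ⁻¹' {b}))
    {β : X → Option κ} (hβ : ∀ b, MeasurableSet (β ⁻¹' {b}))
    (hab : ∀ x j, β x = some j → α x = j) (A : Finset G) :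
    partitionEntropy ν α A ≤ partitionEntropy ν β A +
      A.card * (ν.real (β ⁻¹' {none}) * Real.log (Fintype.card κ)) := by
  classical
  have hm : ∀ g : G, Measurable (fun x : X => g • x) := fun g => (hmp g).measurable
  set η : X → (A → κ) × (A → Option κ) := fun x => (nm α A x, nm β A x) with hηdef
  have hη : ∀ a, MeasurableSet (η ⁻¹' {a}) := by
    rintro ⟨a, b⟩
    have : η ⁻¹' {(a, b)} = nm α A ⁻¹' {a} ∩ nm β A ⁻¹' {b} := by
      ext x; simp [hηdef, Prod.ext_iff]
    rw [this]
    exact (nm_meas hm hα A a).inter (nm_meas hm hβ A b)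
  set n : (A → κ) × (A → Option κ) → ℝ := fun c => ν.real {y | η y = c} with hn
  set q : (A → κ) × (A → Option κ) → ℝ := fun c =>
    ν.real {y | nm β A y = c.2} * ∏ g : A, rw_ (c.1 g) (c.2 g) with hq
  have hq0 : ∀ c, 0 ≤ q c := fun c =>
    mul_nonneg measureReal_nonneg (Finset.prod_nonneg fun g _ => rw_nonneg _ _)
  have hqs : ∑ c, q c = 1 := by
    rw [Fintype.sum_prod_type_right]
    have : ∀ b : A → Option κ, ∑ a : A → κ, q (a, b) = ν.real {y | nm β A y = b} := by
      intro b
      simp only [hq]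
      rw [← Finset.mul_sum]
      have h := Finset.prod_univ_sum (fun _ : A => (Finset.univ : Finset κ))
        (fun g i => rw_ i (b g))
      rw [Fintype.piFinset_univ] at h
      rw [← h]
      simp [rw_sum]
    simp only [this]
    have := sum_real_fiber (ν := ν) (nm β A) (nm_meas hm hβ A) Set.univ MeasurableSet.univ
    simpa using this
  have h_int : ∫ x, q (η x) / n (η x) ∂ν ≤ 1 := by
    rw [integral_fin η hη (fun c => q c / n c), ← hqs]
    refine Finset.sum_le_sum fun c _ => ?_
    change n c * (q c / n c) ≤ q c
    rcases eq_or_ne (n c) 0 with h | h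
    · rw [h]; simpa using hq0 c
    · rw [mul_div_cancel₀ _ h]
  have hnpos : ∀ᵐ x ∂ν, 0 < n (η x) := by
    have : ν (⋃ c ∈ {c | n c = 0}, {y | η y = c}) = 0 := by
      rw [measure_biUnion_null_iff (Set.to_countable _)]
      intro c hc
      exact (measureReal_eq_zero_iff).1 hc
    filter_upwards [measure_eq_zero_iff_ae_notMem.1 this] with x hx
    refine lt_of_le_of_ne measureReal_nonneg fun h => hx ?_
    exact Set.mem_iUnion₂.2 ⟨η x, h.symm, rfl⟩
  have hNα : ∀ x, n (η x) ≤ Nn ν α A x := by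
    intro x
    refine measureReal_mono ?_
    intro y hy
    exact (nm_eq_iff α A x y).1 (congrArg Prod.fst hy)
  have hqη : ∀ x, q (η x) = Nn ν β A x * ∏ g : A, rw_ (α ((g : G) • x)) (β ((g : G) • x)) := by
    intro x
    have : {y | nm β A y = nm β A x} = {y | ∀ h ∈ A, β (h • y) = β (h • x)} := by
      ext y; exact nm_eq_iff β A x y
    simp only [hq, hηdef, this]
    rfl
  set T : X → ℝ := (β ⁻¹' {none}).indicator (fun _ => Real.log (Fintype.card κ)) with hT
  have hTm : Integrable T ν := (integrable_const _).indicator (hβ none)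
  have hTg : ∀ g : G, Integrable (fun x => T (g • x)) ν := fun g =>
    (hmp g).integrable_comp_of_integrable hTm
  have hTi : ∫ x, T x ∂ν = ν.real (β ⁻¹' {none}) * Real.log (Fintype.card κ) := by
    rw [hT, integral_indicator_const _ (hβ none)]; rfl
  have hTgi : ∀ g : G, ∫ x, T (g • x) ∂ν = ν.real (β ⁻¹' {none}) * Real.log (Fintype.card κ) := by
    intro g
    have h := integral_map (μ := ν) (hm g).aemeasurable (f := T)
      (by rw [(hmp g).map_eq]; exact hTm.aestronglyMeasurable)
    rw [(hmp g).map_eq] at h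
    rw [← hTi, h]
  have hI1 : Integrable (fun x => -Real.log (Nn ν α A x)) ν := by
    obtain ⟨f, hf, _⟩ := (Nn_dep ν α A).exists_factor
    have := (integrable_fin (ν := ν) (nm α A) (nm_meas hm hα A) (fun a => -Real.log (f a))).1
    simp only [← hf] at this
    exact this
  have hI2 : Integrable (fun x => -Real.log (Nn ν β A x)) ν := by
    obtain ⟨f, hf, _⟩ := (Nn_dep ν β A).exists_factor
    have := (integrable_fin (ν := ν) (nm β A) (nm_meas hm hβ A) (fun a => -Real.log (f a))).1
    simp only [← hf] at this
    exact this
  have hI3 := (integrable_fin (ν := ν) η hη (fun c => q c / n c)).1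
  have hIs : Integrable (fun x => ∑ g ∈ A, T (g • x)) ν := integrable_finsetSum _ fun g _ => hTg g
  rw [partitionEntropy_eq hm hα, partitionEntropy_eq hm hβ]
  have key : ∀ᵐ x ∂ν, -Real.log (Nn ν α A x) ≤
      (-Real.log (Nn ν β A x) + ∑ g ∈ A, T (g • x)) + (q (η x) / n (η x) - 1) := by
    filter_upwards [hnpos, Nn_pos_ae hm hβ A] with x h1 h2
    have hprod : 0 < ∏ g : A, rw_ (α ((g : G) • x)) (β ((g : G) • x)) :=
      Finset.prod_pos fun g _ => (rw_log α β hab _).1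
    have hqp : 0 < q (η x) := by rw [hqη]; positivity
    have e1 : Real.log (q (η x)) = Real.log (Nn ν β A x) - ∑ g ∈ A, T (g • x) := by
      rw [hqη, Real.log_mul h2.ne' hprod.ne', Real.log_prod
        (fun g _ => ((rw_log α β hab _).1).ne'), ← Finset.sum_coe_sort A]
      rw [sub_eq_add_neg, ← Finset.sum_neg_distrib]
      congr 1
      refine Finset.sum_congr rfl fun g _ => ?_
      rw [hT, ← (rw_log α β hab _).2, neg_neg]
    have e2 := Real.log_le_sub_one_of_pos (div_pos hqp h1)
    rw [Real.log_div hqp.ne' h1.ne'] at e2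
    have e3 := Real.log_le_log h1 (hNα x)
    linarith
  calc ∫ x, -Real.log (Nn ν α A x) ∂ν
      ≤ ∫ x, ((-Real.log (Nn ν β A x) + ∑ g ∈ A, T (g • x)) + (q (η x) / n (η x) - 1)) ∂ν :=
        integral_mono_ae hI1 ((hI2.add hIs).add (hI3.sub (integrable_const _))) key
    _ = (∫ x, -Real.log (Nn ν β A x) ∂ν + ∑ g ∈ A, ∫ x, T (g • x) ∂ν) +
        (∫ x, q (η x) / n (η x) ∂ν - 1) := by
        have j1 : Integrable (fun x => -Real.log (Nn ν β A x) + ∑ g ∈ A, T (g • x)) ν := hI2.add hIs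
        have j2 : Integrable (fun x => q (η x) / n (η x) - 1) ν := hI3.sub (integrable_const _)
        rw [integral_add j1 j2, integral_add hI2 hIs,
          integral_finsetSum _ fun g _ => hTg g, integral_sub hI3 (integrable_const _)]
        simp
    _ ≤ _ := by
        simp only [hTgi, Finset.sum_const, nsmul_eq_mul]
        linarith

end Approx

section Delta
variable {G : Type*} [Group G] [Countable G] [DecidableEq G]
  {X : Type*} [MetricSpace X] [CompactSpace X] [MulAction G X] [ContinuousConstSMul G X]
  [MeasurableSpace X] [BorelSpace X]

lemma exists_delta (μ : Measure X) [IsProbabilityMeasure μ] {ν : Measure X} [IsProbabilityMeasure ν]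
    {F : ℕ → Finset G} (hF : IsFolnerSeq F) (hTemp : IsTemperedSeq F)
    (hG : GrowthCond F) (herg : ErgodicMeasure G ν)
    (hmp : ∀ g : G, MeasurePreserving (fun x : X => g • x) ν ν)
    (htop : measEntropy F ν = ⊤) (M : ℝ) :
    ∃ δ : ℝ, 0 < δ ∧ ∀ᵐ x ∂ν, ∀ᶠ n in atTop,
      μ.real (bowenBall (F n) x δ) ≤ Real.exp (-(M * (F n).card)) := by
  classical
  have hlt : ENNReal.ofReal (M + 6) < measEntropy F ν := by rw [htop]; exact ENNReal.ofReal_lt_top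
  unfold measEntropy at hlt
  simp only [lt_iSup_iff] at hlt
  obtain ⟨k, α, hα, hlt⟩ := hlt
  have hfr := frequently_lt_of_lt_limsup (by isBoundedDefault) hlt
  obtain ⟨x0⟩ : Nonempty X := nonempty_of_isProbabilityMeasure ν
  haveI : Nonempty (Fin k) := ⟨α x0⟩
  have hk : 0 < k := Fin.pos (α x0)
  have hlog : 0 ≤ Real.log k := Real.log_natCast_nonneg k
  have hαm : ∀ b, MeasurableSet (α ⁻¹' {b}) := fun b => hα (measurableSet_singleton b)
  set e : ℝ := 1 / (k * (Real.log k + 1)) with he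
  have hkr : (0 : ℝ) < k := by exact_mod_cast hk
  have hepos : 0 < e := by positivity
  have hK : ∀ i, ∃ K ⊆ α ⁻¹' {i}, IsCompact K ∧ ν (α ⁻¹' {i} \ K) < ENNReal.ofReal e := fun i =>
    (hαm i).exists_isCompact_sdiff_lt (measure_ne_top _ _) (by simpa using hepos)
  choose K hKα hKc hKe using hK
  set β : X → Option (Fin k) := fun x => if x ∈ K (α x) then some (α x) else none with hβdef
  have hβs : ∀ x j, β x = some j → α x = j ∧ x ∈ K j := by
    intro x j h
    simp only [hβdef] at h
    split_ifs at h with hx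
    · obtain rfl := Option.some.inj h
      exact ⟨rfl, hx⟩
  have hβsome : ∀ j, β ⁻¹' {some j} = K j := by
    intro j
    ext x
    refine ⟨fun h => (hβs x j h).2, fun h => ?_⟩
    have : α x = j := hKα j h
    simp [hβdef, this, h]
  have hβnone : β ⁻¹' {none} = ⋃ i ∈ (Finset.univ : Finset (Fin k)), (α ⁻¹' {i} \ K i) := by
    ext x
    simp [hβdef]
  have hβ : ∀ b, MeasurableSet (β ⁻¹' {b}) := by
    intro b
    cases b with
    | none =>
      rw [hβnone]
      exact Finset.measurableSet_biUnion _ fun i _ => (hαm i).diff (hKc i).measurableSet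
    | some j => rw [hβsome]; exact (hKc j).measurableSet
  have hnone : ν.real (β ⁻¹' {none}) ≤ k * e := by
    rw [hβnone]
    calc _ ≤ ∑ i : Fin k, ν.real (α ⁻¹' {i} \ K i) := measureReal_biUnion_finset_le _ _
      _ ≤ ∑ i : Fin k, e := Finset.sum_le_sum fun i _ =>
          ENNReal.toReal_le_of_le_ofReal hepos.le (hKe i).le
      _ = k * e := by simp
  have hnl : ν.real (β ⁻¹' {none}) * Real.log (Fintype.card (Fin k)) ≤ 1 := by
    rw [Fintype.card_fin]
    calc _ ≤ k * e * Real.log k := by gcongr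
      _ = Real.log k / (Real.log k + 1) := by rw [he]; field_simp
      _ ≤ 1 := by rw [div_le_one (by positivity)]; linarith
  have hsep0 : ∀ i j : Fin k, ∃ r : ℝ, 0 < r ∧ (i ≠ j → ∀ x ∈ K i, ∀ y ∈ K j, r < dist x y) := by
    intro i j
    by_cases hij : i = j
    · exact ⟨1, one_pos, fun h => absurd hij h⟩
    have hd : Disjoint (K i) (K j) := by
      refine Set.disjoint_left.2 fun x h1 h2 => hij ?_
      have a1 : α x = i := hKα i h1
      have a2 : α x = j := hKα j h2
      exact a1.symm.trans a2
    obtain ⟨r, hr, hr'⟩ := Metric.exists_pos_forall_lt_edist (hKc i) (hKc j).isClosed hd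
    refine ⟨r, by exact_mod_cast hr, fun _ x hx y hy => ?_⟩
    have := hr' x hx y hy
    rw [edist_nndist] at this
    exact_mod_cast this
  choose r hr0 hr using hsep0
  have hev : ∀ᶠ δ : ℝ in 𝓝[>] 0, (∀ i j, 4 * δ < r i j) ∧ 0 < δ := by
    refine Filter.Eventually.and ?_ self_mem_nhdsWithin
    refine eventually_all.2 fun i => eventually_all.2 fun j => ?_
    refine eventually_nhdsWithin_of_eventually_nhds ?_
    filter_upwards [gt_mem_nhds (show (0 : ℝ) < r i j / 4 by have := hr0 i j; positivity)] with δ hδ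
    linarith
  obtain ⟨δ, hδr, hδ⟩ := hev.exists
  refine ⟨δ, hδ, ball_ae μ hF hTemp hG herg hmp hβ hδ ?_ ?_⟩
  · intro x y i j hx hy hd
    by_contra hij
    have := hr i j hij x (hβs x i hx).2 y (hβs y j hy).2
    have := hδr i j
    linarith
  · refine hfr.mono fun n hn => ?_
    have hcard : (0 : ℝ) < (F n).card := by exact_mod_cast (hF.1 n).card_pos
    have h1 : M + 6 < partitionEntropy ν α (F n) / (F n).card := (ENNReal.ofReal_lt_ofReal_iff'.1 hn).1
    rw [lt_div_iff₀ hcard] at h1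
    have h2 := entropy_approx hmp hαm hβ (fun x j h => (hβs x j h).1) (F n)
    have h3 := mul_le_mul_of_nonneg_left hnl hcard.le
    linarith

end Delta
end LLE

namespace LLE
section Decomp
variable {X : Type*} [MeasurableSpace X] {Y : Type*} [MeasurableSpace Y]
  [MeasurableSingletonClass Y] {μ : Measure X} [IsProbabilityMeasure μ]
  {π : Measure Y} [IsProbabilityMeasure π] {p : X → Y} {μy : Y → Measure X}

lemma exists_meas_version (hprob : ∀ y, IsProbabilityMeasure (μy y))
    (hdecomp : ∀ A : Set X, MeasurableSet A → μ A = ∫⁻ y, μy y A ∂π)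
    {A : Set X} (hA : MeasurableSet A) :
    ∃ g : Y → ℝ≥0∞, Measurable g ∧ ∀ᵐ y ∂π, g y = μy y A := by
  obtain ⟨g1, hg1, hle1, hi1⟩ := exists_measurable_le_lintegral_eq π (fun y => μy y A)
  obtain ⟨g2, hg2, hle2, hi2⟩ := exists_measurable_le_lintegral_eq π (fun y => μy y Aᶜ)
  refine ⟨g1, hg1, ?_⟩
  have hle : ∀ y, g1 y + g2 y ≤ 1 := fun y => by
    rw [← prob_add_prob_compl (μ := μy y) hA]
    exact add_le_add (hle1 y) (hle2 y)
  have h_int : ∫⁻ y, (g1 y + g2 y) ∂π = 1 := by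
    rw [lintegral_add_left hg1, ← hi1, ← hi2, ← hdecomp _ hA, ← hdecomp _ hA.compl,
      prob_add_prob_compl hA]
  have hae : (fun y => g1 y + g2 y) =ᵐ[π] fun _ => 1 := by
    refine ae_eq_of_ae_le_of_lintegral_le (Eventually.of_forall hle) ?_ aemeasurable_const ?_
    · rw [h_int]; exact ENNReal.one_ne_top
    · rw [h_int]; simp
  filter_upwards [hae] with y hy
  refine le_antisymm (hle1 y) ?_
  have h2 : g2 y ≠ ⊤ := ne_top_of_le_ne_top ENNReal.one_ne_top (le_trans le_add_self (hle y))
  refine (ENNReal.add_le_add_iff_right h2).1 ?_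
  rw [hy, ← prob_add_prob_compl (μ := μy y) hA]
  exact add_le_add le_rfl (hle2 y)

lemma fiber_null (hp : Measurable p) {ν : Measure X} [IsProbabilityMeasure ν] {y : Y}
    (h : ν (p ⁻¹' {y}) = 1) {T : Set Y} (hy : y ∉ T) : ν (p ⁻¹' T) = 0 := by
  have h0 : ν (p ⁻¹' {y})ᶜ = 0 := (prob_compl_eq_zero_iff (hp (measurableSet_singleton y))).2 h
  refine measure_mono_null ?_ h0
  intro x hx hxy
  have : p x = y := hxy
  exact hy (this ▸ hx)

lemma ae_pull (hp : Measurable p) (hprob : ∀ y, IsProbabilityMeasure (μy y))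
    (hdecomp : ∀ A : Set X, MeasurableSet A → μ A = ∫⁻ y, μy y A ∂π)
    (hfiber : ∀ᵐ y ∂π, μy y (p ⁻¹' {y}) = 1) {P : Y → Prop} (hP : ∀ᵐ y ∂π, P y) :
    ∀ᵐ x ∂μ, P (p x) := by
  set T := toMeasurable π {y | ¬ P y}
  have hT0 : π T = 0 := (measure_toMeasurable _).trans hP
  have hTm : MeasurableSet T := measurableSet_toMeasurable _ _
  have h0 : μ (p ⁻¹' T) = 0 := by
    rw [hdecomp _ (hp hTm)]
    have : (fun y => μy y (p ⁻¹' T)) =ᵐ[π] fun _ => 0 := by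
      filter_upwards [hfiber, measure_eq_zero_iff_ae_notMem.1 hT0] with y h1 h2
      exact fiber_null hp h1 h2
    rw [lintegral_congr_ae this]; simp
  filter_upwards [measure_eq_zero_iff_ae_notMem.1 h0] with x hx
  by_contra hc
  exact hx (subset_toMeasurable π _ hc)

lemma ae_assemble (hp : Measurable p) (hprob : ∀ y, IsProbabilityMeasure (μy y))
    (hdecomp : ∀ A : Set X, MeasurableSet A → μ A = ∫⁻ y, μy y A ∂π)
    (hfiber : ∀ᵐ y ∂π, μy y (p ⁻¹' {y}) = 1) {P : Y → Prop} {A : Set X} (hA : MeasurableSet A)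
    (hP : ∀ᵐ y ∂π, P y → μy y A = 0) :
    ∀ᵐ x ∂μ, P (p x) → x ∉ A := by
  obtain ⟨g, hg, hgA⟩ := exists_meas_version hprob hdecomp hA
  have hSm : MeasurableSet (g ⁻¹' {0}) := hg (measurableSet_singleton 0)
  have h0 : μ (A ∩ p ⁻¹' (g ⁻¹' {0})) = 0 := by
    rw [hdecomp _ (hA.inter (hp hSm))]
    have : (fun y => μy y (A ∩ p ⁻¹' (g ⁻¹' {0}))) =ᵐ[π] fun _ => 0 := by
      filter_upwards [hfiber, hgA] with y h1 h2
      by_cases hy : y ∈ g ⁻¹' {0}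
      · have hy' : g y = 0 := hy
        exact measure_mono_null Set.inter_subset_left (h2.symm.trans hy')
      · exact measure_mono_null Set.inter_subset_right (fiber_null hp h1 hy)
    rw [lintegral_congr_ae this]; simp
  have h1 := ae_pull hp hprob hdecomp hfiber (hgA.and hP)
  filter_upwards [h1, measure_eq_zero_iff_ae_notMem.1 h0] with x hx hx0 hPx hxA
  refine hx0 ⟨hxA, ?_⟩
  exact hx.1.trans (hx.2 hPx)

end Decomp

section Final
variable {G : Type*} [Group G] [Countable G] [DecidableEq G]
  {X : Type*} [MetricSpace X] [CompactSpace X] [MulAction G X] [ContinuousConstSMul G X]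
  [MeasurableSpace X] [BorelSpace X]

lemma meas_ball (μ : Measure X) [IsProbabilityMeasure μ] (A : Finset G) (δ : ℝ) :
    Measurable fun x => μ (bowenBall A x δ) := by
  haveI : SecondCountableTopology X := inferInstance
  have ho : IsOpen {q : X × X | ∀ g ∈ A, dist (g • q.1) (g • q.2) < δ} := by
    have : {q : X × X | ∀ g ∈ A, dist (g • q.1) (g • q.2) < δ} =
        ⋂ g ∈ A, {q : X × X | dist (g • q.1) (g • q.2) < δ} := by
      ext q; simp
    rw [this]
    refine isOpen_biInter_finset fun g _ => isOpen_lt ?_ continuous_const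
    fun_prop
  exact measurable_measure_prodMk_left ho.measurableSet

lemma ball_pos_ae (μ : Measure X) [IsProbabilityMeasure μ] :
    ∀ᵐ x ∂μ, ∀ (A : Finset G) (δ : ℝ), 0 < δ → 0 < μ (bowenBall A x δ) := by
  haveI : SecondCountableTopology X := inferInstance
  have hB := TopologicalSpace.isBasis_countableBasis X
  have h : ∀ᵐ x ∂μ, ∀ U ∈ TopologicalSpace.countableBasis X, x ∈ U → 0 < μ U := by
    rw [ae_ball_iff (TopologicalSpace.countable_countableBasis X)]
    intro U _
    by_cases hU : μ U = 0
    · filter_upwards [measure_eq_zero_iff_ae_notMem.1 hU] with x hx hxU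
      exact absurd hxU hx
    · exact Eventually.of_forall fun x _ => pos_iff_ne_zero.2 hU
  filter_upwards [h] with x hx A δ hδ
  have hxm : x ∈ bowenBall A x δ := by
    intro g _; simpa using hδ
  obtain ⟨U, hU, hxU, hsub⟩ := hB.exists_subset_of_mem_open hxm (bowenBall_isOpen A x δ)
  exact (hx U hU hxU).trans_le (measure_mono hsub)

/-- The good set. -/
def good (F : ℕ → Finset G) (μ : Measure X) : Set X :=
  ⋂ M : ℕ, ⋃ m : ℕ, ⋃ N : ℕ, ⋂ n : ℕ, ⋂ _ : N ≤ n,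
    {x | μ (bowenBall (F n) x (1 / ((m : ℝ) + 1))) ≤ ENNReal.ofReal (Real.exp (-(M * (F n).card)))}

lemma good_meas (F : ℕ → Finset G) (μ : Measure X) [IsProbabilityMeasure μ] :
    MeasurableSet (good F μ) := by
  refine MeasurableSet.iInter fun M => MeasurableSet.iUnion fun m => MeasurableSet.iUnion fun N =>
    MeasurableSet.iInter fun n => MeasurableSet.iInter fun _ => ?_
  exact measurableSet_le (meas_ball μ _ _) measurable_const

lemma good_top (F : ℕ → Finset G) (hF : IsFolnerSeq F) (μ : Measure X) [IsProbabilityMeasure μ]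
    {x : X} (hx : x ∈ good F μ)
    (hpos : ∀ (A : Finset G) (δ : ℝ), 0 < δ → 0 < μ (bowenBall A x δ)) :
    localLowerEntropy F μ x = ⊤ := by
  refine ENNReal.eq_top_of_forall_nnreal_le fun r => ?_
  obtain ⟨M, hM⟩ := exists_nat_ge r
  obtain ⟨m, hm⟩ := Set.mem_iUnion.1 (Set.mem_iInter.1 hx M)
  obtain ⟨N, hN⟩ := Set.mem_iUnion.1 hm
  have hδ : (0 : ℝ) < 1 / ((m : ℝ) + 1) := by positivity
  unfold localLowerEntropy
  refine le_iSup₂_of_le (1 / ((m : ℝ) + 1)) hδ ?_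
  refine le_liminf_of_le (by isBoundedDefault) ?_
  filter_upwards [eventually_ge_atTop N] with n hn
  have h1 : μ (bowenBall (F n) x (1 / ((m : ℝ) + 1))) ≤
    ENNReal.ofReal (Real.exp (-(M * (F n).card))) := Set.mem_iInter₂.1 hN n hn
  have h2 := ENNReal.toReal_le_of_le_ofReal (Real.exp_pos _).le h1
  have h3 : 0 < (μ (bowenBall (F n) x (1 / ((m : ℝ) + 1)))).toReal :=
    ENNReal.toReal_pos (hpos _ _ hδ).ne' (measure_ne_top _ _)
  have h4 := (Real.log_le_iff_le_exp h3).2 h2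
  have hcard : (0 : ℝ) < (F n).card := by exact_mod_cast (hF.1 n).card_pos
  have h5 : (r : ℝ) ≤ M := by exact_mod_cast hM
  rw [← ENNReal.ofReal_coe_nnreal]
  refine ENNReal.ofReal_le_ofReal (h5.trans ?_)
  rw [le_div_iff₀ hcard]
  linarith

lemma good_ae (μ : Measure X) [IsProbabilityMeasure μ] {ν : Measure X} [IsProbabilityMeasure ν]
    {F : ℕ → Finset G} (hF : IsFolnerSeq F) (hTemp : IsTemperedSeq F)
    (hG : GrowthCond F) (herg : ErgodicMeasure G ν) (hinv : InvariantMeasure G ν)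
    (htop : measEntropy F ν = ⊤) : ν (good F μ)ᶜ = 0 := by
  have hmp : ∀ g : G, MeasurePreserving (fun x : X => g • x) ν ν := fun g =>
    ⟨(continuous_const_smul g).measurable, hinv g⟩
  have h : ∀ᵐ x ∂ν, ∀ M : ℕ, ∃ m N : ℕ, ∀ n ≥ N,
      μ (bowenBall (F n) x (1 / ((m : ℝ) + 1))) ≤ ENNReal.ofReal (Real.exp (-(M * (F n).card))) := by
    refine ae_all_iff.2 fun M => ?_
    obtain ⟨δ, hδ, hae⟩ := exists_delta μ hF hTemp hG herg hmp htop M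
    obtain ⟨m, hm⟩ := exists_nat_one_div_lt hδ
    filter_upwards [hae] with x hx
    obtain ⟨N, hN⟩ := eventually_atTop.1 hx
    refine ⟨m, N, fun n hn => ?_⟩
    refine le_trans (measure_mono (t := bowenBall (F n) x δ) ?_) ?_
    · intro y hy g hg
      exact (hy g hg).trans hm
    · rw [← ENNReal.ofReal_toReal (measure_ne_top μ (bowenBall (F n) x δ))]
      exact ENNReal.ofReal_le_ofReal (hN n hn)
  refine measure_mono_null ?_ h
  intro x hx hcon
  refine hx (Set.mem_iInter.2 fun M => ?_)
  obtain ⟨m, N, hmN⟩ := hcon M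
  exact Set.mem_iUnion.2 ⟨m, Set.mem_iUnion.2 ⟨N, Set.mem_iInter₂.2 hmN⟩⟩

end Final
end LLE

variable {G : Type*} [Group G] [Countable G] [Infinite G] [DecidableEq G]
  {X : Type*} [MetricSpace X] [CompactSpace X] [MulAction G X] [ContinuousConstSMul G X]
  [MeasurableSpace X] [BorelSpace X]

theorem localLowerEntropy_eq_top_on_infinite_components
    (F : ℕ → Finset G) (hFol : IsFolnerSeq F) (hTemp : IsTemperedSeq F) (hGrow : GrowthCond F)
    (μ : Measure X) [IsProbabilityMeasure μ] (hinv : InvariantMeasure G μ)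
    {Y : Type*} [MeasurableSpace Y] [MeasurableSingletonClass Y]
    (π : Measure Y) [IsProbabilityMeasure π] (p : X → Y) (hp : Measurable p)
    (μy : Y → Measure X) (hprob : ∀ y, IsProbabilityMeasure (μy y))
    (hdecomp : ∀ A : Set X, MeasurableSet A → μ A = ∫⁻ y, μy y A ∂π)
    (hfiber : ∀ᵐ y ∂π, μy y (p ⁻¹' {y}) = 1)
    (hinv' : ∀ᵐ y ∂π, InvariantMeasure G (μy y))
    (herg : ∀ᵐ y ∂π, ErgodicMeasure G (μy y))
    (hpinv : ∀ᵐ x ∂μ, ∀ g : G, p (g • x) = p x) :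
    ∀ᵐ x ∂μ, measEntropy F (μy (p x)) = ⊤ → localLowerEntropy F μ x = ⊤ := by
  have h := LLE.ae_assemble (P := fun y => measEntropy F (μy y) = ⊤) hp hprob hdecomp hfiber
    (LLE.good_meas F μ).compl (by
      filter_upwards [hinv', herg] with y h1 h2 h3
      haveI := hprob y
      exact LLE.good_ae μ hFol hTemp hGrow h2 h1 h3)
  filter_upwards [h, LLE.ball_pos_ae (G := G) μ] with x hx hpos htop
  exact LLE.good_top F hFol μ (Set.notMem_compl_iff.1 (hx htop)) hpos
end

section
/- (Variational principle for Bowen entropy of compact sets.) Let G be a countable discrete infinite amenable group acting continuously on a compact metric space (X,d), let K ⊆ X be a non-empty compact set, and let {F_n} be a sequence of finite subsets of G with lim_{n→∞} |F_n|/log n = ∞. Then h^B_top(K,{F_n}) = sup{ ∫_X lim_{ε→0} liminf_{n→∞} −(1/|F_n|) log μ(B_{F_n}(x,ε)) dμ(x) : μ a Borel probability measure on X with μ(K) = 1 }. -/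
open MeasureTheory Filter Set
open scoped Pointwise ENNReal NNReal Topology

lemma bv_finite_duality {ι : Type*} [Fintype ι] (P : Set (ι → ℝ)) (hP : P.Finite) (b : ι → ℝ)
    (hb : ∀ i, 0 ≤ b i)
    (h : ∀ c : ι → ℝ, (∀ i, 0 ≤ c i) → (∀ p ∈ P, 1 ≤ ∑ i, c i * p i) → 1 ≤ ∑ i, c i * b i) :
    ∃ q ∈ convexHull ℝ P, ∀ i, q i ≤ b i := by
  classical
  by_contra hcon
  push Not at hcon
  have hdisj : Disjoint (convexHull ℝ P) (Set.Iic b) := by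
    rw [Set.disjoint_left]
    intro q hq hqb
    obtain ⟨i, hi⟩ := hcon q hq
    exact absurd (hqb i) (not_le.mpr hi)
  obtain ⟨f, u, v, h1, h2, h3⟩ := geometric_hahn_banach_compact_closed (convex_convexHull ℝ P)
    (hP.isCompact_convexHull ℝ) (convex_Iic b) isClosed_Iic hdisj
  have hf : ∀ w : ι → ℝ, f w = ∑ i, f (Pi.single i 1) * w i := by
    intro w
    conv_lhs => rw [pi_eq_sum_univ' w]
    rw [map_sum]
    refine Finset.sum_congr rfl fun i _ => ?_
    rw [map_smul, smul_eq_mul, mul_comm]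
  have hneg : ∀ i, f (Pi.single i 1) ≤ 0 := by
    intro i
    by_contra hpos
    push Not at hpos
    set a := f (Pi.single i 1) with ha
    set k : ℝ := max 0 ((f b - v) / a) with hk
    have hk0 : 0 ≤ k := le_max_left _ _
    have hmem : b - k • Pi.single i (1 : ℝ) ∈ Set.Iic b := by
      rw [Set.mem_Iic]
      refine sub_le_self b ?_
      refine smul_nonneg hk0 ?_
      rw [Pi.single_nonneg]; exact zero_le_one
    have := h3 _ hmem
    rw [map_sub, map_smul, smul_eq_mul, ← ha] at this
    have h4 : (f b - v) / a ≤ k := le_max_right _ _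
    rw [div_le_iff₀ hpos] at h4
    linarith
  have hvb : v < f b := h3 b (Set.mem_Iic.mpr le_rfl)
  have hfb : f b ≤ 0 := by
    rw [hf]
    exact Finset.sum_nonpos fun i _ => mul_nonpos_of_nonpos_of_nonneg (hneg i) (hb i)
  have hu : u < 0 := by linarith
  have key := h (fun i => f (Pi.single i 1) / u) (fun i => div_nonneg_of_nonpos (hneg i) hu.le) ?_
  · have : ∑ i, f (Pi.single i 1) / u * b i = f b / u := by
      rw [hf b, Finset.sum_div]
      exact Finset.sum_congr rfl fun i _ => by ring
    rw [this, le_div_iff_of_neg hu] at key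
    linarith
  · intro p hp
    have : ∑ i, f (Pi.single i 1) / u * p i = f p / u := by
      rw [hf p, Finset.sum_div]
      exact Finset.sum_congr rfl fun i _ => by ring
    rw [this, le_div_iff_of_neg hu]
    have := h1 p (subset_convexHull ℝ P hp)
    linarith

lemma bv_finite_frostman {X : Type*} [MeasurableSpace X] {ι : Type*} [Fintype ι]
    (U : ι → Set X) (hU : ∀ i, MeasurableSet (U i)) (K : Set X) (hKm : MeasurableSet K)
    (b : ι → ℝ) (hb : ∀ i, 0 ≤ b i)
    (h : ∀ c : ι → ℝ, (∀ i, 0 ≤ c i) →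
      (∀ x ∈ K, 1 ≤ ∑ i, c i * (U i).indicator (fun _ => (1 : ℝ)) x) → 1 ≤ ∑ i, c i * b i) :
    ∃ μ : Measure X, IsProbabilityMeasure μ ∧ μ K = 1 ∧ ∀ i, μ (U i) ≤ ENNReal.ofReal (b i) := by
  classical
  set P : Set (ι → ℝ) := (fun x i => (U i).indicator (fun _ => (1 : ℝ)) x) '' K with hPdef
  have hPfin : P.Finite := by
    refine (Set.Finite.pi' (t := fun _ : ι => ({0, 1} : Set ℝ)) (fun _ => by simp)).subset ?_
    rintro _ ⟨x, -, rfl⟩ i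
    by_cases hx : x ∈ U i <;> simp [hx]
  obtain ⟨q, hq, hqb⟩ := bv_finite_duality P hPfin b hb (by
    intro c hc hp
    refine h c hc fun x hx => ?_
    exact hp _ ⟨x, hx, rfl⟩)
  set S : Set (ι → ℝ) := {v | ∃ μ : Measure X, IsProbabilityMeasure μ ∧ μ K = 1 ∧
    ∀ i, μ.real (U i) = v i} with hS
  have hPS : P ⊆ S := by
    rintro _ ⟨x, hx, rfl⟩
    refine ⟨Measure.dirac x, inferInstance, ?_, fun i => ?_⟩
    · rw [Measure.dirac_apply' _ hKm]; simp [hx]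
    · rw [measureReal_def, Measure.dirac_apply' _ (hU i)]
      by_cases hxi : x ∈ U i <;> simp [hxi]
  have hSc : Convex ℝ S := by
    rintro v ⟨μ, hμ, hμK, hμv⟩ w ⟨ν, hν, hνK, hνw⟩ α β hα hβ hαβ
    have hsum : ENNReal.ofReal α + ENNReal.ofReal β = 1 := by
      rw [← ENNReal.ofReal_add hα hβ, hαβ, ENNReal.ofReal_one]
    refine ⟨ENNReal.ofReal α • μ + ENNReal.ofReal β • ν, ⟨?_⟩, ?_, fun i => ?_⟩
    · simp [hsum]
    · simp [hμK, hνK, hsum]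
    · rw [measureReal_def, Measure.add_apply, Measure.smul_apply, Measure.smul_apply,
        smul_eq_mul, smul_eq_mul, ENNReal.toReal_add
        (ENNReal.mul_ne_top ENNReal.ofReal_ne_top (measure_ne_top _ _))
        (ENNReal.mul_ne_top ENNReal.ofReal_ne_top (measure_ne_top _ _)),
        ENNReal.toReal_mul, ENNReal.toReal_mul, ENNReal.toReal_ofReal hα,
        ENNReal.toReal_ofReal hβ]
      have h1 := hμv i
      have h2 := hνw i
      rw [measureReal_def] at h1 h2
      rw [h1, h2]; simp
  obtain ⟨μ, hμ, hμK, hμq⟩ := convexHull_min hPS hSc hq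
  refine ⟨μ, hμ, hμK, fun i => ?_⟩
  rw [← ENNReal.ofReal_toReal (measure_ne_top μ (U i))]
  refine ENNReal.ofReal_le_ofReal ?_
  have := hμq i
  rw [measureReal_def] at this
  rw [this]; exact hqb i

lemma bv_frostman {X : Type*} [MetricSpace X] [CompactSpace X] [MeasurableSpace X] [BorelSpace X]
    {I : Type*} (U : I → Set X) (hU : ∀ i, IsOpen (U i)) (K : Set X) (hKc : IsCompact K)
    (b : I → ℝ) (hb : ∀ i, 0 ≤ b i)
    (h : ∀ (S : Finset I) (c : I → ℝ), (∀ i, 0 ≤ c i) →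
      (∀ x ∈ K, 1 ≤ ∑ i ∈ S, c i * (U i).indicator (fun _ => (1 : ℝ)) x) →
        1 ≤ ∑ i ∈ S, c i * b i) :
    ∃ μ : Measure X, IsProbabilityMeasure μ ∧ μ K = 1 ∧ ∀ i, μ (U i) ≤ ENNReal.ofReal (b i) := by
  classical
  have hfin : ∀ S : Finset I, ∃ μ : ProbabilityMeasure X, (μ : Measure X) K = 1 ∧
      ∀ i ∈ S, (μ : Measure X) (U i) ≤ ENNReal.ofReal (b i) := by
    intro S
    obtain ⟨μ, hμ, hμK, hμU⟩ := bv_finite_frostman (fun i : S => U i)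
      (fun i => (hU i).measurableSet) K hKc.measurableSet (fun i : S => b i) (fun i => hb i) (by
        intro c hc hx
        have := h S (fun i => if hi : i ∈ S then c ⟨i, hi⟩ else 0) (by
          intro i; split_ifs; exacts [hc _, le_rfl]) (by
          intro x hxK
          have := hx x hxK
          rw [← Finset.sum_coe_sort]
          simpa using this)
        rw [← Finset.sum_coe_sort] at this
        simpa using this)
    exact ⟨⟨μ, hμ⟩, hμK, fun i hi => hμU ⟨i, hi⟩⟩
  choose m hmK hmU using hfin
  set L : Ultrafilter (Finset I) := Ultrafilter.of atTop with hL
  have hLle : (L : Filter (Finset I)) ≤ atTop := Ultrafilter.of_le _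
  obtain ⟨μ, hμ⟩ : ∃ μ, Tendsto m L (𝓝 μ) := by
    obtain ⟨μ, -, hμ⟩ := (isCompact_univ (X := ProbabilityMeasure X)).ultrafilter_le_nhds
      (L.map m) (by simp)
    exact ⟨μ, hμ⟩
  refine ⟨μ, inferInstance, ?_, fun i => ?_⟩
  · have h1 := ProbabilityMeasure.le_liminf_measure_open_of_tendsto hμ
      hKc.isClosed.isOpen_compl
    have h2 : ∀ S, (m S : Measure X) Kᶜ = 0 := by
      intro S
      rw [prob_compl_eq_zero_iff hKc.measurableSet]; exact hmK S
    simp only [h2] at h1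
    rw [liminf_const] at h1
    rw [← prob_compl_eq_zero_iff hKc.measurableSet]
    exact le_antisymm h1 (zero_le)
  · refine (ProbabilityMeasure.le_liminf_measure_open_of_tendsto hμ (hU i)).trans ?_
    refine liminf_le_of_frequently_le' ?_
    refine Eventually.frequently ?_
    have : ∀ᶠ S : Finset I in atTop, (m S : Measure X) (U i) ≤ ENNReal.ofReal (b i) := by
      filter_upwards [eventually_ge_atTop {i}] with S hS
      exact hmU S i (hS (Finset.mem_singleton_self i))
    exact hLle this

lemma bv_pack {G : Type*} [Group G] {X : Type*} [MetricSpace X] [MulAction G X]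
    (A : Finset G) (ε : ℝ) (hε : 0 < ε) {J : Type*} (S : Finset J) (x : J → X) (c : J → ℝ)
    (hc : ∀ j, 0 ≤ c j) (t : ℝ) (ht : 0 < t) :
    ∃ E : Finset X, t * E.card ≤ ∑ j ∈ S, c j ∧
      ∀ y, t < ∑ j ∈ S, c j * (bowenBall A (x j) ε).indicator (fun _ => (1 : ℝ)) y →
        ∃ e ∈ E, y ∈ bowenBall A e (2 * ε) := by
  classical
  set Q : Finset X → Prop := fun E =>
    (∀ y ∈ E, t < ∑ j ∈ S, c j * (bowenBall A (x j) ε).indicator (fun _ => (1 : ℝ)) y) ∧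
    ∀ y ∈ E, ∀ z ∈ E, z ∈ bowenBall A y (2 * ε) → y = z with hQ
  have hbound : ∀ E, Q E → t * E.card ≤ ∑ j ∈ S, c j := by
    rintro E ⟨h1, h2⟩
    calc t * E.card = ∑ y ∈ E, t := by rw [Finset.sum_const, nsmul_eq_mul, mul_comm]
      _ ≤ ∑ y ∈ E, ∑ j ∈ S, c j * (bowenBall A (x j) ε).indicator (fun _ => (1 : ℝ)) y :=
        Finset.sum_le_sum fun y hy => (h1 y hy).le
      _ = ∑ j ∈ S, ∑ y ∈ E, c j * (bowenBall A (x j) ε).indicator (fun _ => (1 : ℝ)) y :=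
        Finset.sum_comm
      _ ≤ ∑ j ∈ S, c j := by
        refine Finset.sum_le_sum fun j _ => ?_
        rw [← Finset.mul_sum]
        refine mul_le_of_le_one_right (hc j) ?_
        simp only [Set.indicator_apply]
        rw [Finset.sum_boole]
        have : (E.filter fun y => y ∈ bowenBall A (x j) ε).card ≤ 1 := by
          rw [Finset.card_le_one]
          intro y hy z hz
          rw [Finset.mem_filter] at hy hz
          refine h2 y hy.1 z hz.1 fun g hg => ?_
          have ha := hy.2 g hg
          have hb := hz.2 g hg
          have := dist_triangle_left (g • y) (g • z) (g • x j)
          linarith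
        exact_mod_cast this
  obtain ⟨E, hE, hmax⟩ : ∃ E, Q E ∧ ∀ E', Q E' → E'.card ≤ E.card := by
    set W : Set ℕ := {k | ∃ E, Q E ∧ E.card = k} with hW
    have hne : W.Nonempty := ⟨0, ∅, by simp [hQ], rfl⟩
    have hbdd : BddAbove W := by
      refine ⟨⌊(∑ j ∈ S, c j) / t⌋₊, ?_⟩
      rintro _ ⟨E, hE, rfl⟩
      refine Nat.le_floor ?_
      rw [le_div_iff₀ ht, mul_comm]
      exact hbound E hE
    obtain ⟨E, hE, hEc⟩ := Nat.sSup_mem hne hbdd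
    exact ⟨E, hE, fun E' hE' => hEc ▸ le_csSup hbdd ⟨E', hE', rfl⟩⟩
  refine ⟨E, hbound E hE, fun y hy => ?_⟩
  by_contra hcon
  push Not at hcon
  have hself : ∀ z : X, z ∈ bowenBall A z (2 * ε) := fun z g _ => by
    rw [dist_self]; linarith
  have hyE : y ∉ E := fun hyE => hcon y hyE (hself y)
  have hsymm : ∀ a b : X, a ∈ bowenBall A b (2 * ε) → b ∈ bowenBall A a (2 * ε) :=
    fun a b h g hg => by rw [dist_comm]; exact h g hg
  have := hmax (insert y E) (by
    refine ⟨?_, ?_⟩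
    · intro z hz
      rcases Finset.mem_insert.mp hz with rfl | hz
      · exact hy
      · exact hE.1 z hz
    · intro z hz w hw hzw
      rcases Finset.mem_insert.mp hz with rfl | hz' <;>
        rcases Finset.mem_insert.mp hw with rfl | hw'
      · rfl
      · exact absurd (hsymm _ _ hzw) (hcon w hw')
      · exact absurd hzw (hcon z hz')
      · exact hE.2 z hz' w hw' hzw)
  rw [Finset.card_insert_of_notMem hyE] at this
  omega

lemma bv_weighted {G : Type*} [Group G] {X : Type*} [MetricSpace X] [MulAction G X]
    (F : ℕ → Finset G) (K : Set X) (N : ℕ) (ε : ℝ) (hε : 0 < ε) (s δ : ℝ)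
    (hδ : ∀ T : Finset ℕ, ∑ k ∈ T, Real.exp (-δ * ((F (k + N)).card : ℝ)) < 1)
    (hM : 1 ≤ bowenMpre F K N (2 * ε) s)
    (S : Finset (X × ℕ)) (c : X × ℕ → ℝ) (hc : ∀ p, 0 ≤ c p)
    (hcov : ∀ x ∈ K, 1 ≤ ∑ p ∈ S, c p *
      (bowenBall (F (p.2 + N)) p.1 ε).indicator (fun _ => (1 : ℝ)) x) :
    1 ≤ ∑ p ∈ S, c p * Real.exp (-(s - δ) * ((F (p.2 + N)).card : ℝ)) := by
  classical
  set T : Finset ℕ := S.image Prod.snd with hT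
  have hST : ∀ p ∈ S, p.2 ∈ T := fun p hp => Finset.mem_image_of_mem _ hp
  choose E hEc hEcov using fun k : ℕ => bv_pack (F (k + N)) ε hε (S.filter fun p => p.2 = k)
    (fun p => p.1) c hc (Real.exp (-δ * ((F (k + N)).card : ℝ))) (Real.exp_pos _)
  set D : Finset (X × ℕ) := (T.sigma E).image (fun q => (q.2, q.1 + N)) with hD
  have hinj : Set.InjOn (fun q : (_ : ℕ) × X => (q.2, q.1 + N)) (T.sigma E : Set ((_ : ℕ) × X)) := by
    rintro ⟨a, x⟩ _ ⟨b, y⟩ _ h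
    simp only [Prod.mk.injEq, Nat.add_right_cancel_iff] at h
    obtain ⟨rfl, rfl⟩ := h
    rfl
  have hle : bowenMpre F K N (2 * ε) s ≤
      ∑' p : (D : Set (X × ℕ)),
        ENNReal.ofReal (Real.exp (-s * ((F (p : X × ℕ).2).card : ℝ))) := by
    refine iInf₂_le (D : Set (X × ℕ)) ⟨D.countable_toSet, ?_, ?_⟩
    · intro p hp
      obtain ⟨q, -, rfl⟩ := Finset.mem_image.mp (Finset.mem_coe.mp hp)
      exact Nat.le_add_left _ _
    · intro x hx
      have h1 := hcov x hx
      rw [← Finset.sum_fiberwise_of_maps_to hST] at h1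
      obtain ⟨k, hk, hlt⟩ := Finset.exists_lt_of_sum_lt ((hδ T).trans_le h1)
      have h2 : ∀ p ∈ S.filter (fun p => p.2 = k),
          c p * (bowenBall (F (p.2 + N)) p.1 ε).indicator (fun _ => (1 : ℝ)) x =
          c p * (bowenBall (F (k + N)) p.1 ε).indicator (fun _ => (1 : ℝ)) x := by
        intro p hp
        rw [(Finset.mem_filter.mp hp).2]
      rw [Finset.sum_congr rfl h2] at hlt
      obtain ⟨e, he, hxe⟩ := hEcov k x hlt
      refine Set.mem_iUnion₂.mpr ⟨(e, k + N), ?_, hxe⟩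
      refine Finset.mem_coe.mpr (Finset.mem_image.mpr ⟨⟨k, e⟩, ?_, rfl⟩)
      exact Finset.mem_sigma.mpr ⟨hk, he⟩
  have h3 := hM.trans hle
  rw [Finset.tsum_subtype' D (fun p : X × ℕ =>
    ENNReal.ofReal (Real.exp (-s * ((F p.2).card : ℝ)))), hD, Finset.sum_image hinj,
    Finset.sum_sigma, ← ENNReal.ofReal_one] at h3
  have h4 : (1 : ℝ) ≤ ∑ k ∈ T, ((E k).card : ℝ) * Real.exp (-s * ((F (k + N)).card : ℝ)) := by
    have h5 : ∀ k ∈ T, ∑ e ∈ E k, ENNReal.ofReal (Real.exp (-s * ((F (k + N)).card : ℝ))) =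
        ENNReal.ofReal (((E k).card : ℝ) * Real.exp (-s * ((F (k + N)).card : ℝ))) := by
      intro k _
      rw [Finset.sum_const, nsmul_eq_mul, ENNReal.ofReal_mul (Nat.cast_nonneg _),
        ENNReal.ofReal_natCast]
    rw [Finset.sum_congr rfl h5, ← ENNReal.ofReal_sum_of_nonneg (fun k _ => by positivity)] at h3
    exact (ENNReal.ofReal_le_ofReal_iff (Finset.sum_nonneg fun k _ => by positivity)).mp h3
  refine h4.trans ?_
  rw [← Finset.sum_fiberwise_of_maps_to hST]
  refine Finset.sum_le_sum fun k _ => ?_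
  have h6 : ∀ p ∈ S.filter (fun p => p.2 = k),
      c p * Real.exp (-(s - δ) * ((F (p.2 + N)).card : ℝ)) =
      c p * Real.exp (-(s - δ) * ((F (k + N)).card : ℝ)) := by
    intro p hp
    rw [(Finset.mem_filter.mp hp).2]
  rw [Finset.sum_congr rfl h6, ← Finset.sum_mul]
  have h7 : Real.exp (-s * ((F (k + N)).card : ℝ)) =
      Real.exp (-δ * ((F (k + N)).card : ℝ)) * Real.exp (-(s - δ) * ((F (k + N)).card : ℝ)) := by
    rw [← Real.exp_add]; congr 1; ring
  rw [h7, ← mul_assoc]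
  refine mul_le_mul_of_nonneg_right ?_ (Real.exp_pos _).le
  rw [mul_comm]
  exact hEc k

lemma bv_growth_mul {G : Type*} [Group G] [DecidableEq G] (F : ℕ → Finset G) (hGrow : GrowthCond F)
    (δ : ℝ) (hδ : 0 < δ) :
    ∀ᶠ n : ℕ in atTop, 2 * Real.log n ≤ δ * ((F n).card : ℝ) := by
  filter_upwards [hGrow.eventually_ge_atTop (2 / δ), eventually_ge_atTop 2] with n hn hn2
  have hlog : 0 < Real.log n := Real.log_pos (by exact_mod_cast hn2)
  rw [div_le_div_iff₀ hδ hlog] at hn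
  linarith

lemma bv_card_tendsto {G : Type*} [Group G] [DecidableEq G] (F : ℕ → Finset G)
    (hGrow : GrowthCond F) : Tendsto (fun n => ((F n).card : ℝ)) atTop atTop := by
  have h1 : Tendsto (fun n : ℕ => 2 * Real.log n) atTop atTop :=
    (Real.tendsto_log_atTop.comp tendsto_natCast_atTop_atTop).const_mul_atTop two_pos
  refine tendsto_atTop_mono' _ ?_ h1
  filter_upwards [bv_growth_mul F hGrow 1 one_pos] with n hn
  linarith

lemma bv_growth_sum {G : Type*} [Group G] [DecidableEq G] (F : ℕ → Finset G) (hGrow : GrowthCond F)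
    (δ : ℝ) (hδ : 0 < δ) :
    ∃ N₀ : ℕ, ∀ N ≥ N₀, ∀ T : Finset ℕ, ∑ k ∈ T, Real.exp (-δ * ((F (k + N)).card : ℝ)) < 1 := by
  have hs : Summable fun n : ℕ => Real.exp (-δ * ((F n).card : ℝ)) := by
    refine Summable.of_norm_bounded_eventually_nat (g := fun n : ℕ => ((n : ℝ) ^ 2)⁻¹)
      (Real.summable_nat_pow_inv.mpr one_lt_two) ?_
    filter_upwards [bv_growth_mul F hGrow δ hδ, eventually_ge_atTop 1] with n hn hn1
    have hn0 : (0 : ℝ) < n := by exact_mod_cast hn1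
    rw [Real.norm_of_nonneg (Real.exp_pos _).le]
    calc Real.exp (-δ * ((F n).card : ℝ)) ≤ Real.exp (-(2 * Real.log n)) :=
          Real.exp_le_exp.mpr (by linarith)
      _ = ((n : ℝ) ^ 2)⁻¹ := by
        rw [Real.exp_neg, two_mul, Real.exp_add, Real.exp_log hn0, sq]
  obtain ⟨S, hS⟩ := summable_iff_vanishing_norm.mp hs 1 one_pos
  refine ⟨S.sup id + 1, fun N hN T => ?_⟩
  have := hS (T.map (addRightEmbedding N)) (by
    rw [Finset.disjoint_left]
    intro a ha haS
    obtain ⟨k, -, rfl⟩ := Finset.mem_map.mp ha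
    have := Finset.le_sup (f := id) haS
    simp only [addRightEmbedding_apply, id] at this
    omega)
  rw [Finset.sum_map] at this
  exact (le_abs_self _).trans_lt this

lemma bv_isOpen_ball {G : Type*} [Group G] {X : Type*} [MetricSpace X] [MulAction G X]
    [ContinuousConstSMul G X] (A : Finset G) (x : X) (ε : ℝ) : IsOpen (bowenBall A x ε) := by
  have : bowenBall A x ε = ⋂ g ∈ A, {y | dist (g • x) (g • y) < ε} := by
    ext y; simp [bowenBall]
  rw [this]
  refine isOpen_biInter_finset fun g _ => ?_
  exact isOpen_lt (continuous_const.dist (continuous_const_smul g)) continuous_const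

lemma bv_lower {G : Type*} [Group G] [DecidableEq G]
    {X : Type*} [MetricSpace X] [CompactSpace X] [MulAction G X] [ContinuousConstSMul G X]
    [MeasurableSpace X] [BorelSpace X]
    (F : ℕ → Finset G) (hGrow : GrowthCond F) (K : Set X) (hKc : IsCompact K)
    (s : ℝ) (hs : bowenMeasure F K s = ⊤) (δ : ℝ) (hδ : 0 < δ) :
    ∃ μ : Measure X, (IsProbabilityMeasure μ ∧ μ K = 1) ∧
      ENNReal.ofReal (s - δ) ≤ ∫⁻ x, localLowerEntropy F μ x ∂μ := by
  have h1 : (1 : ℝ≥0∞) < bowenMeasure F K s := by rw [hs]; exact ENNReal.one_lt_top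
  unfold bowenMeasure at h1
  simp only [lt_iSup_iff] at h1
  obtain ⟨ε, hε, N₁, hN₁⟩ := h1
  obtain ⟨N₂, hN₂⟩ := bv_growth_sum F hGrow δ hδ
  obtain ⟨N₃, hN₃⟩ := eventually_atTop.mp ((bv_card_tendsto F hGrow).eventually_gt_atTop 0)
  set N := max N₁ (max N₂ N₃) with hN
  have hM : 1 ≤ bowenMpre F K N (2 * (ε / 2)) s := by
    rw [mul_div_cancel₀ ε two_ne_zero]
    refine hN₁.le.trans ?_
    refine le_iInf₂ fun C hC => iInf₂_le C ⟨hC.1, fun p hp => ?_, hC.2.2⟩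
    exact (le_max_left _ _).trans (hC.2.1 p hp)
  obtain ⟨μ, hμ, hμK, hμU⟩ := bv_frostman
    (fun p : X × ℕ => bowenBall (F (p.2 + N)) p.1 (ε / 2)) (fun p => bv_isOpen_ball _ _ _) K hKc
    (fun p => Real.exp (-(s - δ) * ((F (p.2 + N)).card : ℝ))) (fun p => (Real.exp_pos _).le)
    (fun S c hc hcov => bv_weighted F K N (ε / 2) (half_pos hε) s δ
      (hN₂ N ((le_max_left _ _).trans (le_max_right _ _))) hM S c hc hcov)
  refine ⟨μ, ⟨hμ, hμK⟩, ?_⟩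
  have hpos : ∀ᵐ x ∂μ, ∀ n : ℕ, μ (bowenBall (F n) x (ε / 2)) ≠ 0 := by
    rw [ae_all_iff]
    intro n
    rw [ae_iff]
    refine measure_null_of_locally_null _ fun x hx => ?_
    refine ⟨bowenBall (F n) x (ε / 2), mem_nhdsWithin_of_mem_nhds
      ((bv_isOpen_ball _ _ _).mem_nhds ?_), by simpa using hx⟩
    intro g _
    rw [dist_self]; exact half_pos hε
  calc ENNReal.ofReal (s - δ) = ∫⁻ _, ENNReal.ofReal (s - δ) ∂μ := by simp
    _ ≤ ∫⁻ x, localLowerEntropy F μ x ∂μ := by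
      refine lintegral_mono_ae ?_
      filter_upwards [hpos] with x hx
      refine le_trans ?_ (le_iSup₂ (f := fun (δ : ℝ) (_ : 0 < δ) => liminf (fun n =>
        ENNReal.ofReal (-(Real.log ((μ (bowenBall (F n) x δ)).toReal)) / (F n).card)) atTop)
        (ε / 2) (half_pos hε))
      refine le_liminf_of_le (by isBoundedDefault) ?_
      filter_upwards [eventually_ge_atTop N] with n hn
      refine ENNReal.ofReal_le_ofReal ?_
      have hcard : (0 : ℝ) < (F n).card :=
        hN₃ n (((le_max_right _ _).trans (le_max_right _ _)).trans hn)
      rw [le_div_iff₀ hcard]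
      have h2 := hμU (x, n - N)
      simp only [Nat.sub_add_cancel hn] at h2
      have h3 := ENNReal.toReal_le_of_le_ofReal (Real.exp_pos _).le h2
      have h4 := Real.log_le_log (ENNReal.toReal_pos (hx n) (measure_ne_top _ _)) h3
      rw [Real.log_exp] at h4
      linarith

lemma bv_upper {G : Type*} [Group G] [DecidableEq G]
    {X : Type*} [MetricSpace X] [CompactSpace X] [MulAction G X] [ContinuousConstSMul G X]
    [MeasurableSpace X] [BorelSpace X]
    (F : ℕ → Finset G) (hGrow : GrowthCond F) (K : Set X)
    (hKc : IsCompact K) (μ : Measure X) [IsProbabilityMeasure μ] (hμK : μ K = 1)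
    (r : ℝ≥0) (hr : (r : ℝ≥0∞) < ∫⁻ x, localLowerEntropy F μ x ∂μ) (s : ℝ) (hs : s < r) :
    bowenMeasure F K s = ⊤ := by
  have h1 : ¬ ∀ᵐ x ∂μ, localLowerEntropy F μ x ≤ r := by
    intro hae
    have := lintegral_mono_ae hae
    simp only [lintegral_const, measure_univ, mul_one] at this
    exact absurd hr (not_lt.mpr this)
  rw [ae_iff] at h1
  set A : ℕ → ℕ → Set X := fun k M => {x | ∀ n ≥ M,
    μ (bowenBall (F n) x (1 / ((k : ℝ) + 1))) ≤
      ENNReal.ofReal (Real.exp (-(r : ℝ) * ((F n).card : ℝ)))} with hA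
  have hsub : {x | ¬ localLowerEntropy F μ x ≤ r} ⊆ ⋃ k, ⋃ M, A k M := by
    intro x hx
    replace hx : (r : ℝ≥0∞) < localLowerEntropy F μ x := not_le.mp hx
    unfold localLowerEntropy at hx
    simp only [lt_iSup_iff] at hx
    obtain ⟨δ, hδ, hlt⟩ := hx
    have hev := eventually_lt_of_lt_liminf hlt
    obtain ⟨M, hM⟩ := eventually_atTop.mp hev
    obtain ⟨k, hk⟩ := exists_nat_one_div_lt hδ
    refine Set.mem_iUnion₂.mpr ⟨k, M, fun n hn => ?_⟩
    have h0 := hM n hn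
    have hmono : bowenBall (F n) x (1 / ((k : ℝ) + 1)) ⊆ bowenBall (F n) x δ :=
      fun y hy g hg => (hy g hg).trans hk
    refine (measure_mono hmono).trans ?_
    rw [← ENNReal.ofReal_toReal (measure_ne_top μ (bowenBall (F n) x δ))]
    refine ENNReal.ofReal_le_ofReal ?_
    set m := (μ (bowenBall (F n) x δ)).toReal with hm
    rw [← ENNReal.ofReal_coe_nnreal] at h0
    have h2 := (ENNReal.ofReal_lt_ofReal_iff_of_nonneg (NNReal.coe_nonneg r)).mp h0
    have hm0 : 0 ≤ m := ENNReal.toReal_nonneg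
    rcases hm0.eq_or_lt with hmz | hmpos
    · rw [← hmz]; exact (Real.exp_pos _).le
    · have hcard : (0 : ℝ) < (F n).card := by
        rcases (Nat.cast_nonneg (α := ℝ) (F n).card).eq_or_lt with h | h
        · rw [← h, div_zero] at h2
          exact absurd (NNReal.coe_nonneg r) (not_le.mpr h2)
        · exact h
      rw [lt_div_iff₀ hcard] at h2
      rw [← Real.log_le_iff_le_exp hmpos]
      linarith
  obtain ⟨k, M, hkM⟩ : ∃ k M, μ (A k M) ≠ 0 := by
    by_contra hcon
    push Not at hcon
    refine h1 (measure_mono_null hsub ?_)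
    exact measure_iUnion_null fun k => measure_iUnion_null fun M => hcon k M
  have hKnull : μ Kᶜ = 0 := (prob_compl_eq_zero_iff hKc.measurableSet).mpr hμK
  have hB : μ (A k M ∩ K) ≠ 0 := by
    rw [measure_inter_conull hKnull]; exact hkM
  have hε : (0 : ℝ) < 1 / ((k : ℝ) + 1) := Nat.one_div_pos_of_nat
  set ε : ℝ := 1 / ((k : ℝ) + 1) with hεdef
  have hmain : ∀ L : ℝ≥0, (L : ℝ≥0∞) * μ (A k M ∩ K) ≤ bowenMeasure F K s := by
    intro L
    have hexp : Tendsto (fun n => Real.exp ((r - s) * ((F n).card : ℝ))) atTop atTop :=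
      Real.tendsto_exp_atTop.comp
        ((bv_card_tendsto F hGrow).const_mul_atTop (sub_pos.mpr hs))
    obtain ⟨N₁, hN₁⟩ := eventually_atTop.mp (hexp.eventually_ge_atTop (L : ℝ))
    refine le_trans ?_ (le_iSup₂ (f := fun (ε : ℝ) (_ : 0 < ε) => ⨆ N : ℕ, bowenMpre F K N ε s)
      (ε / 2) (half_pos hε))
    refine le_trans ?_ (le_iSup (fun N : ℕ => bowenMpre F K N (ε / 2) s) (max M N₁))
    refine le_iInf₂ fun C hC => ?_
    obtain ⟨hCc, hCN, hCcov⟩ := hC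
    have hcov : A k M ∩ K ⊆ ⋃ p ∈ C, (bowenBall (F p.2) p.1 (ε / 2) ∩ A k M) := by
      rintro x ⟨hxA, hxK⟩
      obtain ⟨p, hp, hxp⟩ := Set.mem_iUnion₂.mp (hCcov hxK)
      exact Set.mem_iUnion₂.mpr ⟨p, hp, hxp, hxA⟩
    have h2 := (measure_mono (μ := μ) hcov).trans (measure_biUnion_le μ hCc _)
    refine (mul_le_mul_right h2 (L : ℝ≥0∞)).trans ?_
    rw [← ENNReal.tsum_mul_left]
    refine ENNReal.tsum_le_tsum fun p => ?_
    rcases (bowenBall (F (p : X × ℕ).2) (p : X × ℕ).1 (ε / 2) ∩ A k M).eq_empty_or_nonempty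
      with hem | ⟨y, hyb, hyA⟩
    · rw [hem, measure_empty, mul_zero]; exact zero_le
    · have hpN := hCN p p.2
      have h3 : bowenBall (F (p : X × ℕ).2) (p : X × ℕ).1 (ε / 2) ∩ A k M ⊆
          bowenBall (F (p : X × ℕ).2) y ε := by
        rintro z ⟨hz, -⟩ g hg
        have ha := hyb g hg
        have hb := hz g hg
        have := dist_triangle_left (g • y) (g • z) (g • (p : X × ℕ).1)
        linarith
      have h4 := (measure_mono (μ := μ) h3).trans (hyA _ ((le_max_left _ _).trans hpN))
      refine (mul_le_mul_right h4 (L : ℝ≥0∞)).trans ?_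
      rw [← ENNReal.ofReal_coe_nnreal, ← ENNReal.ofReal_mul (NNReal.coe_nonneg L)]
      refine ENNReal.ofReal_le_ofReal ?_
      have h5 := hN₁ _ ((le_max_right _ _).trans hpN)
      refine (mul_le_mul_of_nonneg_right h5 (Real.exp_pos _).le).trans ?_
      rw [← Real.exp_add]
      refine Real.exp_le_exp.mpr (le_of_eq ?_)
      ring
  by_contra hne
  have hBtop : μ (A k M ∩ K) ≠ ⊤ := measure_ne_top _ _
  set q : ℝ≥0∞ := bowenMeasure F K s / μ (A k M ∩ K) with hq
  have hqtop : q ≠ ⊤ := ENNReal.div_ne_top hne hB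
  have h6 := hmain (q.toNNReal + 1)
  rw [← ENNReal.le_div_iff_mul_le (Or.inl hB) (Or.inl hBtop), ← hq, ENNReal.coe_add,
    ENNReal.coe_toNNReal hqtop, ENNReal.coe_one] at h6
  exact absurd h6 (not_le.mpr (ENNReal.lt_add_right hqtop one_ne_zero))



variable {G : Type*} [Group G] [Countable G] [Infinite G] [DecidableEq G]
  {X : Type*} [MetricSpace X] [CompactSpace X] [MulAction G X] [ContinuousConstSMul G X]
  [MeasurableSpace X] [BorelSpace X]

theorem bowenEntropy_compact_variational
    (hAmen : ∃ Φ : ℕ → Finset G, IsFolnerSeq Φ)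
    (F : ℕ → Finset G) (hGrow : GrowthCond F)
    (K : Set X) (hK : K.Nonempty) (hKc : IsCompact K) :
    bowenEntropy F K =
      ⨆ (μ : Measure X) (_ : IsProbabilityMeasure μ ∧ μ K = 1),
        ∫⁻ x, localLowerEntropy F μ x ∂μ := by
  refine le_antisymm ?_ ?_
  · refine iSup₂_le fun s hs => ?_
    refine ENNReal.le_of_forall_pos_le_add fun δ hδ _ => ?_
    obtain ⟨μ, hμ, hle⟩ := bv_lower F hGrow K hKc s hs δ (by exact_mod_cast hδ)
    have h1 : ENNReal.ofReal s ≤ ENNReal.ofReal (s - δ) + δ := by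
      rw [← ENNReal.ofReal_coe_nnreal]
      refine le_trans (ENNReal.ofReal_le_ofReal ?_) ENNReal.ofReal_add_le
      linarith
    refine h1.trans ?_
    gcongr
    exact hle.trans (le_iSup₂ (f := fun (μ : Measure X) (_ : IsProbabilityMeasure μ ∧ μ K = 1) =>
      ∫⁻ x, localLowerEntropy F μ x ∂μ) μ hμ)
  · refine iSup₂_le fun μ hμ => ?_
    have := hμ.1
    refine ENNReal.le_of_forall_nnreal_lt fun r hr => ?_
    refine ENNReal.le_of_forall_pos_le_add fun δ hδ _ => ?_
    have hδ' : (0 : ℝ) < δ := by exact_mod_cast hδ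
    have htop := bv_upper F hGrow K hKc μ hμ.2 r hr (r - δ) (by linarith)
    have h1 : (r : ℝ≥0∞) ≤ ENNReal.ofReal ((r : ℝ) - δ) + δ := by
      rw [← ENNReal.ofReal_coe_nnreal (p := r), ← ENNReal.ofReal_coe_nnreal (p := δ)]
      refine le_trans (ENNReal.ofReal_le_ofReal ?_) ENNReal.ofReal_add_le
      linarith
    refine h1.trans ?_
    gcongr
    exact le_iSup₂ (f := fun (s : ℝ) (_ : bowenMeasure F K s = ⊤) => ENNReal.ofReal s)
      ((r : ℝ) - δ) htop
end
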